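/- Let k ≥ 2, 3 ≤ r ≤ 2k and n ≥ 712k be integers. If G is an n-vertex C_{2k+1}-free simple graph with λ(G) ≥ λ(T_{n−r+1,2}∘K_r), then either G belongs to the family 𝒢_{n,r}, or G is isomorphic to T_{n−r+1,2}∘K_r. -/

import Mathlib

/-- A graph is `m`-cycle-free if it contains no cycle of length `m`. -/
def SimpleGraph.CycleFree {V : Type*} (G : SimpleGraph V) (m : ℕ) : Prop :=
  ∀ ⦃v : V⦄ (w : G.Walk v v), w.IsCycle → w.length ≠ m

/-- The spectral radius of a finite graph: the largest (real) eigenvalue of its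
adjacency matrix, i.e. the supremum of the set of real eigenvalues. -/
noncomputable def SimpleGraph.specRad {V : Type*} [Fintype V] (G : SimpleGraph V) : ℝ :=
  letI : DecidableRel G.Adj := Classical.decRel _
  sSup {μ : ℝ | ∃ x : V → ℝ, x ≠ 0 ∧ (SimpleGraph.adjMatrix ℝ G).mulVec x = μ • x}

/-- A graph is 2-connected if it has at least 3 vertices, is connected, and removing
any single vertex leaves it connected. -/
def SimpleGraph.TwoConnected {V : Type*} (G : SimpleGraph V) : Prop :=
  3 ≤ Nat.card V ∧ G.Connected ∧
    ∀ v : V, (G.induce (({v} : Set V)ᶜ)).Connected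

/-- `turanSuspAt n q v0`: the `n`-vertex graph obtained from the complete bipartite graph
with parts `{0, …, q/2 - 1}` and `{q/2, …, q-1}` (the bipartite Turán graph `T_{q,2}`)
by putting a clique on `{v0} ∪ {q, …, n-1}`; for `v0 < q` this is `T_{q,2}` with a
clique `K_{n-q+1}` suspended at the vertex `v0`. -/
def turanSuspAt (n q v0 : ℕ) : SimpleGraph (Fin n) :=
  SimpleGraph.fromRel (fun i j =>
    ((i : ℕ) < q / 2 ∧ q / 2 ≤ (j : ℕ) ∧ (j : ℕ) < q) ∨
    (((i : ℕ) = v0 ∨ q ≤ (i : ℕ)) ∧ ((j : ℕ) = v0 ∨ q ≤ (j : ℕ))))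

/-- The family `𝒢_{n,r}`: graphs obtained from a bipartite graph by suspending graphs
`G_1, …, G_s` whose parts outside the bipartite graph have at most `r - 2` vertices
in total. -/
def FamilyG (n r : ℕ) (G : SimpleGraph (Fin n)) : Prop :=
  ∃ (s : ℕ) (W : Fin s → Finset (Fin n)) (v : Fin s → Fin n),
    (∀ i j, i ≠ j → Disjoint (W i) (W j)) ∧
    (Finset.univ.biUnion W).card ≤ r - 2 ∧
    (∀ i, v i ∉ Finset.univ.biUnion W) ∧
    (∃ A : Set (Fin n), ∀ x y, G.Adj x y →
        x ∉ Finset.univ.biUnion W → y ∉ Finset.univ.biUnion W →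
        ((x ∈ A ∧ y ∉ A) ∨ (x ∉ A ∧ y ∈ A))) ∧
    (∀ i j, i ≠ j → ∀ x ∈ W i, ∀ y ∈ W j, ¬ G.Adj x y) ∧
    (∀ i, ∀ x ∈ W i, ∀ y, G.Adj x y → y ∉ Finset.univ.biUnion W → y = v i)

/-- The family `𝒢*_{n,r}`: as `FamilyG`, but with exactly `r - 2` vertices outside the
bipartite part. -/
def FamilyGStar (n r : ℕ) (G : SimpleGraph (Fin n)) : Prop :=
  ∃ (s : ℕ) (W : Fin s → Finset (Fin n)) (v : Fin s → Fin n),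
    (∀ i j, i ≠ j → Disjoint (W i) (W j)) ∧
    (Finset.univ.biUnion W).card = r - 2 ∧
    (∀ i, v i ∉ Finset.univ.biUnion W) ∧
    (∃ A : Set (Fin n), ∀ x y, G.Adj x y →
        x ∉ Finset.univ.biUnion W → y ∉ Finset.univ.biUnion W →
        ((x ∈ A ∧ y ∉ A) ∨ (x ∉ A ∧ y ∈ A))) ∧
    (∀ i j, i ≠ j → ∀ x ∈ W i, ∀ y ∈ W j, ¬ G.Adj x y) ∧
    (∀ i, ∀ x ∈ W i, ∀ y, G.Adj x y → y ∉ Finset.univ.biUnion W → y = v i)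

/-- `H` is a `k`-dense bipartite graph: bipartite, 2-connected, any two distinct vertices
in the same part are joined by paths of every odd order `5 ≤ h ≤ 2k+1`, and any two
vertices in different parts are joined by paths of every even order `6 ≤ s ≤ 2k+2`. -/
def KDenseBip {V : Type*} (k : ℕ) (H : SimpleGraph V) : Prop :=
  H.TwoConnected ∧
  ∃ A : Set V,
    (∀ ⦃x y : V⦄, H.Adj x y → ((x ∈ A ∧ y ∉ A) ∨ (x ∉ A ∧ y ∈ A))) ∧
    (∀ u v : V, u ≠ v → (u ∈ A ↔ v ∈ A) → ∀ h : ℕ, Odd h → 5 ≤ h → h ≤ 2 * k + 1 →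
      ∃ p : H.Walk u v, p.IsPath ∧ p.length + 1 = h) ∧
    (∀ u v : V, ¬(u ∈ A ↔ v ∈ A) → ∀ s : ℕ, Even s → 6 ≤ s → s ≤ 2 * k + 2 →
      ∃ p : H.Walk u v, p.IsPath ∧ p.length + 1 = s)

/-- The graph obtained from the complete bipartite graph with parts `{0, …, a}` (size `a+1`)
and `{a+1, …, a+b}` (size `b`) by identifying the vertex `0` with one vertex of a clique
on `r-1` vertices whose remaining `r-2` vertices `{a+b+1, …, a+b+r-2}` are new. -/
def bipCliqueGraph (a b r : ℕ) : SimpleGraph (Fin (a + b + r - 1)) :=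
  SimpleGraph.fromRel (fun i j =>
    ((i : ℕ) ≤ a ∧ a + 1 ≤ (j : ℕ) ∧ (j : ℕ) ≤ a + b) ∨
    (((i : ℕ) = 0 ∨ a + b + 1 ≤ (i : ℕ)) ∧ ((j : ℕ) = 0 ∨ a + b + 1 ≤ (j : ℕ))))

set_option linter.unusedSectionVars false

namespace SimpleGraph

section Spectral

open Finset

variable {V : Type*} [Fintype V]

/-- The quadratic form of the adjacency matrix. -/
def adjForm (G : SimpleGraph V) [DecidableRel G.Adj] (x y : V → ℝ) : ℝ :=
  ∑ v, x v * ∑ w with G.Adj v w, y w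

variable (G : SimpleGraph V) [DecidableRel G.Adj]

theorem adjForm_comm (x y : V → ℝ) : G.adjForm x y = G.adjForm y x := by
  simp only [adjForm, Finset.mul_sum, Finset.sum_filter]
  rw [Finset.sum_comm]
  refine Finset.sum_congr rfl fun v _ => Finset.sum_congr rfl fun w _ => ?_
  simp only [G.adj_comm w v]
  split_ifs <;> ring

theorem adjForm_add_smul (x y : V → ℝ) (t : ℝ) :
    G.adjForm (x + t • y) (x + t • y)
      = G.adjForm x x + 2 * t * G.adjForm y x + t ^ 2 * G.adjForm y y := by
  have h := G.adjForm_comm x y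
  have e : G.adjForm (x + t • y) (x + t • y)
      = G.adjForm x x + t * G.adjForm x y + t * G.adjForm y x + t ^ 2 * G.adjForm y y := by
    simp only [adjForm, Pi.add_apply, Pi.smul_apply, smul_eq_mul,
      Finset.mul_sum, ← Finset.sum_add_distrib]
    refine Finset.sum_congr rfl fun v _ => ?_
    refine Finset.sum_congr rfl fun w _ => ?_
    ring
  rw [e, h]; ring

theorem exists_rayleigh_max [Nonempty V] :
    ∃ (μ : ℝ) (x : V → ℝ), (∀ v, 0 ≤ x v) ∧ ∑ v, x v ^ 2 = 1 ∧ G.adjForm x x = μ ∧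
      ∀ y : V → ℝ, G.adjForm y y ≤ μ * ∑ v, y v ^ 2 := by
  classical
  have hcpt : IsCompact {y : V → ℝ | ∑ v, y v ^ 2 = 1} := by
    refine Metric.isCompact_of_isClosed_isBounded
      (isClosed_eq (by fun_prop) continuous_const) ?_
    refine (Metric.isBounded_closedBall (x := (0 : V → ℝ)) (r := 1)).subset fun y hy => ?_
    rw [mem_closedBall_zero_iff, pi_norm_le_iff_of_nonneg zero_le_one]
    intro i
    have h1 : y i ^ 2 ≤ ∑ v, y v ^ 2 :=
      Finset.single_le_sum (f := fun v => y v ^ 2) (fun v _ => sq_nonneg _) (Finset.mem_univ i)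
    rw [Set.mem_ofPred_eq] at hy
    rw [Real.norm_eq_abs, abs_le_one_iff_mul_self_le_one]
    nlinarith
  obtain ⟨v0⟩ := ‹Nonempty V›
  have hne : {y : V → ℝ | ∑ v, y v ^ 2 = 1}.Nonempty :=
    ⟨Pi.single v0 1, by simp [Pi.single_apply]⟩
  have hcont : Continuous fun y : V → ℝ => G.adjForm y y := by
    unfold adjForm; fun_prop
  obtain ⟨z, hz, hmax⟩ := hcpt.exists_isMaxOn hne hcont.continuousOn
  have hray : ∀ y : V → ℝ, G.adjForm y y ≤ G.adjForm z z * ∑ v, y v ^ 2 := by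
    intro y
    rcases (Finset.sum_nonneg fun v (_ : v ∈ Finset.univ) => sq_nonneg (y v)).eq_or_lt with h0 | h0
    · have hy : ∀ v, y v = 0 := fun v => by
        have := (Finset.sum_eq_zero_iff_of_nonneg
          fun v (_ : v ∈ Finset.univ) => sq_nonneg (y v)).1 h0.symm v (Finset.mem_univ v)
        simpa using this
      simp [adjForm, hy]
    · set s := ∑ v, y v ^ 2 with hs
      have hsq : Real.sqrt s ^ 2 = s := Real.sq_sqrt h0.le
      have hsp : 0 < Real.sqrt s := Real.sqrt_pos.2 h0
      have hmem : (fun v => y v / Real.sqrt s) ∈ {y : V → ℝ | ∑ v, y v ^ 2 = 1} := by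
        simp only [Set.mem_ofPred_eq, div_pow, hsq]
        rw [← Finset.sum_div, ← hs, div_self h0.ne']
      have h1 := hmax hmem
      simp only [Set.mem_ofPred_eq] at h1
      have h2 : G.adjForm (fun v => y v / Real.sqrt s) (fun v => y v / Real.sqrt s)
          = G.adjForm y y / s := by
        simp only [adjForm]
        rw [Finset.sum_div]
        refine Finset.sum_congr rfl fun v _ => ?_
        rw [← Finset.sum_div, div_mul_div_comm, ← pow_two, hsq]
      rw [h2, div_le_iff₀ h0] at h1
      exact h1
  have habs : ∑ v, |z v| ^ 2 = 1 := by simpa [sq_abs] using hz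
  refine ⟨G.adjForm z z, fun v => |z v|, fun v => abs_nonneg _, habs, ?_, hray⟩
  refine le_antisymm ?_ ?_
  · have := hray fun v => |z v|
    rwa [habs, mul_one] at this
  · simp only [adjForm, Finset.mul_sum]
    refine Finset.sum_le_sum fun v _ => Finset.sum_le_sum fun w _ => ?_
    rw [← abs_mul]; exact le_abs_self _

/-- The spectral radius has a nonnegative eigenvector and bounds all Rayleigh quotients. -/
theorem exists_nonneg_eigenvector [Nonempty V] :
    ∃ x : V → ℝ, (∀ v, 0 ≤ x v) ∧ x ≠ 0 ∧
      (∀ v, G.specRad * x v = ∑ w with G.Adj v w, x w) ∧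
      ∀ y : V → ℝ, G.adjForm y y ≤ G.specRad * ∑ v, y v ^ 2 := by
  classical
  obtain ⟨μ, x, hx0, hx1, hxμ, hray⟩ := G.exists_rayleigh_max
  have heig : ∀ v, μ * x v = ∑ w with G.Adj v w, x w := by
    intro v
    have key : ∀ t : ℝ, 0 ≤ 2 * t * (μ * x v - ∑ w with G.Adj v w, x w) + t ^ 2 * μ := by
      intro t
      have h1 := hray (x + t • Pi.single v 1)
      rw [adjForm_add_smul] at h1
      have h2 : G.adjForm (Pi.single v 1) x = ∑ w with G.Adj v w, x w := by
        simp [adjForm, Pi.single_apply]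
      have h3 : G.adjForm (Pi.single v 1) (Pi.single v 1) = 0 := by
        simp only [adjForm, Finset.sum_filter, Pi.single_apply, Finset.mul_sum]
        refine Finset.sum_eq_zero fun a _ => Finset.sum_eq_zero fun b _ => ?_
        by_cases ha : a = v <;> by_cases hb : b = v <;> simp [ha, hb]
      have h4 : ∑ w, (x + t • Pi.single v (1 : ℝ) : V → ℝ) w ^ 2 = 1 + 2 * t * x v + t ^ 2 := by
        have : ∀ w, (x + t • Pi.single v (1 : ℝ) : V → ℝ) w ^ 2
            = x w ^ 2 + 2 * t * (if w = v then x w else 0) + t ^ 2 * (if w = v then 1 else 0) := by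
          intro w
          by_cases h : w = v <;> simp [h]; ring
        simp only [this, Finset.sum_add_distrib, ← Finset.mul_sum, hx1]
        simp
      rw [h2, h3, h4, hxμ] at h1
      linarith
    set c := μ * x v - ∑ w with G.Adj v w, x w with hc
    have hc0 : c = 0 := by
      by_contra hne
      have hc2 : 0 < c ^ 2 := by positivity
      have hM : 0 < |μ| + 1 := by positivity
      have h1 := key (-c / (|μ| + 1))
      have h2 : 2 * (-c / (|μ| + 1)) * c + (-c / (|μ| + 1)) ^ 2 * μ
          = c ^ 2 / (|μ| + 1) ^ 2 * (μ - 2 * (|μ| + 1)) := by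
        field_simp; ring
      rw [h2] at h1
      have h3 : μ - 2 * (|μ| + 1) < 0 := by linarith [le_abs_self μ, abs_nonneg μ]
      have h4 : 0 < c ^ 2 / (|μ| + 1) ^ 2 := by positivity
      nlinarith
    linarith
  have hxne : x ≠ 0 := by
    rintro rfl; simp at hx1
  have hspec : G.specRad = μ := by
    refine IsGreatest.csSup_eq ⟨⟨x, hxne, ?_⟩, ?_⟩
    · ext v
      rw [Pi.smul_apply, smul_eq_mul, heig v, adjMatrix_mulVec_apply]
      refine Finset.sum_congr ?_ fun _ _ => rfl
      ext w; simp
    · rintro ν ⟨y, hy0, hy⟩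
      have h1 := hray y
      have h2 : G.adjForm y y = ν * ∑ v, y v ^ 2 := by
        rw [adjForm, Finset.mul_sum]
        refine Finset.sum_congr rfl fun v _ => ?_
        have := congrFun hy v
        rw [Pi.smul_apply, smul_eq_mul, adjMatrix_mulVec_apply] at this
        have h3 : ∑ w with G.Adj v w, y w = ν * y v := by
          rw [← this]
          refine Finset.sum_congr ?_ fun _ _ => rfl
          ext w; simp
        rw [h3]; ring
      have h3 : 0 < ∑ v, y v ^ 2 := by
        obtain ⟨v, hv⟩ := Function.ne_iff.1 hy0
        exact Finset.sum_pos' (fun v _ => sq_nonneg _) ⟨v, Finset.mem_univ v, by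
          have : y v ≠ 0 := hv
          positivity⟩
      rw [h2] at h1
      exact le_of_mul_le_mul_right h1 h3
  rw [hspec]
  exact ⟨x, hx0, hxne, heig, hray⟩

end Spectral

section ListPaths

variable {V : Type*} {G : SimpleGraph V}

/-- `G.LPath a l b` says that `a, l, b` lists the consecutive vertices of a walk in `G`. -/
def LPath (G : SimpleGraph V) (a : V) (l : List V) (b : V) : Prop :=
  List.IsChain G.Adj (a :: (l ++ [b]))

theorem lPath_nil {a b : V} : G.LPath a [] b ↔ G.Adj a b := by
  simp [LPath]

theorem lPath_cons {a c b : V} {l : List V} :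
    G.LPath a (c :: l) b ↔ G.Adj a c ∧ G.LPath c l b := by
  simp [LPath, List.isChain_cons_cons]

theorem lPath_append {a c b : V} {l l' : List V} :
    G.LPath a (l ++ c :: l') b ↔ G.LPath a l c ∧ G.LPath c l' b := by
  induction l generalizing a with
  | nil => simp [lPath_nil, lPath_cons]
  | cons d l ih => simp [lPath_cons, ih, and_assoc]

theorem LPath.append {a c b : V} {l l' : List V} (h : G.LPath a l c) (h' : G.LPath c l' b) :
    G.LPath a (l ++ c :: l') b := lPath_append.2 ⟨h, h'⟩

theorem LPath.reverse {a b : V} {l : List V} (h : G.LPath a l b) : G.LPath b l.reverse a := by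
  have h1 : List.IsChain (flip G.Adj) (a :: (l ++ [b])).reverse := List.isChain_reverse.2 h
  have h2 : (a :: (l ++ [b])).reverse = b :: (l.reverse ++ [a]) := by simp
  rw [h2] at h1
  exact h1.imp fun x y hxy => G.adj_symm hxy

theorem CycleFree.false_of_lPath {m : ℕ} (hfree : G.CycleFree m) {a : V} {l : List V}
    (h : G.LPath a l a) (hnd : (a :: l).Nodup) (hl : 2 ≤ l.length) (hm : l.length + 1 = m) :
    False := by
  obtain _ | ⟨c, l⟩ := l
  · simp at hl
  rw [lPath_cons] at h
  have hne : c :: (l ++ [a]) ≠ [] := by simp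
  have hp : ∃ p : G.Walk c a, p.support = c :: (l ++ [a]) := by
    have h2 : (c :: (l ++ [a])).head hne = c := by simp
    have h3 : (c :: (l ++ [a])).getLast hne = a := by simp
    refine ⟨(Walk.ofSupport (c :: (l ++ [a])) hne h.2).copy h2 h3, ?_⟩
    rw [Walk.support_copy]
    exact Walk.support_ofSupport _ _
  obtain ⟨p, hp⟩ := hp
  have hpath : p.IsPath := by
    rw [Walk.isPath_def, hp]
    rw [List.nodup_cons] at hnd ⊢
    simp only [List.mem_cons, not_or, List.nodup_cons] at hnd
    simp only [List.mem_append, List.mem_singleton, not_or]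
    refine ⟨⟨hnd.2.1, fun e => hnd.1.1 e.symm⟩, ?_⟩
    rw [List.nodup_append]
    refine ⟨hnd.2.2, by simp, ?_⟩
    intro x hx y hy
    rw [List.mem_singleton] at hy
    rintro rfl
    exact hnd.1.2 (hy ▸ hx)
  have hlen : p.length = l.length + 1 := by
    have := p.length_support
    rw [hp] at this
    simp at this
    omega
  have hcyc : (Walk.cons h.1 p).IsCycle := by
    rw [Walk.cons_isCycle_iff]
    refine ⟨hpath, fun he => ?_⟩
    have hl2 : 2 ≤ p.length := by rw [hlen]; simpa using hl
    cases p with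
    | nil => simp at hl2
    | cons hadj q =>
      rename_i d
      rw [Walk.edges_cons, List.mem_cons] at he
      have hpq := (Walk.cons_isPath_iff hadj q).1 hpath
      rcases he with he | he
      · rw [Sym2.eq_iff] at he
        rcases he with ⟨h5, -⟩ | ⟨h5, -⟩
        · exact h.1.ne h5
        · subst h5
          have := Walk.length_eq_zero_iff.2 (Walk.isPath_iff_nil.1 hpq.1)
          rw [Walk.length_cons, this] at hl2
          omega
      · exact hpq.2 (Walk.snd_mem_support_of_mem_edges q he)
  refine hfree _ hcyc ?_
  rw [Walk.length_cons, hlen]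
  simpa using hm

end ListPaths

section Core

open Finset

variable {V : Type*} [DecidableEq V] {G : SimpleGraph V} [DecidableRel G.Adj]

/-- Number of neighbours of `v` in `S`. -/
def dg (G : SimpleGraph V) [DecidableRel G.Adj] (S : Finset V) (v : V) : ℕ :=
  #{w ∈ S | G.Adj v w}

/-- `A` and `B` are disjoint, every vertex of one has at least `m` neighbours in the other, and
two vertices of one have at least `m` common neighbours in the other. -/
structure IsCore (G : SimpleGraph V) [DecidableRel G.Adj] (m : ℕ) (A B : Finset V) : Prop where
  disj : Disjoint A B
  left : ∀ a ∈ A, m ≤ G.dg B a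
  right : ∀ b ∈ B, m ≤ G.dg A b
  left₂ : ∀ a ∈ A, ∀ a' ∈ A, m ≤ #{b ∈ B | G.Adj a b ∧ G.Adj a' b}
  right₂ : ∀ b ∈ B, ∀ b' ∈ B, m ≤ #{a ∈ A | G.Adj b a ∧ G.Adj b' a}

theorem IsCore.symm {m : ℕ} {A B : Finset V} (h : G.IsCore m A B) : G.IsCore m B A :=
  ⟨h.disj.symm, h.right, h.left, h.right₂, h.left₂⟩

theorem exists_adj_notMem_of_card_lt {S F : Finset V} {v : V} (h : #F < G.dg S v) :
    ∃ w ∈ S, G.Adj v w ∧ w ∉ F := by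
  obtain ⟨w, hw, hwF⟩ := Finset.exists_mem_notMem_of_card_lt_card h
  rw [mem_filter] at hw
  exact ⟨w, hw.1, hw.2, hwF⟩

theorem IsCore.exists_path_same {m : ℕ} {A B : Finset V} (h : G.IsCore m A B) (j : ℕ) :
    ∀ (a a' : V) (F : Finset V), a ∈ A → a' ∈ A → a ≠ a' → #F + 2 * j + 2 ≤ m →
      ∃ l : List V, l.length = 2 * j + 1 ∧ l.Nodup ∧ (∀ x ∈ l, x ∈ A ∪ B ∧ x ∉ F) ∧
        G.LPath a l a' := by
  induction j with
  | zero =>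
    intro a a' F ha ha' hne hF
    have h1 := h.left₂ a ha a' ha'
    obtain ⟨w, hw, hwF⟩ := Finset.exists_mem_notMem_of_card_lt_card
      (show #F < #{b ∈ B | G.Adj a b ∧ G.Adj a' b} by omega)
    rw [mem_filter] at hw
    refine ⟨[w], rfl, by simp, ?_, ?_⟩
    · simp [hw.1, hwF]
    · rw [lPath_cons, lPath_nil]; exact ⟨hw.2.1, hw.2.2.symm⟩
  | succ j ih =>
    intro a a' F ha ha' hne hF
    have h1 := h.left a ha
    obtain ⟨b, hb, hab, hbF⟩ := exists_adj_notMem_of_card_lt (show #F < G.dg B a by omega)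
    have h2 := h.right b hb
    have h3 := Finset.card_insert_le a' F
    obtain ⟨c, hc, hbc, hcF⟩ := exists_adj_notMem_of_card_lt
      (show #(insert a' F) < G.dg A b by omega)
    rw [mem_insert, not_or] at hcF
    have h4 := Finset.card_insert_le b (insert c F)
    have h5 := Finset.card_insert_le c F
    obtain ⟨l, hl, hnd, hmem, hp⟩ := ih c a' (insert b (insert c F)) hc ha' hcF.1 (by omega)
    refine ⟨b :: c :: l, by simp [hl]; ring, ?_, ?_, ?_⟩
    · simp only [List.nodup_cons, List.mem_cons, not_or]
      refine ⟨⟨hbc.ne, fun hb' => (hmem b hb').2 (by simp)⟩,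
        fun hc' => (hmem c hc').2 (by simp), hnd⟩
    · intro x hx
      simp only [List.mem_cons] at hx
      rcases hx with rfl | rfl | hx
      · exact ⟨mem_union_right _ hb, hbF⟩
      · exact ⟨mem_union_left _ hc, hcF.2⟩
      · have := hmem x hx
        simp only [mem_insert, not_or] at this
        exact ⟨this.1, this.2.2.2⟩
    · simp only [lPath_cons]
      exact ⟨hab, hbc, hp⟩

theorem IsCore.exists_path_opp {m : ℕ} {A B : Finset V} (h : G.IsCore m A B) (j : ℕ)
    (a b : V) (F : Finset V) (ha : a ∈ A) (hb : b ∈ B) (hF : #F + 2 * j + 3 ≤ m) :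
    ∃ l : List V, l.length = 2 * j + 2 ∧ l.Nodup ∧ (∀ x ∈ l, x ∈ A ∪ B ∧ x ∉ F) ∧
        G.LPath a l b := by
  have h1 := h.left a ha
  have h3 := Finset.card_insert_le b F
  obtain ⟨c, hc, hac, hcF⟩ := exists_adj_notMem_of_card_lt
    (show #(insert b F) < G.dg B a by omega)
  rw [mem_insert, not_or] at hcF
  have h5 := Finset.card_insert_le c F
  obtain ⟨l, hl, hnd, hmem, hp⟩ := h.symm.exists_path_same j c b (insert c F) hc hb hcF.1
    (by omega)
  refine ⟨c :: l, by simp [hl], ?_, ?_, ?_⟩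
  · exact List.nodup_cons.2 ⟨fun hc' => (hmem c hc').2 (by simp), hnd⟩
  · intro x hx
    rw [List.mem_cons] at hx
    rcases hx with rfl | hx
    · exact ⟨mem_union_right _ hc, hcF.2⟩
    · have := hmem x hx
      simp only [mem_insert, not_or] at this
      exact ⟨by rw [union_comm]; exact this.1, this.2.2⟩
  · rw [lPath_cons]; exact ⟨hac, hp⟩

/-- Closing an ear outside the core with a path inside the core. -/
theorem CycleFree.false_of_ear {k : ℕ} (hfree : G.CycleFree (2 * k + 1)) {C : Finset V}
    {a a' : V} {l l' : List V} (ha : a ∈ C) (ha' : a' ∈ C) (hne : a ≠ a')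
    (hl : ∀ x ∈ l, x ∉ C) (hnd : l.Nodup) (hp : G.LPath a l a')
    (hl' : ∀ x ∈ l', x ∈ C ∧ x ∉ ({a, a'} : Finset V)) (hnd' : l'.Nodup) (hp' : G.LPath a' l' a)
    (hlen : l.length + l'.length + 2 = 2 * k + 1) (hk : 1 ≤ l'.length) : False := by
  refine hfree.false_of_lPath (hp.append hp') ?_ ?_ ?_
  · rw [List.nodup_cons, List.mem_append, List.mem_cons, List.nodup_append, List.nodup_cons]
    refine ⟨?_, hnd, ⟨fun h => (hl' _ h).2 (by simp), hnd'⟩, ?_⟩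
    · rintro (h | h | h)
      · exact hl _ h ha
      · exact hne h
      · exact (hl' _ h).2 (by simp)
    · intro x hx y hy
      rw [List.mem_cons] at hy
      rintro rfl
      rcases hy with rfl | hy
      · exact hl _ hx ha'
      · exact hl _ hx (hl' _ hy).1
  · simp; omega
  · simp; omega

theorem IsCore.false_of_same {m k : ℕ} {A B : Finset V} (h : G.IsCore m A B)
    (hfree : G.CycleFree (2 * k + 1)) (hm : 2 * k + 4 ≤ m) {a a' : V} {l : List V}
    (ha : a ∈ A) (ha' : a' ∈ A) (hne : a ≠ a') (hl : ∀ x ∈ l, x ∉ A ∪ B) (hnd : l.Nodup)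
    (hp : G.LPath a l a') (hodd : Even l.length) (hlen : l.length + 2 ≤ 2 * k) : False := by
  obtain ⟨i, hi⟩ := hodd
  have hc : #({a, a'} : Finset V) ≤ 2 := Finset.card_le_two
  obtain ⟨l', h1, h2, h3, h4⟩ := h.exists_path_same (k - 1 - i) a' a {a, a'} ha' ha hne.symm
    (by omega)
  exact hfree.false_of_ear (mem_union_left _ ha) (mem_union_left _ ha') hne hl hnd hp h3 h2 h4
    (by omega) (by omega)

theorem IsCore.false_of_opp {m k : ℕ} {A B : Finset V} (h : G.IsCore m A B)
    (hfree : G.CycleFree (2 * k + 1)) (hm : 2 * k + 4 ≤ m) {a b : V} {l : List V}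
    (ha : a ∈ A) (hb : b ∈ B) (hl : ∀ x ∈ l, x ∉ A ∪ B) (hnd : l.Nodup)
    (hp : G.LPath a l b) (hodd : Odd l.length) (hlen : l.length + 3 ≤ 2 * k) : False := by
  obtain ⟨i, hi⟩ := hodd
  have hc : #({a, b} : Finset V) ≤ 2 := Finset.card_le_two
  have hne : a ≠ b := fun e => Finset.disjoint_left.1 h.disj ha (e ▸ hb)
  obtain ⟨l', h1, h2, h3, h4⟩ := h.symm.exists_path_opp (k - 2 - i) b a {a, b} hb ha
    (by omega)
  exact hfree.false_of_ear (mem_union_left _ ha) (mem_union_right _ hb) hne hl hnd hp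
    (by simpa only [union_comm] using h3) h2 h4 (by omega) (by omega)

theorem CycleFree.false_of_adj {k : ℕ} (hfree : G.CycleFree (2 * k + 1)) {C : Finset V}
    {a b : V} {l : List V} (ha : a ∈ C) (hb : b ∈ C) (hab : G.Adj b a)
    (hl : ∀ x ∈ l, x ∉ C) (hnd : l.Nodup)
    (hp : G.LPath a l b) (hlen : l.length + 1 = 2 * k) : False := by
  refine hfree.false_of_lPath (hp.append (lPath_nil.2 hab)) ?_ ?_ ?_
  · rw [List.nodup_cons, List.mem_append, List.nodup_append]
    refine ⟨?_, hnd, by simp, ?_⟩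
    · rintro (h | h)
      · exact hl _ h ha
      · exact hab.ne' (by simpa using h)
    · intro x hx y hy
      rw [List.mem_singleton] at hy
      rintro rfl
      exact hl _ hx (hy ▸ hb)
  · rw [List.length_append, List.length_singleton]
    have : 1 ≤ l.length := by omega
    omega
  · simp; omega

end Core

section Degeneracy

open Finset

variable {V : Type*} [DecidableEq V] {G : SimpleGraph V} [DecidableRel G.Adj]

theorem dg_mono {S T : Finset V} (h : S ⊆ T) (v : V) : G.dg S v ≤ G.dg T v :=
  card_le_card (filter_subset_filter _ h)

theorem dg_le_card (S : Finset V) (v : V) : G.dg S v ≤ #S := card_filter_le _ _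

theorem dg_union {S T : Finset V} (h : Disjoint S T) (v : V) :
    G.dg (S ∪ T) v = G.dg S v + G.dg T v := by
  rw [dg, filter_union, card_union_of_disjoint (disjoint_filter_filter h)]; rfl

theorem dg_insert {S : Finset V} {a : V} (h : a ∉ S) (v : V) :
    G.dg (insert a S) v = G.dg S v + if G.Adj v a then 1 else 0 := by
  rw [dg, filter_insert]
  split_ifs
  · rw [card_insert_of_notMem (by simp [h])]; rfl
  · rfl

theorem sum_dg_comm (S T : Finset V) : ∑ v ∈ S, G.dg T v = ∑ w ∈ T, G.dg S w := by
  simp only [dg, card_filter]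
  rw [sum_comm]
  simp only [G.adj_comm]

/-- If every nonempty subset of `X` has a vertex of small inner degree, `X` spans few edges. -/
theorem sum_dg_le_of_degenerate {D : ℕ} (X : Finset V)
    (h : ∀ T ⊆ X, T.Nonempty → ∃ v ∈ T, G.dg T v ≤ D) : ∑ v ∈ X, G.dg X v ≤ 2 * D * #X := by
  induction hc : #X generalizing X with
  | zero => rw [card_eq_zero] at hc; simp [hc]
  | succ c ih =>
    obtain ⟨v, hv, hvD⟩ := h X subset_rfl (card_pos.1 (by omega))
    have hnot : v ∉ X.erase v := notMem_erase v X
    have h1 := ih (X.erase v) (fun T hT => h T (hT.trans (erase_subset _ _)))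
      (by rw [card_erase_of_mem hv]; omega)
    have hX : X = insert v (X.erase v) := (insert_erase hv).symm
    have h3 : G.dg X v = G.dg (X.erase v) v := by
      conv_lhs => rw [hX]
      rw [dg_insert hnot]; simp
    have h2 : ∑ w ∈ X, G.dg X w = ∑ w ∈ X.erase v, G.dg (X.erase v) w + 2 * G.dg X v := by
      rw [← add_sum_erase X _ hv]
      have h4 : ∀ w, G.dg X w = G.dg (X.erase v) w + if G.Adj w v then 1 else 0 := fun w => by
        conv_lhs => rw [hX]
        exact dg_insert hnot w
      rw [sum_congr rfl fun w _ => h4 w, sum_add_distrib, ← card_filter]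
      have h5 : #{w ∈ X.erase v | G.Adj w v} = G.dg (X.erase v) v := by
        simp only [dg, G.adj_comm]
      rw [h5, ← h3]; ring
    rw [h2]
    nlinarith

/-- In a `C_{2k+1}`-free graph the neighbourhood of a vertex is `(2k-2)`-degenerate. -/
theorem CycleFree.exists_dg_le {k : ℕ} (hk : 1 ≤ k) (hfree : G.CycleFree (2 * k + 1)) {u : V}
    {T : Finset V} (hT : ∀ v ∈ T, G.Adj u v) (hne : T.Nonempty) :
    ∃ v ∈ T, G.dg T v ≤ 2 * k - 2 := by
  by_contra! hcon
  have key : ∀ j, j ≤ 2 * k - 1 → ∃ (v : V) (l : List V), l.length = j ∧ (v :: l).Nodup ∧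
      (∀ w ∈ v :: l, w ∈ T) ∧ G.LPath v l u := by
    intro j
    induction j with
    | zero =>
      intro _
      obtain ⟨v, hv⟩ := hne
      exact ⟨v, [], rfl, by simp, by simpa using hv, lPath_nil.2 (hT v hv).symm⟩
    | succ j ih =>
      intro hj
      obtain ⟨v, l, hl, hnd, hmem, hp⟩ := ih (by omega)
      have h1 := hcon v (hmem v (by simp))
      have h2 : #(l.toFinset) ≤ l.length := l.toFinset_card_le
      obtain ⟨w, hw, hvw, hwl⟩ := exists_adj_notMem_of_card_lt
        (show #(l.toFinset) < G.dg T v by omega)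
      refine ⟨w, v :: l, by simp [hl], ?_, ?_, lPath_cons.2 ⟨hvw.symm, hp⟩⟩
      · rw [List.nodup_cons, List.mem_cons, not_or]
        exact ⟨⟨hvw.ne', by simpa using hwl⟩, hnd⟩
      · intro y hy
        rw [List.mem_cons] at hy
        rcases hy with rfl | hy
        · exact hw
        · exact hmem y hy
  obtain ⟨v, l, hl, hnd, hmem, hp⟩ := key (2 * k - 1) le_rfl
  refine hfree.false_of_lPath (lPath_cons.2 ⟨hT v (hmem v (by simp)), hp⟩) ?_ ?_ ?_
  · rw [List.nodup_cons]
    exact ⟨fun h => (hT u (hmem u h)).ne rfl, hnd⟩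
  · simp only [List.length_cons]
    by_contra hlt
    have hk1 : k = 1 := by omega
    omega
  · simp; omega

end Degeneracy

section DenseCore

open Finset

variable {V : Type*} [Fintype V] [DecidableEq V] {G : SimpleGraph V} [DecidableRel G.Adj]

/-- The sum over neighbours as a sum of indicator weights. -/
theorem sq_le_sum_dg {lam : ℝ} {x : V → ℝ} {u : V} (hx1 : ∀ v, x v ≤ 1)
    (hu : x u = 1) (heig : ∀ v, lam * x v = ∑ w with G.Adj v w, x w) :
    lam ^ 2 ≤ ∑ v with G.Adj u v, (G.dg univ v : ℝ) := by
  have h1 : lam = ∑ w with G.Adj u w, x w := by rw [← heig, hu, mul_one]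
  calc lam ^ 2 = ∑ w with G.Adj u w, lam * x w := by rw [← mul_sum, ← h1, sq]
    _ ≤ _ := sum_le_sum fun v _ => by
      rw [heig, dg, ← nsmul_one]
      exact sum_le_card_nsmul _ _ _ fun w _ => hx1 w

/-- A maximal pair of sets with large cross degrees. -/
theorem exists_maximal_pair {c : ℝ} (A₀ B₀ : Finset V) (hd : Disjoint A₀ B₀)
    (hA : ∀ a ∈ A₀, c ≤ G.dg B₀ a) (hB : ∀ b ∈ B₀, c ≤ G.dg A₀ b) :
    ∃ A B : Finset V, A₀ ⊆ A ∧ B₀ ⊆ B ∧ Disjoint A B ∧ (∀ a ∈ A, c ≤ G.dg B a) ∧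
      (∀ b ∈ B, c ≤ G.dg A b) ∧ ∀ v, v ∉ A → v ∉ B → (G.dg A v : ℝ) < c ∧ (G.dg B v : ℝ) < c := by
  classical
  let P : Finset V × Finset V → Prop := fun p => A₀ ⊆ p.1 ∧ B₀ ⊆ p.2 ∧ Disjoint p.1 p.2 ∧
    (∀ a ∈ p.1, c ≤ G.dg p.2 a) ∧ (∀ b ∈ p.2, c ≤ G.dg p.1 b)
  obtain ⟨⟨A, B⟩, hP, hmax⟩ := exists_max_image (univ.filter P) (fun p => #p.1 + #p.2)
    ⟨(A₀, B₀), mem_filter.2 ⟨mem_univ _, subset_rfl, subset_rfl, hd, hA, hB⟩⟩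
  rw [mem_filter] at hP
  obtain ⟨-, h1, h2, h3, h4, h5⟩ := hP
  simp only at h1 h2 h3 h4 h5
  have mono : ∀ {S T : Finset V} (v : V), S ⊆ T → c ≤ G.dg S v → c ≤ G.dg T v :=
    fun v hST h => h.trans (by exact_mod_cast dg_mono hST v)
  refine ⟨A, B, h1, h2, h3, h4, h5, fun v hvA hvB => ⟨?_, ?_⟩⟩
  · by_contra! hcon
    have := hmax (A, insert v B) (by
      simp only [mem_filter, mem_univ, true_and]
      refine ⟨h1, h2.trans (subset_insert _ _), ?_,
        fun a ha => mono a (subset_insert _ _) (h4 a ha),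
        fun b hb => ?_⟩
      · rw [disjoint_insert_right]; exact ⟨hvA, h3⟩
      · rcases mem_insert.1 hb with rfl | hb
        · exact hcon
        · exact h5 b hb)
    simp only [card_insert_of_notMem hvB] at this
    omega
  · by_contra! hcon
    have := hmax (insert v A, B) (by
      simp only [mem_filter, mem_univ, true_and]
      refine ⟨h1.trans (subset_insert _ _), h2, ?_, fun b hb => ?_,
        fun a ha => mono a (subset_insert _ _) (h5 a ha)⟩
      · rw [disjoint_insert_left]; exact ⟨hvB, h3⟩
      · rcases mem_insert.1 hb with rfl | hb
        · exact hcon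
        · exact h4 b hb)
    simp only [card_insert_of_notMem hvA] at this
    omega

/-- Markov's inequality for the numbers of missing neighbours. -/
theorem card_filter_missing_le {N miss : ℝ} (S T : Finset V)
    (h : ∑ v ∈ S, ((#T : ℝ) - G.dg T v) = miss) :
    (#{v ∈ S | ¬ ((#T : ℝ) - G.dg T v ≤ N / 8)} : ℝ) * N ≤ 8 * miss := by
  have h1 : ∑ v ∈ S with ¬ ((#T : ℝ) - G.dg T v ≤ N / 8), (N / 8)
      ≤ ∑ v ∈ S with ¬ ((#T : ℝ) - G.dg T v ≤ N / 8), ((#T : ℝ) - G.dg T v) :=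
    sum_le_sum fun v hv => by
      rw [mem_filter] at hv
      exact (not_le.1 hv.2).le
  have h2 : ∑ v ∈ S with ¬ ((#T : ℝ) - G.dg T v ≤ N / 8), ((#T : ℝ) - G.dg T v)
      ≤ ∑ v ∈ S, ((#T : ℝ) - G.dg T v) :=
    sum_le_sum_of_subset_of_nonneg (filter_subset _ _) fun v _ _ => by
      have : (G.dg T v : ℝ) ≤ #T := by exact_mod_cast dg_le_card T v
      linarith
  rw [sum_const, nsmul_eq_mul] at h1
  linarith

set_option maxHeartbeats 1000000 in
theorem exists_dense_pair {k : ℕ} (hk : 2 ≤ k) (hn : 712 * k ≤ Fintype.card V)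
    (hfree : G.CycleFree (2 * k + 1)) {lam : ℝ} {x : V → ℝ} {u : V}
    (hlam2 : ((Fintype.card V : ℝ) / 2 - k) ^ 2 ≤ lam ^ 2) (hx1 : ∀ v, x v ≤ 1)
    (hu : x u = 1) (heig : ∀ v, lam * x v = ∑ w with G.Adj v w, x w) :
    ∃ A B : Finset V, Disjoint A B ∧ (∀ a ∈ A, 0.29 * (Fintype.card V : ℝ) ≤ G.dg B a) ∧
      (∀ b ∈ B, 0.29 * (Fintype.card V : ℝ) ≤ G.dg A b) ∧
      (∀ v, v ∉ A → v ∉ B → (G.dg A v : ℝ) < 0.29 * (Fintype.card V : ℝ) ∧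
        (G.dg B v : ℝ) < 0.29 * (Fintype.card V : ℝ)) ∧
      (#A : ℝ) ≤ 0.568 * (Fintype.card V : ℝ) ∧ (#B : ℝ) ≤ 0.568 * (Fintype.card V : ℝ) ∧
      0.932 * (Fintype.card V : ℝ) ≤ #A + #B := by
  classical
  set N : ℝ := (Fintype.card V : ℝ) with hNdef
  have hkN : 712 * (k : ℝ) ≤ N := by rw [hNdef]; exact_mod_cast hn
  have hk2 : (2 : ℝ) ≤ k := by exact_mod_cast hk
  have hN0 : 0 < N := by linarith
  set X : Finset V := {v | G.Adj u v} with hX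
  set Y : Finset V := Xᶜ with hY
  have hXY : Disjoint X Y := disjoint_compl_right
  set d : ℝ := (#X : ℝ) with hd
  have hYc : (#Y : ℝ) = N - d := by
    rw [hY, card_compl, Nat.cast_sub (card_le_univ X)]
  have h1 := sq_le_sum_dg hx1 hu heig
  have h2 : ∑ v ∈ X, (G.dg univ v : ℝ) = ∑ v ∈ X, (G.dg X v : ℝ) + ∑ v ∈ X, (G.dg Y v : ℝ) := by
    rw [← sum_add_distrib]
    refine sum_congr rfl fun v _ => ?_
    rw [← union_compl X, dg_union hXY]; push_cast; rfl
  have h3 : ∑ v ∈ X, (G.dg X v : ℝ) ≤ 4 * k * d := by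
    have h4 := sum_dg_le_of_degenerate (G := G) (D := 2 * k - 2) X fun T hT hne =>
      hfree.exists_dg_le (u := u) (by omega) (fun v hv => by
        have := hT hv
        rw [hX, mem_filter] at this
        exact this.2) hne
    have h5 : ((∑ v ∈ X, G.dg X v : ℕ) : ℝ) ≤ ((4 * k * #X : ℕ) : ℝ) := by
      refine Nat.cast_le.2 (h4.trans ?_)
      exact Nat.mul_le_mul_right _ (by omega)
    push_cast at h5
    exact h5
  set miss : ℝ := ∑ v ∈ X, ((#Y : ℝ) - G.dg Y v) with hmiss
  have hmissY : ∑ v ∈ Y, ((#X : ℝ) - G.dg X v) = miss := by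
    rw [hmiss, sum_sub_distrib, sum_sub_distrib, sum_const, sum_const, nsmul_eq_mul, nsmul_eq_mul]
    have : (∑ v ∈ X, (G.dg Y v : ℝ)) = ∑ v ∈ Y, (G.dg X v : ℝ) := by
      exact_mod_cast sum_dg_comm (G := G) X Y
    rw [this]; ring
  have hm1 : miss ≤ d * (N - d) + 4 * k * d - (N / 2 - k) ^ 2 := by
    have : miss = d * (N - d) - ∑ v ∈ X, (G.dg Y v : ℝ) := by
      rw [hmiss, sum_sub_distrib, sum_const, nsmul_eq_mul, hYc]
    rw [this]
    linarith
  have hm0 : 0 ≤ miss := sum_nonneg fun v _ => by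
    have : (G.dg Y v : ℝ) ≤ #Y := by exact_mod_cast dg_le_card Y v
    linarith
  have hd0 : 0 ≤ d := Nat.cast_nonneg _
  have hm2 : miss ≤ d * N - d ^ 2 + 0.005618 * (d * N) - 0.24859 * N ^ 2 := by
    have e1 : 4 * k * d ≤ 0.005618 * (d * N) := by nlinarith
    have e2 : 0.24859 * N ^ 2 ≤ (N / 2 - k) ^ 2 := by nlinarith
    nlinarith
  have hdN : 0 ≤ d * N := mul_nonneg hd0 hN0.le
  have hdN' : d * N ≤ N ^ 2 := by
    have : 0 ≤ N - d := hYc ▸ Nat.cast_nonneg _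
    nlinarith
  set A₀ : Finset V := {v ∈ X | (#Y : ℝ) - G.dg Y v ≤ N / 8} with hA0
  set B₀ : Finset V := {v ∈ Y | (#X : ℝ) - G.dg X v ≤ N / 8} with hB0
  set A₁ : Finset V := {v ∈ X | ¬ ((#Y : ℝ) - G.dg Y v ≤ N / 8)} with hA1
  set B₁ : Finset V := {v ∈ Y | ¬ ((#X : ℝ) - G.dg X v ≤ N / 8)} with hB1
  have hA1c : (#A₁ : ℝ) * N ≤ 8 * miss := card_filter_missing_le X Y rfl
  have hB1c : (#B₁ : ℝ) * N ≤ 8 * miss := card_filter_missing_le Y X hmissY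
  have hAu : A₀ ∪ A₁ = X := filter_union_filter_not_eq _ _
  have hBu : B₀ ∪ B₁ = Y := filter_union_filter_not_eq _ _
  have hAd : Disjoint A₀ A₁ := disjoint_filter_filter_not _ _ _
  have hBd : Disjoint B₀ B₁ := disjoint_filter_filter_not _ _ _
  have hAc : (#A₀ : ℝ) + #A₁ = d := by
    rw [hd, ← hAu, card_union_of_disjoint hAd]; push_cast; rfl
  have hBc : (#B₀ : ℝ) + #B₁ = N - d := by
    rw [← hYc, ← hBu, card_union_of_disjoint hBd]; push_cast; rfl
  have hA0B0 : Disjoint A₀ B₀ :=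
    hXY.mono (filter_subset _ _) (filter_subset _ _)
  have hdeg : ∀ a ∈ A₀, 0.29 * N ≤ G.dg B₀ a := by
    intro a ha
    rw [hA0, mem_filter] at ha
    have e1 : (G.dg Y a : ℝ) = G.dg B₀ a + G.dg B₁ a := by
      rw [← hBu, dg_union hBd]; push_cast; rfl
    have e2 : (G.dg B₁ a : ℝ) ≤ #B₁ := by exact_mod_cast dg_le_card B₁ a
    have e3 : N - d - N / 8 - #B₁ ≤ G.dg B₀ a := by linarith [ha.2]
    have e4 : 0.29 * N * N ≤ (N - d - N / 8 - #B₁) * N := by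
      linarith [sq_nonneg (d - 0.5653 * N), sq_nonneg N, hdN, hdN']
    exact (le_of_mul_le_mul_right e4 hN0).trans e3
  have hdegB : ∀ b ∈ B₀, 0.29 * N ≤ G.dg A₀ b := by
    intro a ha
    rw [hB0, mem_filter] at ha
    have e1 : (G.dg X a : ℝ) = G.dg A₀ a + G.dg A₁ a := by
      rw [← hAu, dg_union hAd]; push_cast; rfl
    have e2 : (G.dg A₁ a : ℝ) ≤ #A₁ := by exact_mod_cast dg_le_card A₁ a
    have e3 : d - N / 8 - #A₁ ≤ G.dg A₀ a := by linarith [ha.2]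
    have e4 : 0.29 * N * N ≤ (d - N / 8 - #A₁) * N := by
      linarith [sq_nonneg (d - 0.4403 * N), sq_nonneg N, hdN, hdN']
    exact (le_of_mul_le_mul_right e4 hN0).trans e3
  obtain ⟨A, B, hAA, hBB, hAB, p1, p2, p3⟩ := exists_maximal_pair A₀ B₀ hA0B0 hdeg hdegB
  have cA : (#A₀ : ℝ) ≤ #A := by exact_mod_cast card_le_card hAA
  have cB : (#B₀ : ℝ) ≤ #B := by exact_mod_cast card_le_card hBB
  have cAB : (#A : ℝ) + #B ≤ N := by
    have := card_le_univ (A ∪ B)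
    rw [card_union_of_disjoint hAB] at this
    rw [hNdef]
    exact_mod_cast this
  refine ⟨A, B, hAB, p1, p2, p3, ?_, ?_, ?_⟩
  · have e4 : 0.432 * N * N ≤ (N - d - #B₁) * N := by
      linarith [sq_nonneg (d - 0.5653 * N), sq_nonneg N, hdN, hdN']
    have := le_of_mul_le_mul_right e4 hN0
    linarith
  · have e4 : 0.432 * N * N ≤ (d - #A₁) * N := by
      linarith [sq_nonneg (d - 0.4403 * N), sq_nonneg N, hdN, hdN']
    have := le_of_mul_le_mul_right e4 hN0
    linarith
  · have e4 : (#A₁ + #B₁ : ℝ) * N ≤ 0.068 * N * N := by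
      linarith [sq_nonneg (d - 0.5028 * N), sq_nonneg N, hdN, hdN']
    have := le_of_mul_le_mul_right e4 hN0
    linarith

end DenseCore

section Structure

open Finset

variable {V : Type*} {G : SimpleGraph V}

theorem _root_.List.exists_eq_append_of_not_nodup {α : Type*} {l : List α} (h : ¬ l.Nodup) :
    ∃ (x : α) (a b c : List α), l = a ++ x :: (b ++ x :: c) := by
  induction l with
  | nil => simp at h
  | cons y l ih =>
    by_cases hy : y ∈ l
    · obtain ⟨b, c, rfl⟩ := List.append_of_mem hy
      exact ⟨y, [], b, c, rfl⟩
    · rw [List.nodup_cons] at h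
      obtain ⟨x, a, b, c, rfl⟩ := ih fun hl => h ⟨hy, hl⟩
      exact ⟨x, y :: a, b, c, rfl⟩

/-- The interior of a walk can be shortened to a path. -/
theorem LPath.exists_nodup {a b : V} {l : List V} (h : G.LPath a l b) (hne : l ≠ []) :
    ∃ l', G.LPath a l' b ∧ l' ≠ [] ∧ l'.Nodup ∧ l' ⊆ l := by
  induction hc : l.length using Nat.strong_induction_on generalizing l with
  | _ c ih =>
    by_cases hnd : l.Nodup
    · exact ⟨l, h, hne, hnd, fun _ => id⟩
    · obtain ⟨x, p, q, s, rfl⟩ := List.exists_eq_append_of_not_nodup hnd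
      have h1 := lPath_append.1 h
      have h2 := lPath_append.1 h1.2
      obtain ⟨l', h3, h4, h5, h6⟩ := ih (p ++ x :: s).length
        (by rw [← hc]; simp) (h1.1.append h2.2) (by simp) rfl
      refine ⟨l', h3, h4, h5, fun y hy => ?_⟩
      have := h6 hy
      simp only [List.mem_append, List.mem_cons] at this ⊢
      tauto

/-- All ears of `K` (paths with distinct ends in `K` and interior outside `K`) are compatible with
the `2`-colouring `col` of `K`. -/
def EarCompatible (G : SimpleGraph V) (K : Finset V) (col : V → ZMod 2) : Prop :=
  ∀ s ∈ K, ∀ s' ∈ K, s ≠ s' → ∀ l : List V, l.Nodup → (∀ x ∈ l, x ∉ K) → G.LPath s l s' →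
    ((l.length : ZMod 2) + 1 = col s + col s')

variable [DecidableEq V]

theorem EarCompatible.union {K : Finset V} {col : V → ZMod 2} (h : G.EarCompatible K col)
    {s s' : V} (hs : s ∈ K) (hs' : s' ∈ K) (hne : s ≠ s') {P : List V} (hnd : P.Nodup)
    (hP : ∀ x ∈ P, x ∉ K) (hp : G.LPath s P s') :
    G.EarCompatible (K ∪ P.toFinset)
      (fun v => if v ∈ K then col v else col s + (P.idxOf v : ℕ) + 1) := by
  have h2 : (2 : ZMod 2) = 0 := rfl
  have hidx : ∀ {p : V} {P₁ P₂ : List V}, P = P₁ ++ p :: P₂ → P.idxOf p = P₁.length := by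
    rintro p P₁ P₂ rfl
    have : p ∉ P₁ := by
      rw [List.nodup_append] at hnd
      exact fun hp => hnd.2.2 p hp p (by simp) rfl
    rw [List.idxOf_append_of_notMem this, List.idxOf_cons_self, add_zero]
  -- an ear from a vertex of `K` to a vertex of `P`
  have key1 : ∀ t ∈ K, ∀ p ∈ P, ∀ Q : List V, Q.Nodup → (∀ x ∈ Q, x ∉ K ∪ P.toFinset) →
      G.LPath t Q p → (Q.length : ZMod 2) + 1 = col t + (col s + (P.idxOf p : ℕ) + 1) := by
    intro t ht p hpP Q hQ hQK hQp
    obtain ⟨P₁, P₂, hPe⟩ := List.append_of_mem hpP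
    rw [hidx hPe]
    rw [hPe] at hnd hp hP hQK
    have e1 := lPath_append.1 hp
    have e0 := h s hs s' hs' hne _ hnd hP hp
    rw [List.nodup_append, List.nodup_cons] at hnd
    by_cases hts : t = s
    · subst hts
      have e2 := h t hs s' hs' hne (Q ++ p :: P₂) (by
          rw [List.nodup_append, List.nodup_cons]
          refine ⟨hQ, hnd.2.1, fun x hx y hy hxy => ?_⟩
          subst hxy
          exact hQK x hx (by simp only [mem_union, List.mem_toFinset, List.mem_append]; tauto))
        (fun x hx => by
          rcases List.mem_append.1 hx with hx | hx
          · exact fun hK => hQK x hx (mem_union_left _ hK)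
          · exact hP x (List.mem_append_right _ hx)) (hQp.append e1.2)
      simp only [List.length_append, List.length_cons, Nat.cast_add, Nat.cast_one] at e0 e2 ⊢
      linear_combination e2 - e0 - col t * h2
    · have e2 := h s hs t ht (Ne.symm hts) (P₁ ++ p :: Q.reverse) (by
          rw [List.nodup_append, List.nodup_cons, List.nodup_reverse, List.mem_reverse]
          refine ⟨hnd.1, ⟨fun hx => hQK p hx (by simp), hQ⟩, fun x hx y hy hxy => ?_⟩
          subst hxy
          rw [List.mem_cons, List.mem_reverse] at hy
          rcases hy with rfl | hy
          · exact hnd.2.2 x hx x (by simp) rfl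
          · exact hQK x hy (by simp only [mem_union, List.mem_toFinset, List.mem_append]; tauto))
        (fun x hx => by
          rw [List.mem_append, List.mem_cons, List.mem_reverse] at hx
          rcases hx with hx | rfl | hx
          · exact hP x (List.mem_append_left _ hx)
          · exact hP x (by simp)
          · exact fun hK => hQK x hx (mem_union_left _ hK)) (e1.1.append hQp.reverse)
      simp only [List.length_append, List.length_cons, Nat.cast_add, Nat.cast_one,
        List.length_reverse] at e2 ⊢
      linear_combination e2 - (P₁.length + 1 : ZMod 2) * h2
  -- an ear between two vertices of `P`
  have key2 : ∀ (p p' : V) (P₁ P₂ P₃ : List V), P = P₁ ++ p :: (P₂ ++ p' :: P₃) →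
      ∀ Q : List V, Q.Nodup → (∀ x ∈ Q, x ∉ K ∪ P.toFinset) → G.LPath p Q p' →
      (Q.length : ZMod 2) + 1 =
        (col s + (P.idxOf p : ℕ) + 1) + (col s + (P.idxOf p' : ℕ) + 1) := by
    intro p p' P₁ P₂ P₃ hPe Q hQ hQK hQp
    rw [hidx hPe, hidx (show P = (P₁ ++ p :: P₂) ++ p' :: P₃ by rw [hPe]; simp)]
    rw [hPe] at hnd hp hP hQK
    have e1 := lPath_append.1 hp
    have e3 := lPath_append.1 e1.2
    have e0 := h s hs s' hs' hne _ hnd hP hp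
    have hnd' : (P₁ ++ p :: (p' :: P₃)).Nodup := by
      refine hnd.sublist ?_
      refine List.Sublist.append_left (List.Sublist.cons_cons _ ?_) _
      exact List.sublist_append_right _ _
    have e2 := h s hs s' hs' hne (P₁ ++ p :: (Q ++ p' :: P₃)) (by
        rw [List.nodup_append, List.nodup_cons] at hnd' ⊢
        rw [List.nodup_append, List.mem_append]
        refine ⟨hnd'.1, ⟨?_, hQ, hnd'.2.1.2, fun x hx y hy hxy => ?_⟩, fun x hx y hy hxy => ?_⟩
        · rintro (hx | hx)
          · exact hQK p hx (by simp)
          · exact hnd'.2.1.1 hx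
        · subst hxy
          exact hQK x hx (by simp only [mem_union, List.mem_toFinset, List.mem_append,
            List.mem_cons] at hy ⊢; tauto)
        · subst hxy
          rw [List.mem_cons, List.mem_append] at hy
          rcases hy with rfl | hy | hy
          · exact hnd'.2.2 x hx x (by simp) rfl
          · exact hQK x hy (by simp only [mem_union, List.mem_toFinset, List.mem_append]; tauto)
          · exact hnd'.2.2 x hx x (List.mem_cons_of_mem _ hy) rfl)
      (fun x hx => by
        rw [List.mem_append, List.mem_cons, List.mem_append] at hx
        by_cases hxQ : x ∈ Q
        · exact fun hK => hQK x hxQ (mem_union_left _ hK)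
        · refine hP x ?_
          simp only [List.mem_append, List.mem_cons] at hx ⊢
          tauto) (e1.1.append (hQp.append e3.2))
    simp only [List.length_append, List.length_cons, Nat.cast_add, Nat.cast_one] at e0 e2 ⊢
    linear_combination e2 - e0 - (col s + P₁.length + 1) * h2
  intro t ht t' ht' htt Q hQ hQK hQp
  have hmem : ∀ {v}, v ∈ K ∪ P.toFinset → v ∉ K → v ∈ P := fun hv hvK => by
    rw [mem_union, List.mem_toFinset] at hv; tauto
  have hQrev : ∀ x ∈ Q.reverse, x ∉ K ∪ P.toFinset := fun x hx => hQK x (List.mem_reverse.1 hx)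
  have hlen : (Q.reverse.length : ZMod 2) = Q.length := by rw [List.length_reverse]
  by_cases htK : t ∈ K <;> by_cases htK' : t' ∈ K
  · simp only [htK, htK', if_true]
    exact h t htK t' htK' htt Q hQ (fun x hx hK => hQK x hx (mem_union_left _ hK)) hQp
  · simp only [htK, htK', if_true, if_false]
    exact key1 t htK t' (hmem ht' htK') Q hQ hQK hQp
  · simp only [htK, htK', if_true, if_false]
    rw [add_comm (col s + _ + 1), ← hlen]
    exact key1 t' htK' t (hmem ht htK) Q.reverse (List.nodup_reverse.2 hQ) hQrev hQp.reverse
  · simp only [htK, htK', if_false]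
    obtain ⟨P₁, P₂, hPe⟩ := List.append_of_mem (hmem ht htK)
    have h3 := hmem ht' htK'
    rw [hPe, List.mem_append, List.mem_cons] at h3
    rcases h3 with h3 | h3 | h3
    · obtain ⟨P₃, P₄, rfl⟩ := List.append_of_mem h3
      rw [add_comm (col s + _ + 1), ← hlen]
      exact key2 t' t P₃ P₄ P₂ (by rw [hPe]; simp) Q.reverse (List.nodup_reverse.2 hQ) hQrev
        hQp.reverse
    · exact absurd h3.symm htt
    · obtain ⟨P₃, P₄, rfl⟩ := List.append_of_mem h3
      exact key2 t t' P₁ P₃ P₄ hPe Q hQ hQK hQp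

/-- A compatible colouring extends to a set all of whose complementary components hang at a single
vertex. -/
theorem EarCompatible.exists_extension [Fintype V] {K : Finset V} {col : V → ZMod 2}
    (h : G.EarCompatible K col) (hK : K.Nonempty) :
    ∃ (S : Finset V) (col' : V → ZMod 2) (f : V → V), K ⊆ S ∧
      (∀ x ∈ S, ∀ y ∈ S, G.Adj x y → col' x ≠ col' y) ∧
      ∀ c, c ∉ S → f c ∈ S ∧ (∀ y ∈ S, G.Adj c y → y = f c) ∧
        ∀ c', c' ∉ S → G.Adj c c' → f c = f c' := by
  classical
  induction hm : #Kᶜ using Nat.strong_induction_on generalizing K col with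
  | _ m ih =>
    by_cases hear : ∃ s ∈ K, ∃ s' ∈ K, s ≠ s' ∧ ∃ P : List V, P ≠ [] ∧ P.Nodup ∧
        (∀ x ∈ P, x ∉ K) ∧ G.LPath s P s'
    · obtain ⟨s, hs, s', hs', hne, P, hP0, hnd, hP, hp⟩ := hear
      have hlt : #(K ∪ P.toFinset)ᶜ < m := by
        rw [← hm]
        refine card_lt_card ?_
        rw [compl_ssubset_compl]
        refine ⟨subset_union_left, fun hsub => ?_⟩
        obtain ⟨x, hx⟩ := List.exists_mem_of_ne_nil P hP0
        exact hP x hx (hsub (by simp [hx]))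
      obtain ⟨S, col', f, h1, h2⟩ := ih _ hlt (h.union hs hs' hne hnd hP hp)
        (hK.mono subset_union_left) rfl
      exact ⟨S, col', f, subset_union_left.trans h1, h2⟩
    · push Not at hear
      obtain ⟨k₀, hk₀⟩ := hK
      let R : V → V → Prop := fun c y => y ∈ K ∧ ∃ l : List V, G.LPath c l y ∧ ∀ x ∈ l, x ∉ K
      have huniq : ∀ c, c ∉ K → ∀ y y', R c y → R c y' → y = y' := by
        rintro c hc y y' ⟨hy, l, hl, hlK⟩ ⟨hy', l', hl', hlK'⟩
        by_contra hne
        obtain ⟨P, e1, e2, e3, e4⟩ := (hl.reverse.append hl').exists_nodup (by simp)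
        refine hear y hy y' hy' hne P e2 e3 (fun x hx => ?_) e1
        have := e4 hx
        rw [List.mem_append, List.mem_reverse, List.mem_cons] at this
        rcases this with h5 | rfl | h5
        · exact hlK x h5
        · exact hc
        · exact hlK' x h5
      have hstep : ∀ c c', c ∉ K → G.Adj c c' → ∀ y, R c y → R c' y := by
        rintro c c' hc hcc y ⟨hy, l, hl, hlK⟩
        refine ⟨hy, c :: l, lPath_cons.2 ⟨hcc.symm, hl⟩, fun x hx => ?_⟩
        rcases List.mem_cons.1 hx with rfl | hx
        · exact hc
        · exact hlK x hx
      let F : (V → Prop) → V := fun Q => if h : ∃ y, Q y then h.choose else k₀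
      have hF : ∀ c, (∃ y, R c y) → R c (F (R c)) := fun c hy => by
        simp only [F, dif_pos hy]; exact hy.choose_spec
      refine ⟨K, col, fun c => F (R c), subset_rfl, fun x hx y hy hxy he => ?_, fun c hc => ?_⟩
      · have := h x hx y hy hxy.ne [] (by simp) (by simp) (lPath_nil.2 hxy)
        rw [he, ← two_mul, show (2 : ZMod 2) = 0 from rfl] at this
        simp at this
      · refine ⟨?_, fun y hy hcy => ?_, fun c' hc' hcc => ?_⟩
        · by_cases hy : ∃ y, R c y
          · exact (hF c hy).1
          · simp only [F, dif_neg hy]; exact hk₀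
        · have hR : R c y := ⟨hy, [], lPath_nil.2 hcy, by simp⟩
          exact huniq c hc _ _ hR (hF c ⟨y, hR⟩)
        · have : R c = R c' := by
            funext y
            exact propext ⟨hstep c c' hc hcc y, hstep c' c hc' hcc.symm y⟩
          simp only [this]

end Structure

section TuranSusp

open Finset

variable {V : Type*} [DecidableEq V] {G : SimpleGraph V}

/-- `G` is a complete bipartite graph with parts `A ∋ s` and `B` with a clique on `insert s W`
attached. -/
structure IsTuranSusp (G : SimpleGraph V) (s : V) (A B W : Finset V) : Prop where
  mem : s ∈ A
  disjAB : Disjoint A B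
  disjAW : Disjoint A W
  disjBW : Disjoint B W
  cover : ∀ v, v ∈ A ∨ v ∈ B ∨ v ∈ W
  adj : ∀ x y, G.Adj x y ↔ x ≠ y ∧ (x ∈ A ∧ y ∈ B ∨ x ∈ B ∧ y ∈ A ∨
    x ∈ insert s W ∧ y ∈ insert s W)

/-- The class of a vertex in a suspended Turán graph. -/
def suspClass (s : V) (A B : Finset V) (v : V) : Fin 4 :=
  if v = s then 0 else if v ∈ A then 1 else if v ∈ B then 2 else 3

theorem IsTuranSusp.adj_iff {s : V} {A B W : Finset V} (h : G.IsTuranSusp s A B W) (x y : V) :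
    G.Adj x y ↔ x ≠ y ∧ ((suspClass s A B x, suspClass s A B y) ∈
      ({(0, 2), (1, 2), (2, 0), (2, 1), (0, 3), (3, 0), (3, 3), (0, 0)} :
        Finset (Fin 4 × Fin 4))) := by
  rw [h.adj]
  have hs := h.mem
  have d1 : ∀ v, v ∈ A → v ∉ B := fun _ hv => Finset.disjoint_left.1 h.disjAB hv
  have d2 : ∀ v, v ∈ A → v ∉ W := fun _ hv => Finset.disjoint_left.1 h.disjAW hv
  have d3 : ∀ v, v ∈ B → v ∉ W := fun _ hv => Finset.disjoint_left.1 h.disjBW hv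
  have hsB := d1 s hs
  have hsW := d2 s hs
  refine and_congr_right fun _ => ?_
  have hx := h.cover x
  have hy := h.cover y
  have d1x := d1 x; have d2x := d2 x; have d3x := d3 x
  have d1y := d1 y; have d2y := d2 y; have d3y := d3 y
  unfold suspClass
  by_cases hxs : x = s <;> by_cases hys : y = s
  · subst hxs; subst hys; simp
  · subst hxs
    by_cases hyA : y ∈ A <;> by_cases hyB : y ∈ B <;> simp_all
  · subst hys
    by_cases hxA : x ∈ A <;> by_cases hxB : x ∈ B <;> simp_all
  · by_cases hyA : y ∈ A <;> by_cases hyB : y ∈ B <;>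
      by_cases hxA : x ∈ A <;> by_cases hxB : x ∈ B <;> simp_all

theorem IsTuranSusp.card_class [Fintype V] {s : V} {A B W : Finset V}
    (h : G.IsTuranSusp s A B W) (i : Fin 4) :
    #{v | suspClass s A B v = i} = ![1, #A - 1, #B, #W] i := by
  have hs := h.mem
  have d1 : ∀ v, v ∈ A → v ∉ B := fun _ hv => Finset.disjoint_left.1 h.disjAB hv
  have d2 : ∀ v, v ∈ A → v ∉ W := fun _ hv => Finset.disjoint_left.1 h.disjAW hv
  have d3 : ∀ v, v ∈ B → v ∉ W := fun _ hv => Finset.disjoint_left.1 h.disjBW hv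
  have hsB := d1 s hs
  have hsW := d2 s hs
  have e0 : ({v | suspClass s A B v = 0} : Finset V) = {s} := by
    ext v
    simp only [mem_filter, mem_univ, true_and, mem_singleton]
    unfold suspClass
    split_ifs <;> simp_all
  have e1 : ({v | suspClass s A B v = 1} : Finset V) = A.erase s := by
    ext v
    simp only [mem_filter, mem_univ, true_and, mem_erase]
    unfold suspClass
    split_ifs <;> simp_all
  have e2 : ({v | suspClass s A B v = 2} : Finset V) = B := by
    ext v
    have := d1 v
    simp only [mem_filter, mem_univ, true_and]
    unfold suspClass
    split_ifs with h1 h2 h3 <;> simp_all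
  have e3 : ({v | suspClass s A B v = 3} : Finset V) = W := by
    ext v
    have a1 := d1 v
    have a2 := d2 v
    have a3 := d3 v
    have a4 := h.cover v
    simp only [mem_filter, mem_univ, true_and]
    unfold suspClass
    split_ifs with h1 h2 h3 <;> simp_all
  fin_cases i
  · simp [e0]
  · simp [e1, card_erase_of_mem hs]
  · simp [e2]
  · simp [e3]

theorem IsTuranSusp.nonempty_iso {V' : Type*} [DecidableEq V'] {H : SimpleGraph V'}
    [Fintype V] [Fintype V'] {s : V} {A B W : Finset V} {s' : V'} {A' B' W' : Finset V'}
    (h : G.IsTuranSusp s A B W) (h' : H.IsTuranSusp s' A' B' W') (hA : #A = #A') (hB : #B = #B')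
    (hW : #W = #W') : Nonempty (G ≃g H) := by
  have e : ∀ i : Fin 4, Nonempty ({v // suspClass s A B v = i} ≃ {v // suspClass s' A' B' v = i}) :=
    fun i => by
      refine ⟨Fintype.equivOfCardEq ?_⟩
      rw [Fintype.card_subtype, Fintype.card_subtype, h.card_class, h'.card_class, hA, hB, hW]
  let E : V ≃ V' := Equiv.ofFiberEquiv fun i => (e i).some
  have hE : ∀ v, suspClass s' A' B' (E v) = suspClass s A B v := Equiv.ofFiberEquiv_map _
  refine ⟨⟨E, fun {x y} => ?_⟩⟩
  rw [h.adj_iff, h'.adj_iff, hE, hE, E.injective.ne_iff]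

theorem IsTuranSusp.form_le [Fintype V] [DecidableRel G.Adj] {s : V} {A B W : Finset V}
    (h : G.IsTuranSusp s A B W) {lam : ℝ}
    (hray : ∀ y : V → ℝ, G.adjForm y y ≤ lam * ∑ v, y v ^ 2) (ys yA yB yW : ℝ) :
    2 * (#B * yB * ((#A - 1) * yA + ys)) + 2 * #W * ys * yW + #W * (#W - 1) * yW ^ 2
      ≤ lam * (ys ^ 2 + (#A - 1) * yA ^ 2 + #B * yB ^ 2 + #W * yW ^ 2) := by
  have hs := h.mem
  have d1 : ∀ v, v ∈ A → v ∉ B := fun _ hv => Finset.disjoint_left.1 h.disjAB hv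
  have d2 : ∀ v, v ∈ A → v ∉ W := fun _ hv => Finset.disjoint_left.1 h.disjAW hv
  have d3 : ∀ v, v ∈ B → v ∉ W := fun _ hv => Finset.disjoint_left.1 h.disjBW hv
  have hsB := d1 s hs
  have hsW := d2 s hs
  set y : V → ℝ := fun v => if v = s then ys else if v ∈ A then yA else if v ∈ B then yB else yW
    with hy
  have y0 : y s = ys := by simp [hy]
  have y1 : ∀ v ∈ A.erase s, y v = yA := fun v hv => by
    rw [mem_erase] at hv; simp [hy, hv.1, hv.2]
  have y2 : ∀ v ∈ B, y v = yB := fun v hv => by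
    have : v ≠ s := by rintro rfl; exact hsB hv
    have : v ∉ A := fun hA => d1 v hA hv
    simp [*]
  have y3 : ∀ v ∈ W, y v = yW := fun v hv => by
    have : v ≠ s := by rintro rfl; exact hsW hv
    have : v ∉ A := fun hA => d2 v hA hv
    have : v ∉ B := fun hA => d3 v hA hv
    simp [*]
  have hcard : ((#(A.erase s) : ℕ) : ℝ) = #A - 1 := by
    rw [card_erase_of_mem hs, Nat.cast_sub (card_pos.2 ⟨s, hs⟩), Nat.cast_one]
  have hsum : ∀ g : V → ℝ, ∑ v, g v
      = g s + ∑ v ∈ A.erase s, g v + ∑ v ∈ B, g v + ∑ v ∈ W, g v := fun g => by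
    have hun : (univ : Finset V) = A ∪ B ∪ W := by
      ext v; have := h.cover v; simp; tauto
    rw [hun, sum_union (disjoint_union_left.2 ⟨h.disjAW, h.disjBW⟩), sum_union h.disjAB,
      ← add_sum_erase A g hs]
  have hconst : ∀ (S : Finset V) (g : V → ℝ) (c : ℝ), (∀ v ∈ S, g v = c) →
      ∑ v ∈ S, g v = #S * c := fun S g c hg => by
    rw [sum_congr rfl hg, sum_const, nsmul_eq_mul]
  have hAsum : ∑ w ∈ A, y w = (#A - 1) * yA + ys := by
    rw [← add_sum_erase A y hs, hconst _ _ _ y1, hcard, y0]; ring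
  have n0 : ∑ w with G.Adj s w, y w = #B * yB + #W * yW := by
    have : ({w | G.Adj s w} : Finset V) = B ∪ W := by
      ext w
      have := d1 w; have := d2 w
      simp only [mem_filter, mem_univ, true_and, h.adj, mem_union, mem_insert]
      constructor
      · rintro ⟨h1, h2⟩; tauto
      · intro h1
        refine ⟨?_, by tauto⟩
        rintro rfl; tauto
    rw [this, sum_union h.disjBW, hconst _ _ _ y2, hconst _ _ _ y3]
  have n1 : ∀ v ∈ A.erase s, y v * ∑ w with G.Adj v w, y w = yA * (#B * yB) := fun v hv => by
    rw [y1 v hv]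
    rw [mem_erase] at hv
    have : ({w | G.Adj v w} : Finset V) = B := by
      ext w
      have := d1 w; have := d1 v hv.2; have := d2 v hv.2
      simp only [mem_filter, mem_univ, true_and, h.adj, mem_insert]
      constructor
      · rintro ⟨h1, h2⟩; tauto
      · intro h1
        refine ⟨?_, by tauto⟩
        rintro rfl; tauto
    rw [this, hconst _ _ _ y2]
  have n2 : ∀ v ∈ B, y v * ∑ w with G.Adj v w, y w = yB * ((#A - 1) * yA + ys) := fun v hv => by
    rw [y2 v hv]
    have : ({w | G.Adj v w} : Finset V) = A := by
      ext w
      have := d1 w; have := d1 v; have := d3 v hv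
      have : v ≠ s := by rintro rfl; exact hsB hv
      simp only [mem_filter, mem_univ, true_and, h.adj, mem_insert]
      constructor
      · rintro ⟨h1, h2⟩; tauto
      · intro h1
        refine ⟨?_, by tauto⟩
        rintro rfl; tauto
    rw [this, hAsum]
  have n3 : ∀ v ∈ W, y v * ∑ w with G.Adj v w, y w = yW * (ys + (#W - 1) * yW) := fun v hv => by
    rw [y3 v hv]
    have hvs : v ≠ s := by rintro rfl; exact hsW hv
    have : ({w | G.Adj v w} : Finset V) = insert s (W.erase v) := by
      ext w
      have := d2 w; have := d2 v; have := d3 v; have := d3 w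
      simp only [mem_filter, mem_univ, true_and, h.adj, mem_insert, mem_erase]
      constructor
      · rintro ⟨h1, h2⟩
        have := h1.symm
        tauto
      · rintro (rfl | h1)
        · exact ⟨hvs, by tauto⟩
        · exact ⟨h1.1.symm, by tauto⟩
    rw [this, sum_insert (by simp [hsW]), y0,
      hconst _ _ _ (fun w hw => y3 w (mem_of_mem_erase hw)), card_erase_of_mem hv,
      Nat.cast_sub (card_pos.2 ⟨v, hv⟩), Nat.cast_one]
  have h1 := hray y
  rw [adjForm, hsum, hsum (fun v => y v ^ 2), n0, y0, hconst _ _ _ n1, hconst _ _ _ n2,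
    hconst _ _ _ n3, hconst _ (fun v => y v ^ 2) (yA ^ 2) (fun v hv => by rw [y1 v hv]),
    hconst _ (fun v => y v ^ 2) (yB ^ 2) (fun v hv => by rw [y2 v hv]),
    hconst _ (fun v => y v ^ 2) (yW ^ 2) (fun v hv => by rw [y3 v hv]), hcard] at h1
  linarith

theorem isTuranSusp_turanSuspAt (n q : ℕ) (hq : 2 ≤ q) (hqn : q ≤ n) :
    (turanSuspAt n q 0).IsTuranSusp ⟨0, by omega⟩ {v | v.1 < q / 2}
      {v | q / 2 ≤ v.1 ∧ v.1 < q} {v | q ≤ v.1} where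
  mem := by simp; omega
  disjAB := by
    rw [Finset.disjoint_left]; intro v; simp only [mem_filter, mem_univ, true_and]; omega
  disjAW := by
    rw [Finset.disjoint_left]; intro v; simp only [mem_filter, mem_univ, true_and]; omega
  disjBW := by
    rw [Finset.disjoint_left]; intro v; simp only [mem_filter, mem_univ, true_and]; omega
  cover v := by simp only [mem_filter, mem_univ, true_and]; omega
  adj x y := by
    simp only [turanSuspAt, fromRel_adj, mem_filter, mem_univ, true_and, mem_insert, Fin.ext_iff]
    refine and_congr_right fun _ => ?_
    tauto

theorem card_filter_fin (n a b : ℕ) (hb : b ≤ n) :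
    #{v : Fin n | a ≤ v.1 ∧ v.1 < b} = b - a := by
  rw [← Nat.card_Ico a b, ← card_map Fin.valEmbedding]
  congr 1
  ext i
  simp only [mem_map, mem_filter, mem_univ, true_and, Fin.valEmbedding_apply, mem_Ico]
  constructor
  · rintro ⟨v, hv, rfl⟩; exact hv
  · intro h; exact ⟨⟨i, by omega⟩, h, rfl⟩

theorem card_turan_classes (n q : ℕ) (hqn : q ≤ n) :
    #{v : Fin n | v.1 < q / 2} = q / 2 ∧ #{v : Fin n | q / 2 ≤ v.1 ∧ v.1 < q} = q - q / 2 ∧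
      #{v : Fin n | q ≤ v.1} = n - q := by
  refine ⟨?_, card_filter_fin n _ _ hqn, ?_⟩
  · simpa using card_filter_fin n 0 (q / 2) (by omega)
  · simpa using card_filter_fin n q n le_rfl

end TuranSusp

section TuranBounds

open Finset

variable {V : Type*} [DecidableEq V] {G : SimpleGraph V}

theorem IsTuranSusp.two_mul_le [Fintype V] [DecidableRel G.Adj] {s : V} {A B W : Finset V}
    (h : G.IsTuranSusp s A B W) {lam : ℝ}
    (hray : ∀ y : V → ℝ, G.adjForm y y ≤ lam * ∑ v, y v ^ 2) :
    2 * (#A * #B : ℝ) ≤ lam * (#A + #B) := by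
  have := h.form_le hray 1 1 1 0
  linarith

theorem IsTuranSusp.le_sq [Fintype V] [DecidableRel G.Adj] {s : V} {A B W : Finset V}
    (h : G.IsTuranSusp s A B W) {lam κ : ℝ} (hlam : 0 < lam)
    (hray : ∀ y : V → ℝ, G.adjForm y y ≤ lam * ∑ v, y v ^ 2)
    (hκ : κ * (lam - #W + 1) = 1) (hκ0 : 0 < lam - κ * #W) :
    #B * (#A - 1 + lam / (lam - κ * #W)) ≤ lam ^ 2 := by
  set b : ℝ := (#B : ℝ)
  set a : ℝ := (#A : ℝ)
  set w : ℝ := (#W : ℝ)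
  have h1 := h.form_le hray (b / (lam - κ * w)) (b / lam) 1 (κ * (b / (lam - κ * w)))
  set t := b / (lam - κ * w) with ht
  have e1 : t * (lam - κ * w) = b := by rw [ht]; field_simp
  have e2 : lam * (b / lam) = b := by field_simp
  set y := b / lam with hy
  have h2 : (a - 1) * (b * y) + b * t ≤ lam * b := by
    have e3 : lam * (a - 1) * y ^ 2 = (a - 1) * b * y := by rw [← e2]; ring
    have e4 : w * (w - 1) * (κ * t) ^ 2 - lam * w * (κ * t) ^ 2 = - (w * κ * t ^ 2) := by
      linear_combination (- w * κ * t ^ 2) * hκ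
    have e5 : lam * t ^ 2 - w * κ * t ^ 2 = b * t := by linear_combination t * e1
    nlinarith
  have e6 : lam / (lam - κ * w) * b = lam * t := by rw [ht]; ring
  have h3 : b * (a - 1 + lam / (lam - κ * w)) = lam * ((a - 1) * y + t) := by
    linear_combination e6 - (a - 1) * e2
  rw [h3]
  by_cases hb : b = 0
  · have hy0 : y = 0 := by rw [hy, hb, zero_div]
    have ht0 : t = 0 := by rw [ht, hb, zero_div]
    rw [hy0, ht0]; nlinarith [sq_nonneg lam]
  · have hb0 : 0 < b := lt_of_le_of_ne (Nat.cast_nonneg _) (Ne.symm hb)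
    have : (a - 1) * y + t ≤ lam := by nlinarith
    nlinarith

end TuranBounds

section Weights

open Finset

variable {V : Type*} [Fintype V] [DecidableEq V] {G : SimpleGraph V} [DecidableRel G.Adj]

/-- A dense pair `A, B` in a `C_{2k+1}`-free graph together with an eigenvector of maximum `1` for
a large eigenvalue. -/
structure SpectralCore (G : SimpleGraph V) [DecidableRel G.Adj] (k : ℕ) (A B : Finset V)
    (x : V → ℝ) (lam : ℝ) : Prop where
  two_le : 2 ≤ k
  le_card : 712 * (k : ℝ) ≤ Fintype.card V
  free : G.CycleFree (2 * k + 1)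
  disj : Disjoint A B
  left : ∀ a ∈ A, 0.29 * (Fintype.card V : ℝ) ≤ G.dg B a
  right : ∀ b ∈ B, 0.29 * (Fintype.card V : ℝ) ≤ G.dg A b
  out_left : ∀ v, v ∉ A → v ∉ B → (G.dg A v : ℝ) < 0.29 * (Fintype.card V : ℝ)
  out_right : ∀ v, v ∉ A → v ∉ B → (G.dg B v : ℝ) < 0.29 * (Fintype.card V : ℝ)
  card_left : (#A : ℝ) ≤ 0.568 * (Fintype.card V : ℝ)
  card_right : (#B : ℝ) ≤ 0.568 * (Fintype.card V : ℝ)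
  card_add : 0.932 * (Fintype.card V : ℝ) ≤ #A + #B
  le_lam : (Fintype.card V : ℝ) / 2 - k ≤ lam
  nonneg : ∀ v, 0 ≤ x v
  le_one : ∀ v, x v ≤ 1
  top : ∃ u, x u = 1
  eig : ∀ v, lam * x v = ∑ w with G.Adj v w, x w

variable {k : ℕ} {A B : Finset V} {x : V → ℝ} {lam : ℝ}

theorem SpectralCore.symm (h : G.SpectralCore k A B x lam) : G.SpectralCore k B A x lam :=
  ⟨h.two_le, h.le_card, h.free, h.disj.symm, h.right, h.left, fun v hA hB => h.out_right v hB hA,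
    fun v hA hB => h.out_left v hB hA, h.card_right, h.card_left, by
      rw [add_comm]; exact h.card_add, h.le_lam, h.nonneg, h.le_one, h.top, h.eig⟩

theorem card_common_nbrs_add_card (S : Finset V) (a a' : V) :
    G.dg S a + G.dg S a' ≤ #{b ∈ S | G.Adj a b ∧ G.Adj a' b} + #S := by
  rw [dg, dg, ← card_union_add_card_inter, ← filter_and, add_comm]
  exact Nat.add_le_add_left (card_le_card (union_subset (filter_subset _ _) (filter_subset _ _))) _

theorem SpectralCore.isCore (h : G.SpectralCore k A B x lam) : G.IsCore (8 * k) A B := by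
  have hn := h.le_card
  have hk : (2 : ℝ) ≤ k := by exact_mod_cast h.two_le
  have aux : ∀ {S : Finset V} {v : V}, 0.29 * (Fintype.card V : ℝ) ≤ G.dg S v →
      8 * k ≤ G.dg S v := fun {S v} hv => by
    have : (8 * k : ℝ) ≤ G.dg S v := by linarith
    exact_mod_cast this
  have aux2 : ∀ {S : Finset V} {v v' : V}, (#S : ℝ) ≤ 0.568 * (Fintype.card V : ℝ) →
      0.29 * (Fintype.card V : ℝ) ≤ G.dg S v →
      0.29 * (Fintype.card V : ℝ) ≤ G.dg S v' → 8 * k ≤ #{b ∈ S | G.Adj v b ∧ G.Adj v' b} :=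
    fun {S v v'} hS hv hv' => by
      have h1 : ((G.dg S v : ℝ) + G.dg S v') ≤ #{b ∈ S | G.Adj v b ∧ G.Adj v' b} + #S := by
        exact_mod_cast card_common_nbrs_add_card S v v'
      have : (8 * k : ℝ) ≤ #{b ∈ S | G.Adj v b ∧ G.Adj v' b} := by linarith
      exact_mod_cast this
  exact ⟨h.disj, fun a ha => aux (h.left a ha), fun b hb => aux (h.right b hb),
    fun a ha a' ha' => aux2 h.card_right (h.left a ha) (h.left a' ha'),
    fun b hb b' hb' => aux2 h.card_left (h.right b hb) (h.right b' hb')⟩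

theorem SpectralCore.not_adj_left (h : G.SpectralCore k A B x lam) {a a' : V} (ha : a ∈ A)
    (ha' : a' ∈ A) : ¬ G.Adj a a' := fun hadj => by
  have := h.two_le
  exact h.isCore.false_of_same (l := []) h.free (by omega) ha ha' hadj.ne (by simp) (by simp)
    (lPath_nil.2 hadj) (by simp) (by simp; omega)

theorem SpectralCore.not_adj_both (h : G.SpectralCore k A B x lam) {a b v : V} (ha : a ∈ A)
    (hb : b ∈ B) (hv : v ∉ A ∪ B) (hva : G.Adj v a) : ¬ G.Adj v b := fun hvb => by
  have := h.two_le
  exact h.isCore.false_of_opp (l := [v]) h.free (by omega) ha hb (by simpa using hv) (by simp)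
    (lPath_cons.2 ⟨hva.symm, lPath_nil.2 hvb⟩) (by simp) (by simp; omega)

theorem dg_eq_zero_iff {S : Finset V} {v : V} : G.dg S v = 0 ↔ ∀ w ∈ S, ¬ G.Adj v w := by
  rw [dg, card_eq_zero, filter_eq_empty_iff]

theorem SpectralCore.dg_left_eq_zero (h : G.SpectralCore k A B x lam) {a : V} (ha : a ∈ A) :
    G.dg A a = 0 := dg_eq_zero_iff.2 fun _ hw => h.not_adj_left ha hw

theorem SpectralCore.dg_eq_zero_or (h : G.SpectralCore k A B x lam) {v : V} (hv : v ∉ A ∪ B) :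
    G.dg A v = 0 ∨ G.dg B v = 0 := by
  by_contra! hcon
  simp only [ne_eq, dg_eq_zero_iff, not_forall, not_not] at hcon
  obtain ⟨⟨a, ha, hva⟩, ⟨b, hb, hvb⟩⟩ := hcon
  exact h.not_adj_both ha hb hv hva hvb

theorem mul_sum_eq_sum_dg (heig : ∀ v, lam * x v = ∑ w with G.Adj v w, x w) (S : Finset V) :
    lam * ∑ v ∈ S, x v = ∑ w, (G.dg S w : ℝ) * x w := by
  rw [mul_sum, sum_congr rfl fun v _ => heig v]
  simp only [sum_filter]
  rw [sum_comm]
  refine sum_congr rfl fun w _ => ?_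
  rw [dg, ← sum_filter, sum_const, nsmul_eq_mul]
  simp only [G.adj_comm]

/-- The weight entering `A` splits into the contribution of `B` and that of outer vertices. -/
theorem SpectralCore.mul_sum_left (h : G.SpectralCore k A B x lam) :
    lam * ∑ v ∈ A, x v = ∑ w ∈ B, (G.dg A w : ℝ) * x w + ∑ w ∈ (A ∪ B)ᶜ, (G.dg A w : ℝ) * x w := by
  rw [mul_sum_eq_sum_dg h.eig, ← sum_add_sum_compl (A ∪ B), sum_union h.disj,
    sum_eq_zero (s := A) fun w hw => by rw [h.dg_left_eq_zero hw]; simp, zero_add]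

theorem SpectralCore.mul_sum_left_le (h : G.SpectralCore k A B x lam) :
    lam * ∑ v ∈ A, x v ≤ #A * ∑ w ∈ B, x w + ∑ w ∈ (A ∪ B)ᶜ, (G.dg A w : ℝ) * x w := by
  rw [h.mul_sum_left, mul_sum]
  gcongr with w hw
  · exact h.nonneg w
  · exact dg_le_card A w

theorem SpectralCore.mul_le_of_notMem (h : G.SpectralCore k A B x lam) {v : V} (hv : v ∉ A ∪ B) :
    lam * x v ≤ 0.29 * (Fintype.card V : ℝ) + #(A ∪ B)ᶜ := by
  rw [mem_union, not_or] at hv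
  have h1 : lam * x v ≤ G.dg univ v := by
    rw [h.eig, dg, ← nsmul_one]
    exact sum_le_card_nsmul _ _ _ fun w _ => h.le_one w
  have h2 : G.dg univ v = G.dg A v + G.dg B v + G.dg (A ∪ B)ᶜ v := by
    rw [← dg_union h.disj, ← dg_union disjoint_compl_right, union_compl]
  have h3 : (G.dg (A ∪ B)ᶜ v : ℝ) ≤ #(A ∪ B)ᶜ := by exact_mod_cast dg_le_card _ v
  have h4 : (G.dg A v + G.dg B v : ℝ) ≤ 0.29 * (Fintype.card V : ℝ) := by
    rcases h.dg_eq_zero_or (v := v) (by simp [hv]) with h5 | h5 <;> rw [h5]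
    · simpa using (h.out_right v hv.1 hv.2).le
    · simpa using (h.out_left v hv.1 hv.2).le
  rw [h2] at h1
  push_cast at h1
  linarith

theorem SpectralCore.card_outer (h : G.SpectralCore k A B x lam) :
    (#(A ∪ B)ᶜ : ℝ) = Fintype.card V - #A - #B := by
  rw [card_compl, Nat.cast_sub (card_le_univ _), card_union_of_disjoint h.disj]
  push_cast; ring

/-- Lower bounds for the total weights of the two sides, in terms of a bound `ξ` for the weights
of the outer vertices. -/
theorem SpectralCore.sum_ge (h : G.SpectralCore k A B x lam) {ξ c : ℝ} (hξ1 : ξ < 1)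
    (hcA : #A ≤ c * Fintype.card V) (hcB : #B ≤ c * Fintype.card V)
    (hξ : ∀ v, v ∉ A ∪ B → x v ≤ ξ) :
    (lam - ξ * #(A ∪ B)ᶜ ≤ ∑ v ∈ A, x v ∧ lam * (∑ v ∈ A, x v) ≤
        c * Fintype.card V * (∑ v ∈ B, x v) + 0.29 * Fintype.card V * ξ * #(A ∪ B)ᶜ) ∨
    (lam - ξ * #(A ∪ B)ᶜ ≤ ∑ v ∈ B, x v ∧ lam * (∑ v ∈ B, x v) ≤
        c * Fintype.card V * (∑ v ∈ A, x v) + 0.29 * Fintype.card V * ξ * #(A ∪ B)ᶜ) := by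
  have key : ∀ {A B : Finset V}, G.SpectralCore k A B x lam →
      #B ≤ c * (Fintype.card V : ℝ) → (∀ v, v ∉ A ∪ B → x v ≤ ξ) →
      ∀ u ∈ A, x u = 1 → (lam - ξ * #(A ∪ B)ᶜ ≤ ∑ v ∈ B, x v ∧ lam * (∑ v ∈ B, x v) ≤
        c * Fintype.card V * (∑ v ∈ A, x v) + 0.29 * Fintype.card V * ξ * #(A ∪ B)ᶜ) := by
    intro A B h hcB hξ u hu hu1
    constructor
    · have h1 : lam = ∑ w with G.Adj u w, x w := by rw [← h.eig, hu1, mul_one]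
      have h2 : ∑ w with G.Adj u w, x w ≤ ∑ w ∈ B ∪ (A ∪ B)ᶜ, x w := by
        refine sum_le_sum_of_subset_of_nonneg (fun w hw => ?_) fun w _ _ => h.nonneg w
        rw [mem_filter] at hw
        have := h.not_adj_left hu (a' := w)
        simp only [mem_union, mem_compl, not_or]
        tauto
      rw [sum_union (disjoint_compl_right.mono_left subset_union_right)] at h2
      have h3 : ∑ w ∈ (A ∪ B)ᶜ, x w ≤ #(A ∪ B)ᶜ * ξ := by
        rw [← nsmul_eq_mul]
        exact sum_le_card_nsmul _ _ _ fun w hw => hξ w (mem_compl.1 hw)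
      linarith
    · have h1 := h.symm.mul_sum_left_le
      rw [union_comm B A] at h1
      have h2 : ∑ w ∈ (A ∪ B)ᶜ, (G.dg B w : ℝ) * x w
          ≤ #(A ∪ B)ᶜ * (0.29 * Fintype.card V * ξ) := by
        rw [← nsmul_eq_mul]
        refine sum_le_card_nsmul _ _ _ fun w hw => ?_
        have hw' := mem_compl.1 hw
        have h3 := hξ w hw'
        rw [mem_union, not_or] at hw'
        have h4 := h.out_right w hw'.1 hw'.2
        have := h.nonneg w
        gcongr
      have h3 : (#B : ℝ) * ∑ w ∈ A, x w ≤ c * Fintype.card V * ∑ w ∈ A, x w :=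
        mul_le_mul_of_nonneg_right hcB (sum_nonneg fun w _ => h.nonneg w)
      linarith
  obtain ⟨u, hu⟩ := h.top
  have huC : u ∈ A ∪ B := by
    by_contra hcon
    have := hξ u hcon
    linarith
  rcases mem_union.1 huC with huA | huB
  · exact Or.inr (key h hcB hξ u huA hu)
  · left
    have := key h.symm hcA (by rwa [union_comm]) u huB hu
    rwa [union_comm] at this

theorem sum_cost_eq (S : Finset V) :
    ∑ w ∈ S, (G.dg A w / (∑ v ∈ B, x v) + G.dg B w / (∑ v ∈ A, x v)) * x w =
      (∑ w ∈ S, G.dg A w * x w) / (∑ v ∈ B, x v) + (∑ w ∈ S, G.dg B w * x w) / ∑ v ∈ A, x v := by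
  rw [sum_div, sum_div, ← sum_add_distrib]
  exact sum_congr rfl fun w _ => by ring

theorem SpectralCore.two_mul_lam_le (h : G.SpectralCore k A B x lam) (hlam : 0 < lam)
    (hA : 0 < ∑ v ∈ A, x v) (hB : 0 < ∑ v ∈ B, x v) :
    2 * lam ≤ #A + #B + ∑ w ∈ (A ∪ B)ᶜ,
      (G.dg A w / (∑ v ∈ B, x v) + G.dg B w / (∑ v ∈ A, x v)) * x w := by
  have h1 := h.mul_sum_left_le
  have h2 := h.symm.mul_sum_left_le
  rw [union_comm B A] at h2
  rw [sum_cost_eq]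
  set XA := ∑ v ∈ A, x v
  set XB := ∑ v ∈ B, x v
  have h3 : lam * (XA / XB) ≤ #A + (∑ w ∈ (A ∪ B)ᶜ, G.dg A w * x w) / XB := by
    rw [← mul_div_assoc, div_le_iff₀ hB, add_mul, div_mul_cancel₀ _ hB.ne']
    exact h1
  have h4 : lam * (XB / XA) ≤ #B + (∑ w ∈ (A ∪ B)ᶜ, G.dg B w * x w) / XA := by
    rw [← mul_div_assoc, div_le_iff₀ hA, add_mul, div_mul_cancel₀ _ hA.ne']
    exact h2
  have h5 : 2 ≤ XA / XB + XB / XA := by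
    rw [div_add_div _ _ hB.ne' hA.ne', le_div_iff₀ (by positivity)]
    nlinarith [sq_nonneg (XA - XB)]
  nlinarith

theorem SpectralCore.card_pos (h : G.SpectralCore k A B x lam) : 1424 ≤ (Fintype.card V : ℝ) := by
  have := h.le_card
  have hk : (2 : ℝ) ≤ k := by exact_mod_cast h.two_le
  linarith

theorem SpectralCore.lam_ge (h : G.SpectralCore k A B x lam) :
    0.49859 * (Fintype.card V : ℝ) ≤ lam := by
  have := h.le_card
  have := h.le_lam
  linarith

theorem SpectralCore.cost_le (h : G.SpectralCore k A B x lam) {X ξ : ℝ} (hX : 0 < X)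
    (hξ : ∀ v, v ∉ A ∪ B → x v ≤ ξ)
    (hA : X ≤ ∑ v ∈ A, x v) (hB : X ≤ ∑ v ∈ B, x v) {w : V} (hw : w ∉ A ∪ B) :
    (G.dg A w / (∑ v ∈ B, x v) + G.dg B w / (∑ v ∈ A, x v)) * x w
      ≤ 0.29 * Fintype.card V * ξ / X := by
  have hw' := hw
  rw [mem_union, not_or] at hw'
  have h3 := h.out_left w hw'.1 hw'.2
  have h4 := h.out_right w hw'.1 hw'.2
  have h5 := hξ w hw
  have h6 := h.nonneg w
  have : (G.dg A w / (∑ v ∈ B, x v) + G.dg B w / (∑ v ∈ A, x v))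
      ≤ 0.29 * Fintype.card V / X := by
    rcases h.dg_eq_zero_or hw with h7 | h7 <;> rw [h7] <;> simp only [Nat.cast_zero, zero_div,
      zero_add, add_zero]
    · gcongr
    · gcongr
  calc _ ≤ 0.29 * Fintype.card V / X * ξ := by gcongr
    _ = _ := by ring

theorem SpectralCore.card_outer_le (h : G.SpectralCore k A B x lam) : #(A ∪ B)ᶜ ≤ 5 * k := by
  have hn := h.card_pos
  have hl := h.lam_ge
  have hc := h.card_outer
  have hca := h.card_add
  have hk := h.le_card
  have hll := h.le_lam
  set N : ℝ := (Fintype.card V : ℝ) with hN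
  set ν : ℝ := (#(A ∪ B)ᶜ : ℝ) with hν
  have hν0 : 0 ≤ ν := Nat.cast_nonneg _
  have hν1 : ν ≤ 0.068 * N := by linarith
  have hξ : ∀ v, v ∉ A ∪ B → x v ≤ 0.719 := fun v hv => by
    have := h.mul_le_of_notMem hv
    by_contra! hcon
    have : lam * 0.719 ≤ lam * x v := by gcongr; linarith
    linarith
  have hX : 0.369 * N ≤ ∑ v ∈ A, x v ∧ 0.369 * N ≤ ∑ v ∈ B, x v := by
    rcases h.sum_ge (by norm_num) h.card_left h.card_right hξ with ⟨h1, h2⟩ | ⟨h1, h2⟩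
    · have h4 : 0.449 * N ≤ ∑ v ∈ A, x v := by linarith
      refine ⟨by linarith, ?_⟩
      nlinarith
    · have h4 : 0.449 * N ≤ ∑ v ∈ B, x v := by linarith
      refine ⟨?_, by linarith⟩
      nlinarith
  have h1 := h.two_mul_lam_le (by linarith) (by linarith) (by linarith)
  have h2 : ∑ w ∈ (A ∪ B)ᶜ, (G.dg A w / (∑ v ∈ B, x v) + G.dg B w / (∑ v ∈ A, x v)) * x w
      ≤ ν * 0.5651 := by
    rw [hν, ← nsmul_eq_mul]
    refine sum_le_card_nsmul _ _ _ fun w hw => ?_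
    refine (h.cost_le (by linarith) hξ hX.1 hX.2 (mem_compl.1 hw)).trans ?_
    rw [div_le_iff₀ (by linarith)]
    linarith
  have h3 : ν ≤ 5 * k := by linarith
  rw [hν] at h3
  exact_mod_cast h3

theorem SpectralCore.le_of_notMem (h : G.SpectralCore k A B x lam) {v : V} (hv : v ∉ A ∪ B) :
    x v ≤ 0.5958 := by
  have hn := h.card_pos
  have hl := h.lam_ge
  have hk := h.le_card
  have h1 : (#(A ∪ B)ᶜ : ℝ) ≤ 5 * k := by exact_mod_cast h.card_outer_le
  have := h.mul_le_of_notMem hv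
  by_contra! hcon
  have : lam * 0.5958 ≤ lam * x v := by gcongr; linarith
  linarith

theorem SpectralCore.sum_ge' (h : G.SpectralCore k A B x lam) :
    0.431 * Fintype.card V ≤ ∑ v ∈ A, x v ∧ 0.431 * Fintype.card V ≤ ∑ v ∈ B, x v := by
  have hn := h.card_pos
  have hl := h.lam_ge
  have hk := h.le_card
  have h1 : (#(A ∪ B)ᶜ : ℝ) ≤ 5 * k := by exact_mod_cast h.card_outer_le
  set N : ℝ := (Fintype.card V : ℝ) with hN
  set ν : ℝ := (#(A ∪ B)ᶜ : ℝ) with hν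
  have hν1 : ν ≤ 0.00703 * N := by linarith
  rcases h.sum_ge (by norm_num) h.card_left h.card_right (fun v hv => h.le_of_notMem hv) with
    ⟨h1, h2⟩ | ⟨h1, h2⟩
  · have h4 : 0.4943 * N ≤ ∑ v ∈ A, x v := by linarith
    refine ⟨by linarith, ?_⟩
    nlinarith
  · have h4 : 0.4943 * N ≤ ∑ v ∈ B, x v := by linarith
    refine ⟨?_, by linarith⟩
    nlinarith

end Weights

section Outer

open Finset

variable {V : Type*} [Fintype V] [DecidableEq V] {G : SimpleGraph V} [DecidableRel G.Adj]

variable (G) in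
/-- The vertices outside `C` with at least two neighbours in `C`. -/
def multi (C : Finset V) : Finset V := {w ∈ Cᶜ | 2 ≤ G.dg C w}

variable (G) in
/-- The vertices outside `C` with at most one neighbour in `C`. -/
def pend (C : Finset V) : Finset V := {w ∈ Cᶜ | ¬ 2 ≤ G.dg C w}

theorem mem_multi {C : Finset V} {w : V} : w ∈ G.multi C ↔ w ∉ C ∧ 2 ≤ G.dg C w := by
  simp [multi]

theorem mem_pend {C : Finset V} {w : V} : w ∈ G.pend C ↔ w ∉ C ∧ G.dg C w ≤ 1 := by
  simp [pend]

theorem sum_multi_add_sum_pend (C : Finset V) (f : V → ℝ) :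
    ∑ w ∈ G.multi C, f w + ∑ w ∈ G.pend C, f w = ∑ w ∈ Cᶜ, f w :=
  sum_filter_add_sum_filter_not _ _ _

theorem card_multi_add_card_pend (C : Finset V) : #(G.multi C) + #(G.pend C) = #Cᶜ :=
  card_filter_add_card_filter_not _

variable {k : ℕ} {A B : Finset V} {x : V → ℝ} {lam : ℝ}

theorem SpectralCore.sum_pend_le (h : G.SpectralCore k A B x lam) :
    lam * ∑ w ∈ G.pend (A ∪ B), x w ≤ #(G.pend (A ∪ B)) *
      (1 + ∑ w ∈ G.multi (A ∪ B), x w + ∑ w ∈ G.pend (A ∪ B), x w) := by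
  have aux : ∀ S : Finset V, ∑ w ∈ S, (G.dg (G.pend (A ∪ B)) w : ℝ) * x w
      ≤ #(G.pend (A ∪ B)) * ∑ w ∈ S, x w := fun S => by
    rw [mul_sum]
    gcongr with w hw
    · exact h.nonneg w
    · exact dg_le_card _ w
  have hC : ∑ w ∈ A ∪ B, (G.dg (G.pend (A ∪ B)) w : ℝ) * x w ≤ #(G.pend (A ∪ B)) := by
    calc _ ≤ ∑ w ∈ A ∪ B, (G.dg (G.pend (A ∪ B)) w : ℝ) := by
          gcongr with w hw
          exact mul_le_of_le_one_right (Nat.cast_nonneg _) (h.le_one w)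
      _ = ∑ w ∈ G.pend (A ∪ B), (G.dg (A ∪ B) w : ℝ) := by
          exact_mod_cast sum_dg_comm (G := G) _ _
      _ ≤ #(G.pend (A ∪ B)) • (1 : ℝ) := by
          refine sum_le_card_nsmul _ _ _ fun w hw => ?_
          exact_mod_cast ((mem_pend (G := G)).1 hw).2
      _ = _ := by simp
  rw [mul_sum_eq_sum_dg h.eig, ← sum_add_sum_compl (A ∪ B), ← sum_multi_add_sum_pend (G := G)]
  have h1 := aux (G.multi (A ∪ B))
  have h2 := aux (G.pend (A ∪ B))
  linarith

theorem SpectralCore.dg_union_eq (h : G.SpectralCore k A B x lam) (w : V) :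
    G.dg (A ∪ B) w = G.dg A w + G.dg B w := dg_union (G := G) h.disj w

theorem SpectralCore.dg_union_le (h : G.SpectralCore k A B x lam) {w : V} (hw : w ∉ A ∪ B) :
    (G.dg (A ∪ B) w : ℝ) ≤ 0.29 * Fintype.card V := by
  have hw' := hw
  rw [mem_union, not_or] at hw'
  rw [h.dg_union_eq]
  rcases h.dg_eq_zero_or hw with h5 | h5 <;> rw [h5]
  · simpa using (h.out_right w hw'.1 hw'.2).le
  · simpa using (h.out_left w hw'.1 hw'.2).le

theorem SpectralCore.cost_le_dg (h : G.SpectralCore k A B x lam) {X : ℝ} (hX : 0 < X)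
    (hA : X ≤ ∑ v ∈ A, x v) (hB : X ≤ ∑ v ∈ B, x v) (w : V) :
    (G.dg A w / (∑ v ∈ B, x v) + G.dg B w / (∑ v ∈ A, x v)) * x w
      ≤ G.dg (A ∪ B) w * x w / X := by
  rw [h.dg_union_eq, mul_div_right_comm]
  push_cast
  rw [add_div]
  have := h.nonneg w
  gcongr

theorem SpectralCore.sum_cost_pend_le (h : G.SpectralCore k A B x lam) {X : ℝ} (hX : 0 < X)
    (hA : X ≤ ∑ v ∈ A, x v) (hB : X ≤ ∑ v ∈ B, x v) :
    ∑ w ∈ G.pend (A ∪ B), (G.dg A w / (∑ v ∈ B, x v) + G.dg B w / (∑ v ∈ A, x v)) * x w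
      ≤ (∑ w ∈ G.pend (A ∪ B), x w) / X := by
  rw [sum_div]
  refine sum_le_sum fun w hw => (h.cost_le_dg hX hA hB w).trans ?_
  have h1 : (G.dg (A ∪ B) w : ℝ) ≤ 1 := by exact_mod_cast ((mem_pend (G := G)).1 hw).2
  have := h.nonneg w
  gcongr
  exact mul_le_of_le_one_left this h1

theorem SpectralCore.sum_cost_multi_le (h : G.SpectralCore k A B x lam) {S : Finset V}
    (hS : S ⊆ (A ∪ B)ᶜ) :
    ∑ w ∈ S, (G.dg A w / (∑ v ∈ B, x v) + G.dg B w / (∑ v ∈ A, x v)) * x w ≤ 0.41 * #S := by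
  have hn := h.card_pos
  have hX := h.sum_ge'
  rw [mul_comm, ← nsmul_eq_mul]
  refine sum_le_card_nsmul _ _ _ fun w hw => ?_
  refine (h.cost_le (by linarith) (fun v hv => h.le_of_notMem hv) hX.1 hX.2
    (mem_compl.1 (hS hw))).trans ?_
  rw [div_le_iff₀ (by linarith)]
  linarith

theorem multi_subset {C : Finset V} : G.multi C ⊆ Cᶜ := filter_subset _ _

theorem SpectralCore.two_mul_lam_add_le (h : G.SpectralCore k A B x lam) :
    2 * lam + #(G.pend (A ∪ B)) + 0.59 * #(G.multi (A ∪ B)) ≤ Fintype.card V + 0.001 := by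
  have hn := h.card_pos
  have hl := h.lam_ge
  have hk := h.le_card
  have hk2 : (2 : ℝ) ≤ k := by exact_mod_cast h.two_le
  have hν : (#(A ∪ B)ᶜ : ℝ) ≤ 5 * k := by exact_mod_cast h.card_outer_le
  have hc := h.card_outer
  have hX := h.sum_ge'
  have h1 := h.two_mul_lam_le (by linarith) (by linarith) (by linarith)
  rw [← sum_multi_add_sum_pend (G := G)] at h1
  have h2 := h.sum_cost_multi_le (multi_subset (G := G))
  have h3 := h.sum_cost_pend_le (by linarith) hX.1 hX.2
  have h4 := h.sum_pend_le
  have hcard : (#(G.multi (A ∪ B)) + #(G.pend (A ∪ B)) : ℝ) = #(A ∪ B)ᶜ := by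
    exact_mod_cast card_multi_add_card_pend (G := G) _
  have h5 : ∑ w ∈ G.multi (A ∪ B), x w + ∑ w ∈ G.pend (A ∪ B), x w ≤ 5 * k := by
    rw [sum_multi_add_sum_pend (G := G)]
    refine (sum_le_card_nsmul _ _ 1 fun w _ => h.le_one w).trans ?_
    simpa using hν
  have hM0 : 0 ≤ ∑ w ∈ G.multi (A ∪ B), x w := sum_nonneg fun w _ => h.nonneg w
  have hS0 : 0 ≤ ∑ w ∈ G.pend (A ∪ B), x w := sum_nonneg fun w _ => h.nonneg w
  set S := ∑ w ∈ G.pend (A ∪ B), x w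
  have hl0 : 0 ≤ lam := by linarith
  have hδ : (#(G.pend (A ∪ B)) : ℝ) ≤ 5 * k := by
    have : (0 : ℝ) ≤ #(G.multi (A ∪ B)) := Nat.cast_nonneg _
    linarith
  have h6 : lam * S ≤ 5 * k * (1 + 5 * k) := 
    h4.trans (mul_le_mul hδ (by linarith) (by linarith) (by positivity))
  have h7 : S / (0.431 * (Fintype.card V : ℝ)) ≤ 0.001 := by
    rw [div_le_iff₀ (by linarith)]
    by_contra! hcon
    have : lam * (0.001 * (0.431 * (Fintype.card V : ℝ))) ≤ lam * S := by gcongr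
    have e1 : 0.49859 * (712 * (k : ℝ)) ≤ lam := by linarith
    have e2 : (0.49859 * (712 * (k : ℝ))) * (0.001 * (0.431 * (712 * (k : ℝ))))
       ≤ lam * (0.001 * (0.431 * (Fintype.card V : ℝ))) := by gcongr
    nlinarith
  linarith

end Outer

section Missing

open Finset

variable {V : Type*} [Fintype V] [DecidableEq V] {G : SimpleGraph V} [DecidableRel G.Adj]
  {k : ℕ} {A B : Finset V} {x : V → ℝ} {lam : ℝ}

theorem le_of_mul_le_add {lam a b X Y EX EY N : ℝ} (hX : 0 < X) (hY : 0 < Y) (hN : 0 < N)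
    (hlam : 0.49859 * N ≤ lam) (ha : 0 ≤ a) (hE : 0 ≤ EX)
    (h1 : lam * X ≤ a * Y + EX) (h2 : lam * Y ≤ b * X + EY) (h3 : a + b + (EX / Y + EY / X) ≤ N) :
    a ≤ 0.5377 * N := by
  obtain ⟨α, hα⟩ : ∃ α, α = EX / Y := ⟨_, rfl⟩
  obtain ⟨β, hβ⟩ : ∃ β, β = EY / X := ⟨_, rfl⟩
  have hα0 : 0 ≤ α := by rw [hα]; positivity
  rw [← hα, ← hβ] at h3
  rw [eq_div_iff hY.ne'] at hα
  rw [eq_div_iff hX.ne'] at hβ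
  have hlam0 : 0 < lam := by linarith
  have h4 : (lam * X) * (lam * Y) ≤ ((a + α) * Y) * ((b + β) * X) :=
    mul_le_mul (by linarith) (by linarith) (by positivity) (by positivity)
  have h5 : lam * lam ≤ (a + α) * (b + β) :=
    le_of_mul_le_mul_right (by linarith) (mul_pos hX hY)
  have h6 : (a + α) * (b + β) ≤ (a + α) * (N - (a + α)) :=
    mul_le_mul_of_nonneg_left (by linarith) (by positivity)
  by_contra! hcon
  have h7 : 0.49859 * N * (0.49859 * N) ≤ lam * lam := by gcongr
  have h8 : 0 ≤ (a + α - 0.5377 * N) * (a + α - 0.4623 * N) :=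
    mul_nonneg (by linarith) (by linarith)
  linarith [mul_pos hN hN]

theorem SpectralCore.card_left_le (h : G.SpectralCore k A B x lam) :
    (#A : ℝ) ≤ 0.5377 * Fintype.card V := by
  have hn := h.card_pos
  have hc := h.card_outer
  obtain ⟨hXA, hXB⟩ := h.sum_ge'
  have h1 := h.mul_sum_left_le
  have h2 := h.symm.mul_sum_left_le
  rw [union_comm B A] at h2
  have h3 := h.sum_cost_multi_le (subset_refl (A ∪ B)ᶜ)
  rw [sum_cost_eq] at h3
  have hν : (0 : ℝ) ≤ #(A ∪ B)ᶜ := Nat.cast_nonneg _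
  exact le_of_mul_le_add (by linarith) (by linarith) (by linarith) h.lam_ge (Nat.cast_nonneg _)
    (sum_nonneg fun w _ => mul_nonneg (Nat.cast_nonneg _) (h.nonneg w)) h1 h2 (by linarith)

theorem SpectralCore.sum_ge_of_card_le (h : G.SpectralCore k A B x lam)
    (hν : #(A ∪ B)ᶜ ≤ 2 * k) :
    0.459 * Fintype.card V ≤ ∑ v ∈ A, x v ∧ 0.459 * Fintype.card V ≤ ∑ v ∈ B, x v := by
  have hn := h.card_pos
  have hl := h.lam_ge
  have hk := h.le_card
  have h1 : (#(A ∪ B)ᶜ : ℝ) ≤ 2 * k := by exact_mod_cast hν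
  set N : ℝ := (Fintype.card V : ℝ) with hN
  set ν : ℝ := (#(A ∪ B)ᶜ : ℝ) with hν
  have hν1 : ν ≤ 0.00281 * N := by linarith
  rcases h.sum_ge (by norm_num) h.card_left_le h.symm.card_left_le
    (fun v hv => h.le_of_notMem hv) with ⟨h1, h2⟩ | ⟨h1, h2⟩
  · have h4 : 0.4969 * N ≤ ∑ v ∈ A, x v := by linarith
    refine ⟨by linarith, ?_⟩
    nlinarith
  · have h4 : 0.4969 * N ≤ ∑ v ∈ B, x v := by linarith
    refine ⟨?_, by linarith⟩
    nlinarith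

/-- If there are no edges between `P ⊆ A` and `Q ⊆ B`, then `A` receives correspondingly less
weight. -/
theorem SpectralCore.mul_sum_left_le_of_missing (h : G.SpectralCore k A B x lam) {P Q : Finset V}
    (hP : P ⊆ A) (hQ : Q ⊆ B) (hPQ : ∀ a ∈ P, ∀ b ∈ Q, ¬ G.Adj a b) :
    lam * ∑ v ∈ A, x v + #P * ∑ w ∈ Q, x w ≤
      #A * ∑ w ∈ B, x w + ∑ w ∈ (A ∪ B)ᶜ, (G.dg A w : ℝ) * x w := by
  rw [h.mul_sum_left, add_right_comm]
  gcongr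
  rw [← sum_sdiff hQ, ← sum_sdiff hQ, mul_add, add_assoc, mul_sum, mul_sum, mul_sum,
    ← sum_add_distrib]
  gcongr with w hw w hw
  · exact h.nonneg w
  · exact dg_le_card A w
  · rw [← add_mul]
    have := h.nonneg w
    gcongr
    have h1 : G.dg A w ≤ #(A \ P) := by
      refine card_le_card fun v hv => ?_
      rw [mem_filter] at hv
      exact mem_sdiff.2 ⟨hv.1, fun hvP => hPQ v hvP w hw hv.2.symm⟩
    rw [card_sdiff_of_subset hP] at h1
    have h2 := card_le_card hP
    have : G.dg A w + #P ≤ #A := by omega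
    exact_mod_cast this

theorem SpectralCore.le_mul_right (h : G.SpectralCore k A B x lam) {b : V} (hb : b ∈ B) :
    ∑ v ∈ A, x v - 0.2477 * Fintype.card V ≤ lam * x b := by
  have h1 : ∑ v ∈ A with ¬ G.Adj b v, x v ≤ 0.2477 * Fintype.card V := by
    have h2 : ∑ v ∈ A with ¬ G.Adj b v, x v ≤ #{v ∈ A | ¬ G.Adj b v} := by
      rw [← nsmul_one]
      exact sum_le_card_nsmul _ _ _ fun v _ => h.le_one v
    have h3 : (G.dg A b + #{v ∈ A | ¬ G.Adj b v} : ℝ) = #A := by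
      exact_mod_cast card_filter_add_card_filter_not _
    have h4 := h.right b hb
    have h5 := h.card_left_le
    linarith
  have h2 : ∑ v ∈ A with G.Adj b v, x v ≤ lam * x b := by
    rw [h.eig]
    exact sum_le_sum_of_subset_of_nonneg (filter_subset_filter _ (subset_univ _))
      fun v _ _ => h.nonneg v
  rw [← sum_filter_add_sum_filter_not A (fun v => G.Adj b v)]
  linarith

theorem SpectralCore.sum_pend_le_of_card_le (h : G.SpectralCore k A B x lam)
    (hν : #(A ∪ B)ᶜ ≤ 2 * k) (hμ : #(G.multi (A ∪ B)) ≤ 3) :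
    ∑ w ∈ G.multi (A ∪ B), x w ≤ 1.79 ∧ ∑ w ∈ G.pend (A ∪ B), x w ≤ 0.016 := by
  have hn := h.card_pos
  have hl := h.lam_ge
  have hk := h.le_card
  have h1 : (#(A ∪ B)ᶜ : ℝ) ≤ 2 * k := by exact_mod_cast hν
  have hμ' : (#(G.multi (A ∪ B)) : ℝ) ≤ 3 := by exact_mod_cast hμ
  have hcard : (#(G.multi (A ∪ B)) + #(G.pend (A ∪ B)) : ℝ) = #(A ∪ B)ᶜ := by
    exact_mod_cast card_multi_add_card_pend (G := G) _
  have h4 := h.sum_pend_le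
  have hM : ∑ w ∈ G.multi (A ∪ B), x w ≤ 1.79 := by
    have : ∑ w ∈ G.multi (A ∪ B), x w ≤ #(G.multi (A ∪ B)) * 0.5958 := by
      rw [← nsmul_eq_mul]
      exact sum_le_card_nsmul _ _ _ fun w hw => h.le_of_notMem ((mem_multi (G := G)).1 hw).1
    linarith
  refine ⟨hM, ?_⟩
  have hS0 : 0 ≤ ∑ w ∈ G.pend (A ∪ B), x w := sum_nonneg fun w _ => h.nonneg w
  have hμ0 : (0 : ℝ) ≤ #(G.multi (A ∪ B)) := Nat.cast_nonneg _
  set S := ∑ w ∈ G.pend (A ∪ B), x w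
  set N : ℝ := (Fintype.card V : ℝ) with hN
  have hδ : (#(G.pend (A ∪ B)) : ℝ) ≤ 0.00281 * N := by linarith
  have h5 : lam * S ≤ 0.00281 * N * (2.79 + S) :=
    h4.trans (mul_le_mul hδ (by linarith)
      (by linarith [sum_nonneg fun w (_ : w ∈ G.multi (A ∪ B)) => h.nonneg w]) (by linarith))
  by_contra! hcon
  have h6 : 0.49859 * N * S ≤ lam * S := by gcongr
  nlinarith

theorem SpectralCore.mul_le_of_mem_multi (h : G.SpectralCore k A B x lam)
    (hν : #(A ∪ B)ᶜ ≤ 2 * k) (hμ : #(G.multi (A ∪ B)) ≤ 3) (w : V) :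
    lam * x w ≤ G.dg (A ∪ B) w + 1.806 := by
  obtain ⟨h1, h2⟩ := h.sum_pend_le_of_card_le hν hμ
  have h3 := sum_multi_add_sum_pend (G := G) (A ∪ B) x
  rw [h.eig, ← sum_filter_add_sum_filter_not _ (· ∈ A ∪ B)]
  have h4 : ∑ v ∈ univ.filter (G.Adj w) with v ∈ A ∪ B, x v ≤ G.dg (A ∪ B) w := by
    have : filter (· ∈ A ∪ B) (univ.filter (G.Adj w)) = {v ∈ A ∪ B | G.Adj w v} := by
      ext v; simp [and_comm]
    rw [this, dg, ← nsmul_one]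
    exact sum_le_card_nsmul _ _ _ fun v _ => h.le_one v
  have h5 : ∑ v ∈ univ.filter (G.Adj w) with v ∉ A ∪ B, x v ≤ ∑ v ∈ (A ∪ B)ᶜ, x v :=
    sum_le_sum_of_subset_of_nonneg (fun v hv => mem_compl.2 (mem_filter.1 hv).2)
      fun v _ _ => h.nonneg v
  linarith

theorem lam_le_of_missing {lam a b c X Y EX EY N : ℝ} (hN : 0 < N) (hlam : 0 < lam)
    (hlamN : lam ≤ 0.501 * N) (hX : 0.459 * N ≤ X) (hY : 0.459 * N ≤ Y) (hc : 0 ≤ c)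
    (h1 : lam * X + c * ((X - 0.2477 * N) / lam) ≤ a * Y + EX)
    (h2 : lam * Y + c * ((Y - 0.2477 * N) / lam) ≤ b * X + EY) :
    2 * lam + 1.83 * c / N ≤ a + b + (EX / Y + EY / X) := by
  have hX0 : 0 < X := by linarith
  have hY0 : 0 < Y := by linarith
  have h3 : (lam * X + c * ((X - 0.2477 * N) / lam)) / Y ≤ a + EX / Y := by
    rwa [div_le_iff₀ hY0, add_mul, div_mul_cancel₀ _ hY0.ne']
  have h4 : (lam * Y + c * ((Y - 0.2477 * N) / lam)) / X ≤ b + EY / X := by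
    rwa [div_le_iff₀ hX0, add_mul, div_mul_cancel₀ _ hX0.ne']
  have h5 : 2 ≤ X / Y + Y / X := by
    rw [div_add_div _ _ hY0.ne' hX0.ne', le_div_iff₀ (by positivity)]
    linarith [sq_nonneg (X - Y)]
  have h6 : ∀ {Z : ℝ}, 0.459 * N ≤ Z → 0.2477 * N / Z ≤ 0.5397 := fun {Z} hZ => by
    rw [div_le_iff₀ (by linarith)]; linarith
  have h7 := h6 hX
  have h8 := h6 hY
  have h9 : (lam * X + c * ((X - 0.2477 * N) / lam)) / Y
      + (lam * Y + c * ((Y - 0.2477 * N) / lam)) / X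
      = lam * (X / Y + Y / X) + c / lam *
        (X / Y + Y / X - 0.2477 * N / X - 0.2477 * N / Y) := by
    field_simp
    ring
  have h10 : c / lam * 0.9206 ≤ c / lam * (X / Y + Y / X - 0.2477 * N / X - 0.2477 * N / Y) := by
    gcongr
    linarith
  have h11 : lam * 2 ≤ lam * (X / Y + Y / X) := by gcongr
  have h12 : 1.83 * c / N ≤ c / lam * 0.9206 := by
    rw [div_mul_eq_mul_div, div_le_div_iff₀ hN hlam]
    nlinarith
  linarith

theorem SpectralCore.lam_le (h : G.SpectralCore k A B x lam) :
    lam ≤ 0.501 * Fintype.card V := by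
  have hn := h.card_pos
  have := h.two_mul_lam_add_le
  have h1 : (0 : ℝ) ≤ #(G.pend (A ∪ B)) := Nat.cast_nonneg _
  have h2 : (0 : ℝ) ≤ #(G.multi (A ∪ B)) := Nat.cast_nonneg _
  linarith

theorem SpectralCore.le_sum_right (h : G.SpectralCore k A B x lam) {Q : Finset V} (hQ : Q ⊆ B) :
    #Q * ((∑ v ∈ A, x v - 0.2477 * Fintype.card V) / lam) ≤ ∑ w ∈ Q, x w := by
  have hn := h.card_pos
  have hl := h.lam_ge
  rw [← nsmul_eq_mul]
  refine card_nsmul_le_sum _ _ _ fun w hw => ?_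
  rw [div_le_iff₀ (by linarith), mul_comm (x w)]
  exact h.le_mul_right (hQ hw)

theorem SpectralCore.two_mul_lam_le_of_missing (h : G.SpectralCore k A B x lam)
    (hν : #(A ∪ B)ᶜ ≤ 2 * k) (hμ : #(G.multi (A ∪ B)) ≤ 3) {T P Q : Finset V}
    (hT : T ⊆ G.multi (A ∪ B)) (hP : P ⊆ A) (hQ : Q ⊆ B) (hPQ : ∀ a ∈ P, ∀ b ∈ Q, ¬ G.Adj a b)
    (hcount : 1.1 + 1.28 * ∑ m ∈ T, (G.dg (A ∪ B) m : ℝ) ≤ 1.83 * (#P * #Q)) :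
    2 * lam + #(G.pend (A ∪ B)) + #T + 1 / Fintype.card V ≤ Fintype.card V := by
  have hn := h.card_pos
  have hl := h.lam_ge
  have hc := h.card_outer
  obtain ⟨hXA, hXB⟩ := h.sum_ge_of_card_le hν
  have hcard : (#(G.multi (A ∪ B)) + #(G.pend (A ∪ B)) : ℝ) = #(A ∪ B)ᶜ := by
    exact_mod_cast card_multi_add_card_pend (G := G) _
  have h1 := h.mul_sum_left_le_of_missing hP hQ hPQ
  have h2 := h.symm.mul_sum_left_le_of_missing hQ hP fun b hb a ha hba => hPQ a ha b hb hba.symm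
  rw [union_comm B A] at h2
  have h3 := h.le_sum_right hQ
  have h4 := h.symm.le_sum_right hP
  have h5 : (#P : ℝ) * (#Q * ((∑ v ∈ A, x v - 0.2477 * Fintype.card V) / lam))
    ≤ #P * ∑ w ∈ Q, x w := by gcongr
  have h6 : (#Q : ℝ) * (#P * ((∑ v ∈ B, x v - 0.2477 * Fintype.card V) / lam))
    ≤ #Q * ∑ w ∈ P, x w := by gcongr
  have h7 := lam_le_of_missing (c := #P * #Q) (by linarith) (by linarith) h.lam_le hXA hXB
    (by positivity) ((by linarith : _ ≤ _).trans h1) ((by linarith : _ ≤ _).trans h2)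
  rw [← sum_cost_eq, ← sum_multi_add_sum_pend (G := G), ← sum_sdiff hT] at h7
  have h8 := h.sum_cost_multi_le ((sdiff_subset (t := T)).trans (multi_subset (G := G)))
  have h9 := h.sum_cost_pend_le (by linarith) hXA hXB
  have h10 := (h.sum_pend_le_of_card_le hν hμ).2
  have h11 : ∑ w ∈ T, (G.dg A w / (∑ v ∈ B, x v) + G.dg B w / (∑ v ∈ A, x v)) * x w
      ≤ 1.28 * (∑ m ∈ T, (G.dg (A ∪ B) m : ℝ)) / Fintype.card V := by
    rw [mul_sum, sum_div]
    refine sum_le_sum fun w hw => (h.cost_le_dg (by linarith) hXA hXB w).trans ?_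
    have e1 := h.mul_le_of_mem_multi hν hμ w
    have e2 := h.dg_union_le ((mem_multi (G := G)).1 (hT hw)).1
    have e3 : x w ≤ 0.5866 := by
      by_contra! hcon
      have : lam * 0.5866 ≤ lam * x w := by gcongr; linarith
      linarith
    have e4 : (G.dg (A ∪ B) w : ℝ) * x w ≤ G.dg (A ∪ B) w * 0.5866 := by gcongr
    rw [div_le_div_iff₀ (by linarith) (by linarith)]
    have e5 : (G.dg (A ∪ B) w : ℝ) * x w * Fintype.card V ≤
      G.dg (A ∪ B) w * 0.5866 * Fintype.card V := by gcongr
    have e6 : 0 ≤ (G.dg (A ∪ B) w : ℝ) * Fintype.card V := by positivity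
    linarith
  have h12 : (∑ w ∈ G.pend (A ∪ B), x w) / (0.459 * (Fintype.card V : ℝ))
      ≤ 0.05 / Fintype.card V := by
    rw [div_le_div_iff₀ (by linarith) (by linarith)]
    nlinarith
  have h13 : (1.1 + 1.28 * ∑ m ∈ T, (G.dg (A ∪ B) m : ℝ)) / Fintype.card V
      ≤ 1.83 * (#P * #Q) / Fintype.card V := by gcongr
  have h14 : (#(G.multi (A ∪ B) \ T) + #T : ℝ) = #(G.multi (A ∪ B)) := by
    exact_mod_cast card_sdiff_add_card_eq_card hT
  have h15 : (0 : ℝ) ≤ #(G.multi (A ∪ B) \ T) := Nat.cast_nonneg _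
  rw [add_div] at h13
  have h16 : 1 / (Fintype.card V : ℝ) + 0.05 / Fintype.card V ≤ 1.1 / Fintype.card V := by
    rw [← add_div]; gcongr; norm_num
  linarith

end Missing

section Ears

open Finset

variable {V : Type*} [Fintype V] [DecidableEq V] {G : SimpleGraph V} [DecidableRel G.Adj]
  {k r : ℕ} {A B : Finset V} {x : V → ℝ} {lam : ℝ}

theorem SpectralCore.pend_add_le (h : G.SpectralCore k A B x lam)
    (hq : Fintype.card V - r + 1 - 0.9 / Fintype.card V ≤ 2 * lam) :
    #(G.pend (A ∪ B)) + 0.59 * #(G.multi (A ∪ B)) ≤ (r : ℝ) - 0.99 := by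
  have hn := h.card_pos
  have h1 := h.two_mul_lam_add_le
  have h2 : 0.9 / (Fintype.card V : ℝ) ≤ 0.001 := by
    rw [div_le_iff₀ (by linarith)]; linarith
  linarith

theorem SpectralCore.pend_add_le_of_le (h : G.SpectralCore k A B x lam)
    (hq : Fintype.card V - r + 1 - 0.9 / Fintype.card V ≤ 2 * lam) {e : ℕ} (he : e ≤ 2)
    (heμ : e ≤ #(G.multi (A ∪ B))) : #(G.pend (A ∪ B)) + e + 1 ≤ r := by
  have h1 := h.pend_add_le hq
  by_contra! hcon
  have h2 : (r : ℝ) ≤ #(G.pend (A ∪ B)) + e := by exact_mod_cast Nat.lt_succ_iff.1 hcon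
  have h3 : (e : ℝ) ≤ #(G.multi (A ∪ B)) := by exact_mod_cast heμ
  interval_cases e <;> push_cast at h2 h3 <;> linarith

theorem SpectralCore.false_of_opp (h : G.SpectralCore k A B x lam) (hr : r ≤ 2 * k)
    (hq : Fintype.card V - r + 1 - 0.9 / Fintype.card V ≤ 2 * lam)
    {T P Q : Finset V} {l : List V} (hT : T ⊆ G.multi (A ∪ B)) (hT2 : #T ≤ 2)
    (hP : P ⊆ A) (hQ : Q ⊆ B) (hP0 : P.Nonempty) (hQ0 : Q.Nonempty)
    (hcount : 1.1 + 1.28 * ∑ m ∈ T, (G.dg (A ∪ B) m : ℝ) ≤ 1.83 * (#P * #Q))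
    (hp : ∀ a ∈ P, ∀ b ∈ Q, G.LPath a l b) (hnd : l.Nodup) (hl : ∀ x ∈ l, x ∉ A ∪ B)
    (hodd : Odd l.length) (hlen : l.length ≤ #(G.pend (A ∪ B)) + #T) : False := by
  have h1 := h.pend_add_le_of_le hq hT2 (card_le_card hT)
  obtain ⟨a, ha⟩ := hP0
  obtain ⟨b, hb⟩ := hQ0
  by_cases h2 : l.length + 3 ≤ 2 * k
  · exact h.isCore.false_of_opp h.free (by have := h.two_le; omega) (hP ha) (hQ hb) hl hnd
      (hp a ha b hb) hodd h2
  have h3 : l.length + 1 = 2 * k := by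
    obtain ⟨m, hm⟩ := hodd
    omega
  have hPQ : ∀ a ∈ P, ∀ b ∈ Q, ¬ G.Adj a b := fun a ha b hb hab =>
    h.free.false_of_adj (mem_union_left B (hP ha)) (mem_union_right A (hQ hb)) hab.symm hl hnd
      (hp a ha b hb) h3
  have h4 : #(G.pend (A ∪ B)) + #T + 1 = r := by omega
  have h5 : (#(G.pend (A ∪ B)) + #T + 1 : ℝ) = r := by exact_mod_cast h4
  have h6 := h.pend_add_le hq
  have h7 : 0.59 * (#(G.multi (A ∪ B)) : ℝ) ≤ #T + 0.01 := by linarith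
  have h8 : #(G.multi (A ∪ B)) ≤ #T + 1 ∧ #(G.multi (A ∪ B)) ≤ 3 := by
    by_contra! hcon
    have h9 : #T + 2 ≤ #(G.multi (A ∪ B)) := by omega
    have h10 : (#T + 2 : ℝ) ≤ #(G.multi (A ∪ B)) := by exact_mod_cast h9
    have h11 : (#T : ℝ) ≤ 2 := by exact_mod_cast hT2
    linarith
  have hν := card_multi_add_card_pend (G := G) (A ∪ B)
  have h12 := h.two_mul_lam_le_of_missing (by omega) h8.2 hT hP hQ hPQ hcount
  have hn := h.card_pos
  have h13 : 0.9 / (Fintype.card V : ℝ) < 1 / Fintype.card V := by gcongr; norm_num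
  linarith

variable (G A B) in
/-- The colouring of a dense pair and of the outer vertices attached to it: colour `1` is given to
`B` and to the vertices with a neighbour in `A`. -/
def coreCol (v : V) : ZMod 2 := if v ∈ B ∨ (v ∉ A ∧ G.dg A v ≠ 0) then 1 else 0

/-- The vertices of the dense pair which stand for a vertex `s` attached to the pair, together with
the list of vertices which leads to them. -/
structure IsAnchor (G : SimpleGraph V) [DecidableRel G.Adj] (A B : Finset V) (s : V)
    (Γ : Finset V) (t : List V) : Prop where
  eq_or : t = [] ∧ Γ = {s} ∨ t = [s] ∧ s ∈ G.multi (A ∪ B) ∧ #Γ = G.dg (A ∪ B) s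
  path : ∀ a ∈ Γ, ∀ l c, G.LPath s l c → G.LPath a (t ++ l) c
  side : Γ ⊆ A ∧ G.coreCol A B s + t.length = 0 ∨ Γ ⊆ B ∧ G.coreCol A B s + t.length = 1

theorem IsAnchor.nonempty {s : V} {Γ : Finset V} {t : List V} (h : G.IsAnchor A B s Γ t) :
    Γ.Nonempty := by
  rcases h.eq_or with ⟨_, rfl⟩ | ⟨_, h1, h2⟩
  · simp
  · rw [← card_pos, h2]
    have := (mem_multi.1 h1).2
    omega

theorem SpectralCore.exists_isAnchor (h : G.SpectralCore k A B x lam) {s : V}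
    (hs : s ∈ (A ∪ B) ∪ G.multi (A ∪ B)) : ∃ Γ t, G.IsAnchor A B s Γ t := by
  rw [mem_union] at hs
  rcases hs with hs | hs
  · refine ⟨{s}, [], Or.inl ⟨rfl, rfl⟩, ?_, ?_⟩
    · rintro a ha l c hl
      rw [mem_singleton] at ha
      simpa [ha] using hl
    · rw [mem_union] at hs
      by_cases hB : s ∈ B
      · right; simp [coreCol, hB]
      · left; have hA : s ∈ A := by tauto
        simp [coreCol, hA, hB]
  · have hs' := mem_multi.1 hs
    refine ⟨{v ∈ A ∪ B | G.Adj s v}, [s], Or.inr ⟨rfl, hs, rfl⟩, ?_, ?_⟩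
    · rintro a ha l c hl
      exact lPath_cons.2 ⟨(mem_filter.1 ha).2.symm, hl⟩
    · have hsC := hs'.1
      rw [mem_union, not_or] at hsC
      rcases h.dg_eq_zero_or hs'.1 with h0 | h0
      · right
        refine ⟨fun v hv => ?_, by simp [coreCol, hsC.2, h0]⟩
        rw [mem_filter, mem_union] at hv
        have := dg_eq_zero_iff.1 h0 v
        tauto
      · left
        have hA : G.dg A s ≠ 0 := by
          have := hs'.2
          rw [h.dg_union_eq] at this
          omega
        refine ⟨fun v hv => ?_, ?_⟩
        · rw [mem_filter, mem_union] at hv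
          have := dg_eq_zero_iff.1 h0 v
          tauto
        · simp [coreCol, hsC.1, hA]; decide

theorem IsAnchor.exists_ne {s s' : V} {Γ Γ' : Finset V} {t t' : List V}
    (h : G.IsAnchor A B s Γ t) (h' : G.IsAnchor A B s' Γ' t') (hne : s ≠ s') :
    ∃ a ∈ Γ, ∃ a' ∈ Γ', a ≠ a' := by
  by_contra! hcon
  obtain ⟨a, ha⟩ := h.nonempty
  obtain ⟨a', ha'⟩ := h'.nonempty
  have e1 : Γ = {a} := by
    ext v; rw [mem_singleton]
    exact ⟨fun hv => (hcon v hv a' ha').trans (hcon a ha a' ha').symm, fun e => e ▸ ha⟩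
  have e2 : Γ' = {a} := by
    ext v; rw [mem_singleton]
    exact ⟨fun hv => (hcon a ha v hv).symm, fun e => e ▸ hcon a ha a' ha' ▸ ha'⟩
  have key : ∀ {s : V} {Γ : Finset V} {t : List V}, G.IsAnchor A B s Γ t → Γ = {a} → s = a := by
    rintro s Γ t h rfl
    rcases h.eq_or with ⟨_, h1⟩ | ⟨_, h1, h2⟩
    · exact (singleton_injective h1).symm
    · have := (mem_multi.1 h1).2
      rw [card_singleton] at h2
      omega
  exact hne ((key h e1).trans (key h' e2).symm)

theorem IsAnchor.count {s s' : V} {Γ Γ' : Finset V} {t t' : List V}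
    (h : G.IsAnchor A B s Γ t) (h' : G.IsAnchor A B s' Γ' t') (hne : s ≠ s') :
    (t ++ t').toFinset ⊆ G.multi (A ∪ B) ∧ #(t ++ t').toFinset = t.length + t'.length ∧
    t.length + t'.length ≤ 2 ∧
    1.1 + 1.28 * ∑ m ∈ (t ++ t').toFinset, (G.dg (A ∪ B) m : ℝ) ≤ 1.83 * (#Γ * #Γ') := by
  have key : ∀ {s : V}, s ∈ G.multi (A ∪ B) → (2 : ℝ) ≤ G.dg (A ∪ B) s := fun h => by
    exact_mod_cast (mem_multi.1 h).2
  rcases h.eq_or with ⟨rfl, rfl⟩ | ⟨rfl, h1, h2⟩ <;>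
  rcases h'.eq_or with ⟨rfl, rfl⟩ | ⟨rfl, h1', h2'⟩
  · simp; norm_num
  · have := key h1'
    simp [h1', h2']; linarith
  · have := key h1
    simp [h1, h2]; linarith
  · have e1 := key h1
    have e2 := key h1'
    have e3 := mul_nonneg (sub_nonneg.2 e1) (sub_nonneg.2 e2)
    simp [h1, h2, h1', h2', hne, insert_subset_iff]
    linarith

theorem SpectralCore.earCompatible (h : G.SpectralCore k A B x lam) (hr : r ≤ 2 * k)
    (hq : Fintype.card V - r + 1 - 0.9 / Fintype.card V ≤ 2 * lam) :
    G.EarCompatible ((A ∪ B) ∪ G.multi (A ∪ B)) (G.coreCol A B) := by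
  intro s hs s' hs' hne l hnd hl hp
  obtain ⟨Γ, t, ht⟩ := h.exists_isAnchor hs
  obtain ⟨Γ', t', ht'⟩ := h.exists_isAnchor hs'
  obtain ⟨hT, hTc, hT2, hcount⟩ := ht.count ht' hne
  have htrev : t'.reverse = t' := by rcases ht'.eq_or with ⟨rfl, _⟩ | ⟨rfl, _⟩ <;> rfl
  have hpath : ∀ a ∈ Γ, ∀ a' ∈ Γ', G.LPath a (t ++ (l ++ t')) a' := fun a ha a' ha' =>
    ht.path a ha _ _ (by simpa [htrev] using (ht'.path a' ha' _ _ hp.reverse).reverse)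
  have hmem : ∀ y, y ∈ t ++ t' → y ∈ G.multi (A ∪ B) := fun y hy => hT (by simpa using hy)
  have hmemT : ∀ y, y ∈ t → y = s := by
    rcases ht.eq_or with ⟨rfl, _⟩ | ⟨rfl, _⟩ <;> simp
  have hmemT' : ∀ y, y ∈ t' → y = s' := by
    rcases ht'.eq_or with ⟨rfl, _⟩ | ⟨rfl, _⟩ <;> simp
  have hndt : t.Nodup := by rcases ht.eq_or with ⟨rfl, _⟩ | ⟨rfl, _⟩ <;> simp
  have hndt' : t'.Nodup := by rcases ht'.eq_or with ⟨rfl, _⟩ | ⟨rfl, _⟩ <;> simp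
  have hL : (t ++ (l ++ t')).Nodup := by
    rw [List.nodup_append, List.nodup_append]
    refine ⟨hndt, ⟨hnd, hndt', fun y hy z hz e => hl y hy ?_⟩, fun y hy z hz e => ?_⟩
    · rw [e, hmemT' z hz]; exact hs'
    · rw [List.mem_append] at hz
      have e1 := hmemT y hy
      rcases hz with hz | hz
      · exact hl z hz (by rw [← e, e1]; exact hs)
      · exact hne (by rw [← e1, ← hmemT' z hz, e])
  have hLC : ∀ y ∈ t ++ (l ++ t'), y ∉ A ∪ B := by
    intro y hy
    simp only [List.mem_append] at hy
    by_cases hyl : y ∈ l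
    · exact fun hC => hl y hyl (mem_union_left _ hC)
    · exact (mem_multi.1 (hmem y (List.mem_append.2 (by tauto)))).1
  have hlδ : l.length ≤ #(G.pend (A ∪ B)) := by
    rw [← List.toFinset_card_of_nodup hnd]
    refine card_le_card fun y hy => ?_
    rw [List.mem_toFinset] at hy
    have := hl y hy
    rw [mem_union, mem_multi, not_or] at this
    exact mem_pend.2 ⟨this.1, by by_contra! h5; exact this.2 ⟨this.1, h5⟩⟩
  have hlen : (t ++ (l ++ t')).length ≤ #(G.pend (A ∪ B)) + #(t ++ t').toFinset := by
    simp only [List.length_append] at hTc ⊢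
    omega
  have hsmall := h.pend_add_le_of_le hq hT2 (hTc ▸ card_le_card hT)
  by_contra hcon
  have h2k := h.two_le
  have same : ∀ {i : ZMod 2}, G.coreCol A B s + t.length = i → G.coreCol A B s' + t'.length = i →
      Even (t ++ (l ++ t')).length := fun {i} e1 e2 => by
    rw [← ZMod.natCast_eq_zero_iff_even]
    simp only [List.length_append]
    push_cast
    revert hcon e1 e2
    generalize G.coreCol A B s = c1
    generalize G.coreCol A B s' = c2
    generalize (t.length : ZMod 2) = c3
    generalize (t'.length : ZMod 2) = c4
    generalize (l.length : ZMod 2) = c5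
    revert c1 c2 c3 c4 c5 i
    decide
  have opp : ∀ {i : ZMod 2}, G.coreCol A B s + t.length = i →
      G.coreCol A B s' + t'.length = i + 1 → Odd (t ++ (l ++ t')).length := fun {i} e1 e2 => by
    rw [← ZMod.natCast_eq_one_iff_odd]
    simp only [List.length_append]
    push_cast
    revert hcon e1 e2
    generalize G.coreCol A B s = c1
    generalize G.coreCol A B s' = c2
    generalize (t.length : ZMod 2) = c3
    generalize (t'.length : ZMod 2) = c4
    generalize (l.length : ZMod 2) = c5
    revert c1 c2 c3 c4 c5 i
    decide
  have hsame2 : Even (t ++ (l ++ t')).length → (t ++ (l ++ t')).length + 2 ≤ 2 * k := by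
    rintro ⟨m, hm⟩
    omega
  rcases ht.side with ⟨hΓ, e1⟩ | ⟨hΓ, e1⟩ <;> rcases ht'.side with ⟨hΓ', e2⟩ | ⟨hΓ', e2⟩
  · obtain ⟨a, ha, a', ha', hne'⟩ := ht.exists_ne ht' hne
    have hev := same e1 e2
    exact h.isCore.false_of_same h.free (by omega) (hΓ ha) (hΓ' ha') hne' hLC hL
      (hpath a ha a' ha') hev (hsame2 hev)
  · exact h.false_of_opp hr hq hT (by omega) hΓ hΓ' ht.nonempty ht'.nonempty hcount hpath hL hLC
      (opp e1 e2) hlen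
  · have hodd := opp e1 (e2.trans (by decide))
    refine h.false_of_opp (l := (t ++ (l ++ t')).reverse) hr hq hT (by omega) hΓ' hΓ ht'.nonempty
      ht.nonempty (by linarith) (fun a ha b hb => (hpath b hb a ha).reverse)
      (List.nodup_reverse.2 hL) (fun y hy => hLC y (List.mem_reverse.1 hy)) ?_ ?_
    · rwa [List.length_reverse]
    · rwa [List.length_reverse]
  · obtain ⟨a, ha, a', ha', hne'⟩ := ht.exists_ne ht' hne
    have hev := same e1 e2
    exact h.isCore.symm.false_of_same h.free (by omega) (hΓ ha) (hΓ' ha') hne'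
      (by rwa [union_comm]) hL (hpath a ha a' ha') hev (hsame2 hev)

end Ears

section Extremal

open Finset

theorem eq_or_mul_add_one_le (a b : ℕ) :
    (a = (a + b) / 2 ∧ b = a + b - (a + b) / 2) ∨ (b = (a + b) / 2 ∧ a = a + b - (a + b) / 2) ∨
      a * b + 1 ≤ (a + b - (a + b) / 2) * ((a + b) / 2) := by
  have key : ∀ p q i : ℕ, p ≤ q → (q + (i + 1)) * (p - (i + 1)) + 1 ≤ q * p ∨ p < i + 1 := by
    intro p q i hpq
    by_cases h : p < i + 1
    · exact Or.inr h
    · obtain ⟨d, rfl⟩ := Nat.exists_eq_add_of_le (not_lt.1 h)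
      left
      rw [Nat.add_sub_cancel_left]
      nlinarith
  by_cases h1 : a + b - (a + b) / 2 < a
  · right; right
    obtain ⟨i, hi⟩ := Nat.exists_eq_add_of_lt h1
    have := key ((a + b) / 2) (a + b - (a + b) / 2) i (by omega)
    rcases this with h | h
    · have e1 : a + b - (a + b) / 2 + (i + 1) = a := by omega
      have e2 : (a + b) / 2 - (i + 1) = b := by omega
      rwa [e1, e2] at h
    · omega
  · by_cases h2 : a + b - (a + b) / 2 < b
    · right; right
      obtain ⟨i, hi⟩ := Nat.exists_eq_add_of_lt h2
      have := key ((a + b) / 2) (a + b - (a + b) / 2) i (by omega)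
      rcases this with h | h
      · have e1 : a + b - (a + b) / 2 + (i + 1) = b := by omega
        have e2 : (a + b) / 2 - (i + 1) = a := by omega
        rw [e1, e2] at h
        rwa [mul_comm a b]
      · omega
    · omega

/-- If pendant weights are not concentrated on one vertex, the product bound is violated. -/
theorem false_of_spread {a b q w : ℕ} {κ lam u v : ℝ} (hab : a + b = q) (hκ : 0 < κ)
    (hκw : κ * w ≤ 0.02) (hw : 1 ≤ w) (hwq : w < q - q / 2) (hlam : 1 ≤ lam)
    (hq : q ≤ 2.1 * lam) (hu : 0 ≤ u) (hv : 0 ≤ v) (huv : u + v ≤ w)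
    (hlow : ((q - q / 2 : ℕ) : ℝ) * ((q / 2 : ℕ) - 1 + lam / (lam - κ * w)) ≤ lam ^ 2)
    (hupp : lam ^ 2 ≤ (a + κ / (lam - κ * (w - 1)) * u) * (b + κ / (lam - κ * (w - 1)) * v)) :
    False := by
  have hw' : (1 : ℝ) ≤ w := by exact_mod_cast hw
  have hwq' : (w : ℝ) < (q - q / 2 : ℕ) := by exact_mod_cast hwq
  have hp : 0 < lam - κ * w := by linarith
  have hp1 : 0 < lam - κ * (w - 1) := by nlinarith
  obtain ⟨η, hη⟩ : ∃ η, η = κ / (lam - κ * (w - 1)) := ⟨_, rfl⟩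
  obtain ⟨η₀, hη₀⟩ : ∃ η, η = κ / (lam - κ * w) := ⟨_, rfl⟩
  have hη0 : 0 < η := by rw [hη]; positivity
  rw [← hη] at hupp
  have e1 : lam / (lam - κ * w) = 1 + w * η₀ := by
    rw [hη₀]; field_simp; ring
  have e2 : η₀ - η = η₀ * η := by
    rw [hη₀, hη]; field_simp; ring
  have e3 : η ≤ η₀ := by
    rw [hη₀, hη]
    gcongr
    linarith
  have e4 : η * w * q ≤ 0.5 := by
    have : η * w ≤ 0.2 / lam := by
      rw [hη, div_mul_eq_mul_div, div_le_div_iff₀ hp1 (by linarith)]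
      nlinarith
    calc η * w * q ≤ 0.2 / lam * (2.1 * lam) := by gcongr
      _ = 0.42 := by field_simp; norm_num
      _ ≤ 0.5 := by norm_num
  rw [e1] at hlow
  have h1 : ((q - q / 2 : ℕ) : ℝ) * (q / 2 : ℕ) + (q - q / 2 : ℕ) * (w * η₀)
      ≤ a * b + η * (u * b + v * a) + η ^ 2 * (u * v) := by
    linarith
  have huvw : u * v ≤ w * w := by nlinarith
  have h2 : η ^ 2 * (u * v) ≤ η ^ 2 * (w * w) := by gcongr
  have hA0 : (0 : ℝ) ≤ a := Nat.cast_nonneg _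
  have hB0 : (0 : ℝ) ≤ b := Nat.cast_nonneg _
  have tri := eq_or_mul_add_one_le a b
  rw [hab] at tri
  have hβq : ((q - q / 2 : ℕ) : ℝ) ≤ q := by exact_mod_cast Nat.sub_le _ _
  have hαβ : q / 2 ≤ q - q / 2 := by omega
  have habR : (a : ℝ) + b = q := by exact_mod_cast hab
  clear hlow hupp hab hwq
  generalize q - q / 2 = β at *
  generalize q / 2 = α at *
  have balanced : a ≤ β → b ≤ β → a * b = β * α → False := by
    intro ha hb he
    have he' : (a * b : ℝ) = β * α := by exact_mod_cast he
    have ha' : (a : ℝ) ≤ β := by exact_mod_cast ha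
    have hb' : (b : ℝ) ≤ β := by exact_mod_cast hb
    have hβ0 : (0 : ℝ) ≤ β := Nat.cast_nonneg _
    have h3 : u * b + v * a ≤ w * β := by
      have := mul_le_mul_of_nonneg_left hb' hu
      have := mul_le_mul_of_nonneg_left ha' hv
      have := mul_le_mul_of_nonneg_right huv hβ0
      linarith
    have h4 : η * (u * b + v * a) ≤ η * (w * β) := by gcongr
    have h5 : η * η ≤ η₀ * η := by gcongr
    have h6 : β * w * (η * η) ≤ β * w * (η₀ - η) := by rw [e2]; gcongr
    have h7 : 0 < (β - w) * (w * (η * η)) := mul_pos (by linarith) (by positivity)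
    nlinarith
  rcases tri with h | h | h
  · exact balanced (h.1.trans_le hαβ) h.2.le (by rw [h.1, h.2, mul_comm])
  · exact balanced h.2.le (h.1.trans_le hαβ) (by rw [h.1, h.2])
  · have h' : (a * b + 1 : ℝ) ≤ β * α := by exact_mod_cast h
    have h3 : u * b + v * a ≤ w * q := by
      have := mul_le_mul_of_nonneg_left (show (b : ℝ) ≤ q by linarith) hu
      have := mul_le_mul_of_nonneg_left (show (a : ℝ) ≤ q by linarith) hv
      have := mul_le_mul_of_nonneg_right huv (show (0 : ℝ) ≤ q by linarith)
      linarith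
    have h4 : η * (u * b + v * a) ≤ η * (w * q) := by gcongr
    have hw1 : 0 ≤ η * w := by positivity
    have h6 : η ^ 2 * (w * w) ≤ 0.5 * 0.5 := by
      have : η * w ≤ 0.5 := by
        refine le_trans ?_ e4
        exact le_mul_of_one_le_right hw1 (by linarith)
      calc η ^ 2 * (w * w) = (η * w) * (η * w) := by ring
        _ ≤ 0.5 * 0.5 := by gcongr
    have h7 : 0 ≤ (β : ℝ) * (w * η₀) :=
      mul_nonneg (Nat.cast_nonneg _) (mul_nonneg (Nat.cast_nonneg _) (hη0.le.trans e3))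
    linarith

theorem eq_half_of_mul_le {a b q : ℕ} {H : ℝ} (hab : a + b = q) (hH0 : 0 < H) (hH1 : H < 1)
    (h : ((q - q / 2 : ℕ) : ℝ) * ((q / 2 : ℕ) + H) ≤ (a + H) * b) :
    a = q / 2 ∧ b = q - q / 2 := by
  have tri := eq_or_mul_add_one_le a b
  rw [hab] at tri
  have hαβ : q / 2 + (q - q / 2) = a + b := by omega
  have hle : q / 2 ≤ q - q / 2 := by omega
  generalize q - q / 2 = β at *
  generalize q / 2 = α at *
  have hαβ' : (α : ℝ) + β = a + b := by exact_mod_cast hαβ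
  rcases tri with h1 | h1 | h1
  · exact h1
  · by_cases e : a = b
    · omega
    · have : b + 1 ≤ a := by omega
      have : (b + 1 : ℝ) ≤ a := by exact_mod_cast this
      rw [← h1.1, ← h1.2] at h
      nlinarith
  · exfalso
    have h1' : (a * b + 1 : ℝ) ≤ β * α := by exact_mod_cast h1
    by_cases hb : b ≤ β
    · have hb' : (b : ℝ) ≤ β := by exact_mod_cast hb
      nlinarith
    · obtain ⟨d, hd⟩ : ∃ d : ℝ, d = b - β := ⟨_, rfl⟩
      have hd1 : 1 ≤ d := by
        have : (β + 1 : ℝ) ≤ b := by exact_mod_cast not_le.1 hb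
        linarith
      have hle' : (α : ℝ) ≤ β := by exact_mod_cast hle
      have ha : (a : ℝ) = α - d := by linarith
      have hb' : (b : ℝ) = β + d := by linarith
      rw [ha, hb'] at h
      nlinarith [mul_nonneg (sub_nonneg.2 hd1) (sub_nonneg.2 hle'),
        mul_pos hH0 (by linarith : 0 < d)]

end Extremal

section Extremal

open Finset

variable {V : Type*} [Fintype V] [DecidableEq V] {G : SimpleGraph V} [DecidableRel G.Adj]
  {k : ℕ} {A B : Finset V} {x : V → ℝ} {lam : ℝ}

theorem _root_.Finset.eq_of_card_mul_le_sum {ι : Type*} {S : Finset ι} {g : ι → ℝ} {c : ℝ}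
    (hle : ∀ i ∈ S, g i ≤ c) (hsum : #S * c ≤ ∑ i ∈ S, g i) : ∀ i ∈ S, g i = c := by
  refine (sum_eq_sum_iff_of_le hle).1 (le_antisymm (sum_le_sum hle) ?_)
  rwa [sum_const, nsmul_eq_mul]

/-- Every vertex outside `C` is anchored at a vertex of `C`, its only possible neighbour in `C`,
and adjacent outside vertices have the same anchor. -/
def IsAnchored (G : SimpleGraph V) (C : Finset V) (f : V → V) : Prop :=
  ∀ c ∉ C, f c ∈ C ∧ (∀ y ∈ C, G.Adj c y → y = f c) ∧ ∀ c' ∉ C, G.Adj c c' → f c = f c'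

theorem IsAnchored.le_mul {C : Finset V} {f : V → V} (hf : G.IsAnchored C f) {κ : ℝ}
    (h0 : ∀ v, 0 ≤ x v) (heig : ∀ v, lam * x v = ∑ w with G.Adj v w, x w) (hκ0 : 0 < κ)
    (hκ : κ * (lam - #Cᶜ + 1) = 1) {c : V} (hc : c ∉ C) : x c ≤ κ * x (f c) := by
  obtain ⟨c₀, hc₀, hmax⟩ := exists_max_image {c' ∈ Cᶜ | f c' = f c} x ⟨c, by simp [hc]⟩
  refine (hmax c (by simp [hc])).trans ?_
  have hc₀' := hc₀
  rw [mem_filter, mem_compl] at hc₀'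
  have h1 : lam * x c₀ ≤ x (f c) + ∑ w ∈ ({c' ∈ Cᶜ | f c' = f c} : Finset V).erase c₀, x w := by
    rw [heig, ← sum_insert (by simp [(hf c hc).1])]
    refine sum_le_sum_of_subset_of_nonneg (fun w hw => ?_) fun w _ _ => h0 w
    rw [mem_filter] at hw
    rw [mem_insert, mem_erase, mem_filter, mem_compl, ← hc₀'.2]
    by_cases hwC : w ∈ C
    · exact Or.inl ((hf c₀ hc₀'.1).2.1 w hwC hw.2)
    · exact Or.inr ⟨hw.2.ne', hwC, ((hf c₀ hc₀'.1).2.2 w hwC hw.2).symm⟩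
  have h2 : ∑ w ∈ ({c' ∈ Cᶜ | f c' = f c} : Finset V).erase c₀, x w ≤ (#Cᶜ - 1) * x c₀ := by
    refine (sum_le_card_nsmul _ _ (x c₀) fun w hw => hmax w (mem_of_mem_erase hw)).trans ?_
    rw [nsmul_eq_mul]
    refine mul_le_mul_of_nonneg_right ?_ (h0 c₀)
    have : #(({c' ∈ Cᶜ | f c' = f c} : Finset V).erase c₀) + 1 ≤ #Cᶜ := by
      rw [card_erase_add_one hc₀]
      exact card_filter_le _ _
    have : (#(({c' ∈ Cᶜ | f c' = f c} : Finset V).erase c₀) + 1 : ℝ) ≤ #Cᶜ := by exact_mod_cast this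
    linarith
  calc x c₀ = κ * ((lam - #Cᶜ + 1) * x c₀) := by rw [← mul_assoc, hκ, one_mul]
    _ ≤ κ * x (f c) := by
      refine mul_le_mul_of_nonneg_left ?_ hκ0.le
      linarith

theorem IsAnchored.sum_dg_le {C : Finset V} {f : V → V} (hf : G.IsAnchored C f) :
    ∑ s ∈ C, G.dg Cᶜ s ≤ #Cᶜ := by
  rw [sum_dg_comm]
  refine (sum_le_card_nsmul _ _ 1 fun c hc => ?_).trans (by simp)
  rw [dg, card_le_one]
  intro y hy z hz
  rw [mem_filter] at hy hz
  rw [mem_compl] at hc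
  rw [(hf c hc).2.1 y hy.1 hy.2, (hf c hc).2.1 z hz.1 hz.2]

theorem IsAnchored.sum_outer_le {C : Finset V} {f : V → V} (hf : G.IsAnchored C f) {κ : ℝ}
    (h0 : ∀ v, 0 ≤ x v) (heig : ∀ v, lam * x v = ∑ w with G.Adj v w, x w) (hκ0 : 0 < κ)
    (hκ : κ * (lam - #Cᶜ + 1) = 1) {s : V} (hs : s ∈ C) :
    ∑ w ∈ Cᶜ with G.Adj s w, x w ≤ κ * G.dg Cᶜ s * x s := by
  refine (sum_le_card_nsmul _ _ (κ * x s) fun w hw => ?_).trans (le_of_eq ?_)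
  · rw [mem_filter, mem_compl] at hw
    rw [(hf w hw.1).2.1 s hs hw.2.symm]
    exact hf.le_mul h0 heig hκ0 hκ hw.1
  · rw [nsmul_eq_mul, dg]; ring

theorem SpectralCore.mul_eq_left (h : G.SpectralCore k A B x lam) {a : V} (ha : a ∈ A) :
    lam * x a = ∑ w ∈ B with G.Adj a w, x w + ∑ w ∈ (A ∪ B)ᶜ with G.Adj a w, x w := by
  rw [h.eig, ← sum_union (disjoint_filter_filter
    (disjoint_compl_right.mono_left subset_union_right))]
  refine sum_congr ?_ fun _ _ => rfl
  ext w
  have := h.not_adj_left (a' := w) ha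
  simp only [mem_filter, mem_univ, true_and, mem_union, mem_compl]
  tauto

theorem sum_filter_le_sum {S : Finset V} (h0 : ∀ v, 0 ≤ x v) (p : V → Prop) [DecidablePred p] :
    ∑ w ∈ S with p w, x w ≤ ∑ w ∈ S, x w :=
  sum_le_sum_of_subset_of_nonneg (filter_subset _ _) fun w _ _ => h0 w

theorem SpectralCore.mul_le_left (h : G.SpectralCore k A B x lam) {f : V → V} {κ : ℝ}
    (hf : G.IsAnchored (A ∪ B) f) (hκ0 : 0 < κ) (hκ : κ * (lam - #(A ∪ B)ᶜ + 1) = 1) {a : V}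
    (ha : a ∈ A) : lam * x a ≤ ∑ w ∈ B, x w + κ * G.dg (A ∪ B)ᶜ a * x a := by
  rw [h.mul_eq_left ha]
  exact add_le_add (sum_filter_le_sum h.nonneg _)
    (hf.sum_outer_le h.nonneg h.eig hκ0 hκ (mem_union_left _ ha))

theorem SpectralCore.mul_sum_left_le_of_dg_lt (h : G.SpectralCore k A B x lam) {f : V → V} {κ : ℝ}
    (hf : G.IsAnchored (A ∪ B) f) (hκ0 : 0 < κ) (hκ : κ * (lam - #(A ∪ B)ᶜ + 1) = 1)
    (hκw : 0 < lam - κ * (#(A ∪ B)ᶜ - 1)) (hlt : ∀ a ∈ A, G.dg (A ∪ B)ᶜ a < #(A ∪ B)ᶜ) :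
    lam * ∑ a ∈ A, x a ≤ (#A + κ / (lam - κ * (#(A ∪ B)ᶜ - 1)) *
      (∑ a ∈ A, G.dg (A ∪ B)ᶜ a : ℕ)) * ∑ b ∈ B, x b := by
  have key : ∀ a ∈ A, lam * x a ≤
      (∑ b ∈ B, x b) * (1 + κ / (lam - κ * (#(A ∪ B)ᶜ - 1)) * G.dg (A ∪ B)ᶜ a) := by
    intro a ha
    have h1 := h.mul_le_left hf hκ0 hκ ha
    have h2 : (G.dg (A ∪ B)ᶜ a + 1 : ℝ) ≤ #(A ∪ B)ᶜ := by exact_mod_cast hlt a ha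
    have h3 : x a ≤ (∑ b ∈ B, x b) / (lam - κ * (#(A ∪ B)ᶜ - 1)) := by
      rw [le_div_iff₀ hκw]
      have : κ * (G.dg (A ∪ B)ᶜ a + 1) * x a ≤ κ * #(A ∪ B)ᶜ * x a := by
        have := h.nonneg a
        gcongr
      nlinarith
    have h4 : κ * G.dg (A ∪ B)ᶜ a * x a ≤
        κ * G.dg (A ∪ B)ᶜ a * ((∑ b ∈ B, x b) / (lam - κ * (#(A ∪ B)ᶜ - 1))) := by gcongr
    refine h1.trans ((add_le_add_right h4 _).trans (le_of_eq ?_))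
    ring
  rw [mul_sum]
  refine (sum_le_sum key).trans (le_of_eq ?_)
  rw [← mul_sum, sum_add_distrib, ← mul_sum]
  push_cast
  rw [sum_const, nsmul_eq_mul, mul_one, mul_comm]

end Extremal

section Extremal

open Finset

variable {V : Type*} [Fintype V] [DecidableEq V] {G : SimpleGraph V} [DecidableRel G.Adj]
  {k : ℕ} {A B : Finset V} {x : V → ℝ} {lam : ℝ}

theorem SpectralCore.card_outer_le_card (h : G.SpectralCore k A B x lam) :
    (#(A ∪ B)ᶜ : ℝ) ≤ 0.0071 * Fintype.card V := by
  have h1 : (#(A ∪ B)ᶜ : ℝ) ≤ 5 * k := by exact_mod_cast h.card_outer_le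
  have := h.le_card
  linarith

theorem SpectralCore.mul_card_outer_le (h : G.SpectralCore k A B x lam) {κ : ℝ}
    (hκ : κ * (lam - #(A ∪ B)ᶜ + 1) = 1) : 0 < κ ∧ κ * #(A ∪ B)ᶜ ≤ 0.02 := by
  have h1 := h.card_outer_le_card
  have h2 := h.lam_ge
  have h3 := h.card_pos
  have hpos : 0 < lam - #(A ∪ B)ᶜ + 1 := by linarith
  have hκ0 : 0 < κ := pos_of_mul_pos_left (by rw [hκ]; exact one_pos) hpos.le
  refine ⟨hκ0, ?_⟩
  have : κ * #(A ∪ B)ᶜ ≤ κ * (0.02 * (lam - #(A ∪ B)ᶜ + 1)) := by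
    refine mul_le_mul_of_nonneg_left ?_ hκ0.le
    linarith
  linarith

/-- In the extremal situation some core vertex is adjacent to all outer vertices. -/
theorem SpectralCore.exists_dg_eq (h : G.SpectralCore k A B x lam) {f : V → V} {κ : ℝ}
    (hf : G.IsAnchored (A ∪ B) f) (hκ : κ * (lam - #(A ∪ B)ᶜ + 1) = 1)
    (hne : ((A ∪ B)ᶜ).Nonempty)
    (hlow : (((#A + #B) - (#A + #B) / 2 : ℕ) : ℝ) * (((#A + #B) / 2 : ℕ) - 1 +
      lam / (lam - κ * #(A ∪ B)ᶜ)) ≤ lam ^ 2) :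
    ∃ s ∈ A ∪ B, G.dg (A ∪ B)ᶜ s = #(A ∪ B)ᶜ := by
  by_contra! hcon
  have hlt : ∀ s ∈ A ∪ B, G.dg (A ∪ B)ᶜ s < #(A ∪ B)ᶜ := fun s hs =>
    lt_of_le_of_ne (dg_le_card _ _) (hcon s hs)
  obtain ⟨hκ0, hκw⟩ := h.mul_card_outer_le hκ
  have h1 := h.card_outer_le_card
  have h2 := h.lam_ge
  have h3 := h.card_pos
  have h4 := h.card_add
  have h5 := h.card_outer
  obtain ⟨hXA, hXB⟩ := h.sum_ge'
  have hw : 1 ≤ #(A ∪ B)ᶜ := hne.card_pos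
  have hw' : (1 : ℝ) ≤ #(A ∪ B)ᶜ := by exact_mod_cast hw
  have hκw' : 0 < lam - κ * (#(A ∪ B)ᶜ - 1) := by
    rw [mul_sub]
    have : κ * 1 ≤ κ * #(A ∪ B)ᶜ := by gcongr
    linarith
  have hA := h.mul_sum_left_le_of_dg_lt hf hκ0 hκ hκw' fun a ha => hlt a (mem_union_left _ ha)
  have hB := h.symm.mul_sum_left_le_of_dg_lt (f := f) (κ := κ)
    (by rwa [union_comm]) hκ0 (by rwa [union_comm]) (by rwa [union_comm])
    fun b hb => by rw [union_comm]; exact hlt b (mem_union_right _ hb)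
  rw [union_comm B A] at hB
  have huv : (∑ a ∈ A, G.dg (A ∪ B)ᶜ a) + ∑ b ∈ B, G.dg (A ∪ B)ᶜ b ≤ #(A ∪ B)ᶜ := by
    rw [← sum_union h.disj]
    exact hf.sum_dg_le
  have hXA0 : 0 < ∑ a ∈ A, x a := by linarith
  have hXB0 : 0 < ∑ b ∈ B, x b := by linarith
  refine false_of_spread (a := #A) (b := #B) rfl hκ0 hκw hw ?_ (by linarith)
    (by push_cast; linarith) (Nat.cast_nonneg _) (Nat.cast_nonneg _) (by exact_mod_cast huv) hlow ?_
  · have : (2 * #(A ∪ B)ᶜ + 1 : ℝ) ≤ #A + #B := by linarith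
    have : 2 * #(A ∪ B)ᶜ + 1 ≤ #A + #B := by exact_mod_cast this
    omega
  · have hlam : 0 < lam := by linarith
    have := mul_le_mul hA hB (by positivity) ((by positivity : 0 ≤ lam * ∑ a ∈ A, x a).trans hA)
    refine le_of_mul_le_mul_right (a := (∑ a ∈ A, x a) * ∑ b ∈ B, x b) ?_ (by positivity)
    linarith

/-- If all outer vertices are attached to `s ∈ A` and the spectral bound is attained, then `G` is
a suspended balanced complete bipartite graph. -/
theorem SpectralCore.isTuranSusp_left (h : G.SpectralCore k A B x lam) {f : V → V} {κ : ℝ}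
    (hf : G.IsAnchored (A ∪ B) f) (hκ : κ * (lam - #(A ∪ B)ᶜ + 1) = 1)
    (hne : ((A ∪ B)ᶜ).Nonempty)
    (hlow : (((#A + #B) - (#A + #B) / 2 : ℕ) : ℝ) * (((#A + #B) / 2 : ℕ) - 1 +
      lam / (lam - κ * #(A ∪ B)ᶜ)) ≤ lam ^ 2)
    {s : V} (hs : s ∈ A) (hdg : G.dg (A ∪ B)ᶜ s = #(A ∪ B)ᶜ) :
    G.IsTuranSusp s A B (A ∪ B)ᶜ ∧ #A = (#A + #B) / 2 ∧ #B = #A + #B - (#A + #B) / 2 := by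
  obtain ⟨hκ0, hκw⟩ := h.mul_card_outer_le hκ
  have h1 := h.card_outer_le_card
  have h2 := h.lam_ge
  have h3 := h.card_pos
  obtain ⟨hXA, hXB⟩ := h.sum_ge'
  have hlam : 0 < lam := by linarith
  have hp : 0 < lam - κ * #(A ∪ B)ᶜ := by linarith
  have hXA0 : 0 < ∑ a ∈ A, x a := by linarith
  have hXB0 : 0 < ∑ b ∈ B, x b := by linarith
  have hw : (0 : ℝ) < #(A ∪ B)ᶜ := by exact_mod_cast hne.card_pos
  have hadj : ∀ c ∈ (A ∪ B)ᶜ, G.Adj s c := by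
    rwa [dg, card_filter_eq_iff] at hdg
  have hfs : ∀ c ∈ (A ∪ B)ᶜ, f c = s := fun c hc =>
    ((hf c (mem_compl.1 hc)).2.1 s (mem_union_left _ hs) (hadj c hc).symm).symm
  have honly : ∀ c ∈ (A ∪ B)ᶜ, ∀ y ∈ A ∪ B, G.Adj c y → y = s := fun c hc y hy hcy =>
    ((hf c (mem_compl.1 hc)).2.1 y hy hcy).trans (hfs c hc)
  have hdg0 : ∀ y ∈ A ∪ B, y ≠ s → G.dg (A ∪ B)ᶜ y = 0 := fun y hy hys =>
    dg_eq_zero_iff.2 fun c hc hyc => hys (honly c hc y hy hyc.symm)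
  have hsB : ∀ b ∈ B, b ≠ s := fun b hb hbs => Finset.disjoint_left.1 h.disj hs (hbs ▸ hb)
  obtain ⟨H, hH⟩ : ∃ H, H = κ * #(A ∪ B)ᶜ / (lam - κ * #(A ∪ B)ᶜ) := ⟨_, rfl⟩
  have hH0 : 0 < H := by rw [hH]; positivity
  have hH1 : H < 1 := by rw [hH, div_lt_one hp]; linarith
  have hHe : lam / (lam - κ * #(A ∪ B)ᶜ) = 1 + H := by rw [hH]; field_simp; ring
  have hBb : ∀ b ∈ B, lam * x b ≤ ∑ a ∈ A, x a := by
    intro b hb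
    have := h.symm.mul_le_left (f := f) (κ := κ) (by rwa [union_comm]) hκ0
      (by rwa [union_comm]) hb
    rw [union_comm B A, hdg0 b (mem_union_right _ hb) (hsB b hb)] at this
    simpa using this
  have hAsum : ∀ a ∈ A, lam * x a - κ * G.dg (A ∪ B)ᶜ a * x a ≤ ∑ b ∈ B with G.Adj a b, x b := by
    intro a ha
    have e := h.mul_eq_left ha
    have := hf.sum_outer_le h.nonneg h.eig hκ0 hκ (mem_union_left B ha)
    linarith
  have hAa : ∀ a ∈ A, lam * x a - κ * G.dg (A ∪ B)ᶜ a * x a ≤ ∑ b ∈ B, x b := fun a ha =>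
    (hAsum a ha).trans (sum_filter_le_sum h.nonneg _)
  have hxs : κ * #(A ∪ B)ᶜ * x s ≤ H * ∑ b ∈ B, x b := by
    have := hAa s hs
    rw [hdg] at this
    rw [hH, div_mul_eq_mul_div, le_div_iff₀ hp]
    have := mul_le_mul_of_nonneg_left this (by positivity : 0 ≤ κ * #(A ∪ B)ᶜ)
    linarith
  have hsumd : ∑ a ∈ A, (lam * x a - κ * G.dg (A ∪ B)ᶜ a * x a) =
      lam * ∑ a ∈ A, x a - κ * #(A ∪ B)ᶜ * x s := by
    have e : ∑ a ∈ A, κ * G.dg (A ∪ B)ᶜ a * x a = κ * G.dg (A ∪ B)ᶜ s * x s :=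
      sum_eq_single_of_mem s hs fun a ha has => by
        rw [hdg0 a (mem_union_left _ ha) has]; simp
    rw [sum_sub_distrib, ← mul_sum, e, hdg]
  have hA1 : lam * ∑ a ∈ A, x a ≤ (#A + H) * ∑ b ∈ B, x b := by
    have := sum_le_card_nsmul A _ _ hAa
    rw [hsumd, nsmul_eq_mul] at this
    linarith
  have hB1 : lam * ∑ b ∈ B, x b ≤ #B * ∑ a ∈ A, x a := by
    have := sum_le_card_nsmul B _ _ hBb
    rwa [← mul_sum, nsmul_eq_mul] at this
  have hupp : lam ^ 2 ≤ (#A + H) * #B := by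
    have := mul_le_mul hA1 hB1 (by positivity) (by positivity)
    refine le_of_mul_le_mul_right (a := (∑ a ∈ A, x a) * ∑ b ∈ B, x b) ?_ (by positivity)
    linarith
  rw [hHe] at hlow
  have hlow' : (((#A + #B) - (#A + #B) / 2 : ℕ) : ℝ) * (((#A + #B) / 2 : ℕ) + H) ≤ lam ^ 2 := by
    linarith
  have hcards := eq_half_of_mul_le rfl hH0 hH1 (hlow'.trans hupp)
  rw [← hcards.2, ← hcards.1] at hlow'
  have hlamsq : lam ^ 2 = (#A + H) * #B := le_antisymm hupp (by linarith)
  have hB2 : #B * ∑ a ∈ A, x a ≤ lam * ∑ b ∈ B, x b := by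
    refine le_of_mul_le_mul_left (a := lam) ?_ hlam
    have := mul_le_mul_of_nonneg_left hA1 (Nat.cast_nonneg (α := ℝ) #B)
    have e : lam * (lam * ∑ b ∈ B, x b) = #B * ((#A + H) * ∑ b ∈ B, x b) := by
      linear_combination hlamsq * ∑ b ∈ B, x b
    rw [e]; linarith
  have hBpos : (0 : ℝ) < #B := by
    by_contra hcon
    have : 0 < lam ^ 2 := by positivity
    have := mul_nonpos_of_nonneg_of_nonpos
      (add_nonneg (Nat.cast_nonneg _) hH0.le : 0 ≤ #A + H) (not_lt.1 hcon)
    linarith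
  have hA2 : (#A + H) * ∑ b ∈ B, x b ≤ lam * ∑ a ∈ A, x a := by
    refine le_of_mul_le_mul_left (a := (#B : ℝ)) ?_ hBpos
    have := mul_le_mul_of_nonneg_left hB1 hlam.le
    have e : lam * (lam * ∑ b ∈ B, x b) = #B * ((#A + H) * ∑ b ∈ B, x b) := by
      linear_combination hlamsq * ∑ b ∈ B, x b
    linarith
  have hBeq : ∀ b ∈ B, lam * x b = ∑ a ∈ A, x a :=
    eq_of_card_mul_le_sum hBb (by rwa [← mul_sum])
  have hAeq : ∀ a ∈ A, lam * x a - κ * G.dg (A ∪ B)ᶜ a * x a = ∑ b ∈ B, x b :=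
    eq_of_card_mul_le_sum hAa (by rw [hsumd]; linarith)
  have hxB : ∀ b ∈ B, 0 < x b := fun b hb =>
    pos_of_mul_pos_right (by rw [hBeq b hb]; exact hXA0) hlam.le
  have hAB : ∀ a ∈ A, ∀ b ∈ B, G.Adj a b := by
    intro a ha b hb
    by_contra hab
    have h6 := hAsum a ha
    rw [hAeq a ha] at h6
    have h7 : ∑ b ∈ B with G.Adj a b, x b < ∑ b ∈ B, x b :=
      sum_lt_sum_of_subset (filter_subset _ _) hb (by simp [hab]) (hxB b hb) fun w _ _ => h.nonneg w
    linarith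
  have hs0 : 0 < x s := by
    have := hAeq s hs
    rw [hdg, ← sub_mul] at this
    exact pos_of_mul_pos_right (by rw [this]; exact hXB0) hp.le
  have hWle : ∀ c ∈ (A ∪ B)ᶜ, x c ≤ κ * x s := fun c hc => by
    have := hf.le_mul h.nonneg h.eig hκ0 hκ (mem_compl.1 hc)
    rwa [hfs c hc] at this
  have hWeq : ∀ c ∈ (A ∪ B)ᶜ, x c = κ * x s := by
    refine eq_of_card_mul_le_sum hWle ?_
    have e := h.mul_eq_left hs
    have e1 := hAeq s hs
    rw [hdg] at e1
    have e2 := sum_filter_le_sum (S := B) h.nonneg (G.Adj s)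
    rw [filter_true_of_mem hadj] at e
    linarith
  have hW : ∀ c ∈ (A ∪ B)ᶜ, ∀ c' ∈ (A ∪ B)ᶜ, c ≠ c' → G.Adj c c' := by
    intro c hc c' hc' hne'
    by_contra hcc
    have e1 : lam * x c ≤ x s + ∑ w ∈ (((A ∪ B)ᶜ).erase c).erase c', x w := by
      rw [h.eig, ← sum_insert (by simp [hs])]
      refine sum_le_sum_of_subset_of_nonneg (fun w hw => ?_) fun w _ _ => h.nonneg w
      rw [mem_filter] at hw
      by_cases hwC : w ∈ A ∪ B
      · exact mem_insert.2 (Or.inl (honly c hc w hwC hw.2))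
      · refine mem_insert_of_mem (mem_erase.2 ⟨fun e => hcc (e ▸ hw.2), mem_erase.2
          ⟨hw.2.ne', mem_compl.2 hwC⟩⟩)
    rw [sum_congr rfl fun w hw => hWeq w (mem_of_mem_erase (mem_of_mem_erase hw)), sum_const,
      nsmul_eq_mul, hWeq c hc] at e1
    have e2 : #((((A ∪ B)ᶜ).erase c).erase c') + 2 = #(A ∪ B)ᶜ := by
      have := card_erase_add_one (mem_erase.2 ⟨hne'.symm, hc'⟩)
      have := card_erase_add_one hc
      omega
    have e3 : (#((((A ∪ B)ᶜ).erase c).erase c') + 2 : ℝ) = #(A ∪ B)ᶜ := by exact_mod_cast e2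
    have e4 : κ * lam * x s = x s + (κ * (#(A ∪ B)ᶜ - 1)) * x s := by
      linear_combination hκ * x s
    have e5 : 0 < κ * x s := by positivity
    rw [← e3] at e4
    linarith
  refine ⟨⟨hs, h.disj, ?_, ?_, ?_, ?_⟩, hcards⟩
  · exact disjoint_compl_right.mono_left subset_union_left
  · exact disjoint_compl_right.mono_left subset_union_right
  · intro v
    by_cases hv : v ∈ A ∪ B
    · rcases mem_union.1 hv with hv | hv <;> simp [hv]
    · exact Or.inr (Or.inr (mem_compl.2 hv))
  · intro u v
    constructor
    · intro huv
      refine ⟨huv.ne, ?_⟩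
      by_cases hu : u ∈ (A ∪ B)ᶜ
      · refine Or.inr (Or.inr ⟨mem_insert_of_mem hu, ?_⟩)
        by_cases hv : v ∈ (A ∪ B)ᶜ
        · exact mem_insert_of_mem hv
        · exact mem_insert.2 (Or.inl (honly u hu v (by_contra fun hc => hv (mem_compl.2 hc)) huv))
      · by_cases hv : v ∈ (A ∪ B)ᶜ
        · exact Or.inr (Or.inr ⟨mem_insert.2 (Or.inl (honly v hv u
            (by_contra fun hc => hu (mem_compl.2 hc)) huv.symm)), mem_insert_of_mem hv⟩)
        · have hu' : u ∈ A ∪ B := by_contra fun hc => hu (mem_compl.2 hc)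
          have hv' : v ∈ A ∪ B := by_contra fun hc => hv (mem_compl.2 hc)
          rcases mem_union.1 hu' with hu' | hu' <;> rcases mem_union.1 hv' with hv' | hv'
          · exact absurd huv (h.not_adj_left hu' hv')
          · exact Or.inl ⟨hu', hv'⟩
          · exact Or.inr (Or.inl ⟨hu', hv'⟩)
          · exact absurd huv (h.symm.not_adj_left hu' hv')
    · rintro ⟨hne', ⟨hu, hv⟩ | ⟨hu, hv⟩ | ⟨hu, hv⟩⟩
      · exact hAB u hu v hv
      · exact (hAB v hv u hu).symm
      · rcases mem_insert.1 hu with hu | hu <;> rcases mem_insert.1 hv with hv | hv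
        · exact absurd (hu.trans hv.symm) hne'
        · exact hu ▸ hadj v hv
        · exact hv ▸ (hadj u hu).symm
        · exact hW u hu v hv hne'

/-- An anchored graph attaining the spectral bound is a suspended balanced complete bipartite
graph. -/
theorem SpectralCore.exists_isTuranSusp (h : G.SpectralCore k A B x lam) {f : V → V} {κ : ℝ}
    (hf : G.IsAnchored (A ∪ B) f) (hκ : κ * (lam - #(A ∪ B)ᶜ + 1) = 1)
    (hne : ((A ∪ B)ᶜ).Nonempty)
    (hlow : (((#A + #B) - (#A + #B) / 2 : ℕ) : ℝ) * (((#A + #B) / 2 : ℕ) - 1 +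
      lam / (lam - κ * #(A ∪ B)ᶜ)) ≤ lam ^ 2) :
    ∃ s A' B', G.IsTuranSusp s A' B' (A ∪ B)ᶜ ∧ #A' = (#A + #B) / 2 ∧
      #B' = #A + #B - (#A + #B) / 2 := by
  obtain ⟨s, hs, hdg⟩ := h.exists_dg_eq hf hκ hne hlow
  rcases mem_union.1 hs with hs | hs
  · exact ⟨s, A, B, h.isTuranSusp_left hf hκ hne hlow hs hdg⟩
  · refine ⟨s, B, A, ?_⟩
    have := h.symm.isTuranSusp_left (f := f) (κ := κ) (s := s)
    rw [union_comm B A, add_comm #B #A] at this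
    exact this hf hκ hne hlow hs hdg

end Extremal

section Stability

open Finset

variable {V : Type*} [Fintype V] [DecidableEq V] {G : SimpleGraph V} [DecidableRel G.Adj]
  {k r : ℕ} {A B : Finset V} {x : V → ℝ} {lam : ℝ}

/-- Either `G` is bipartite up to fewer than `r - 1` anchored vertices, or it is the extremal
graph. -/
theorem SpectralCore.exists_anchored_or_isTuranSusp (h : G.SpectralCore k A B x lam) (hr2 : 2 ≤ r)
    (hr : r ≤ 2 * k) (hq : Fintype.card V - r + 1 - 0.9 / Fintype.card V ≤ 2 * lam)
    (hlow : ∀ (q w : ℕ) (κ : ℝ), q + w = Fintype.card V → w + 1 = r → κ * (lam - w + 1) = 1 →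
      0 < lam - κ * w →
      ((q - q / 2 : ℕ) : ℝ) * ((q / 2 : ℕ) - 1 + lam / (lam - κ * w)) ≤ lam ^ 2) :
    (∃ (S : Finset V) (col : V → ZMod 2) (f : V → V), S.Nonempty ∧ #Sᶜ ≤ r - 2 ∧
      (∀ x ∈ S, ∀ y ∈ S, G.Adj x y → col x ≠ col y) ∧ G.IsAnchored S f) ∨
    ∃ s A' B' W', G.IsTuranSusp s A' B' W' ∧ #W' + 1 = r ∧
      #A' = (Fintype.card V - #W') / 2 ∧ #B' = Fintype.card V - #W' -
        (Fintype.card V - #W') / 2 := by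
  have hXA := h.sum_ge'.1
  have hn := h.card_pos
  have hne : (A ∪ B).Nonempty := by
    by_contra hcon
    rw [not_nonempty_iff_eq_empty, union_eq_empty] at hcon
    rw [hcon.1, sum_empty] at hXA
    linarith
  obtain ⟨S, col, f, hKS, hcol, hf⟩ := (h.earCompatible hr hq).exists_extension
    (hne.mono subset_union_left)
  have hCS : A ∪ B ⊆ S := subset_union_left.trans hKS
  by_cases hS : #Sᶜ ≤ r - 2
  · exact Or.inl ⟨S, col, f, hne.mono hCS, hS, hcol, hf⟩
  right
  have hp := h.pend_add_le_of_le hq (e := 0) (by norm_num) (Nat.zero_le _)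
  have hSp : Sᶜ ⊆ G.pend (A ∪ B) := by
    intro c hc
    rw [mem_compl] at hc
    have h1 : c ∉ A ∪ B := fun h => hc (hCS h)
    have h2 : c ∉ G.multi (A ∪ B) := fun h => hc (hKS (mem_union_right _ h))
    rw [mem_multi (G := G)] at h2
    rw [mem_pend (G := G)]
    exact ⟨h1, by by_contra h3; exact h2 ⟨h1, by omega⟩⟩
  have hSp' := card_le_card hSp
  have hμ : #(G.multi (A ∪ B)) = 0 := by
    by_contra hcon
    have := h.pend_add_le_of_le hq (e := 1) (by norm_num) (by omega)
    omega
  have hcard := card_multi_add_card_pend (G := G) (A ∪ B)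
  have hSC : S = A ∪ B := by
    have : Sᶜ = (A ∪ B)ᶜ := eq_of_subset_of_card_le (compl_subset_compl.2 hCS) (by omega)
    exact compl_injective this
  subst hSC
  have hw : #(A ∪ B)ᶜ + 1 = r := by omega
  have hqw : #A + #B + #(A ∪ B)ᶜ = Fintype.card V := by
    rw [← card_union_of_disjoint h.disj, card_add_card_compl]
  have h1 := h.card_outer_le_card
  have h2 := h.lam_ge
  have hκ : (1 / (lam - #(A ∪ B)ᶜ + 1)) * (lam - #(A ∪ B)ᶜ + 1) = 1 :=
    one_div_mul_cancel (by linarith)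
  have hκw := (h.mul_card_outer_le hκ).2
  obtain ⟨s, A', B', hT, hA', hB'⟩ := h.exists_isTuranSusp hf hκ (Finset.card_pos.1 (by omega))
    (hlow _ _ _ hqw hw hκ (by linarith))
  refine ⟨s, A', B', _, hT, hw, ?_, ?_⟩
  · rw [hA', ← hqw, Nat.add_sub_cancel]
  · rw [hB', ← hqw, Nat.add_sub_cancel]

theorem exists_spectralCore [Nonempty V] (hk : 2 ≤ k) (hn : 712 * k ≤ Fintype.card V)
    (hfree : G.CycleFree (2 * k + 1)) (hlam : (Fintype.card V : ℝ) / 2 - k ≤ G.specRad) :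
    ∃ A B x, G.SpectralCore k A B x G.specRad := by
  obtain ⟨x, hx0, hxne, heig, -⟩ := G.exists_nonneg_eigenvector
  obtain ⟨u, -, hu⟩ := exists_max_image univ x univ_nonempty
  have hxu : 0 < x u := by
    obtain ⟨v, hv⟩ := Function.ne_iff.1 hxne
    exact (lt_of_le_of_ne (hx0 v) (Ne.symm hv)).trans_le (hu v (mem_univ v))
  have heig' : ∀ v, G.specRad * (x v / x u) = ∑ w with G.Adj v w, x w / x u := fun v => by
    rw [← sum_div, ← heig, mul_div_assoc]
  have hle : ∀ v, x v / x u ≤ 1 := fun v => (div_le_one hxu).2 (hu v (mem_univ v))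
  have hn' : 712 * (k : ℝ) ≤ Fintype.card V := by exact_mod_cast hn
  have hk0 : (0 : ℝ) ≤ k := Nat.cast_nonneg _
  obtain ⟨A, B, h1, h2, h3, h4, h5, h6, h7⟩ := exists_dense_pair hk hn hfree
    (pow_le_pow_left₀ (by linarith) hlam 2) hle (div_self hxu.ne') heig'
  exact ⟨A, B, fun v => x v / x u, hk, hn', hfree, h1, h2, h3, fun v hA hB => (h4 v hA hB).1,
    fun v hA hB => (h4 v hA hB).2, h5, h6, h7, hlam, fun v => div_nonneg (hx0 v) hxu.le, hle,
    ⟨u, div_self hxu.ne'⟩, heig'⟩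

end Stability

section Main

open Finset

theorem sq_sub_one_le_half_mul_half (q : ℕ) :
    (q : ℝ) ^ 2 - 1 ≤ 4 * ((q / 2 : ℕ) * (q - q / 2 : ℕ)) := by
  have h1 : (q / 2 : ℕ) + (q - q / 2 : ℕ) = q := by omega
  have h2 : (q - q / 2 : ℕ) ≤ q / 2 + 1 := by omega
  have h3 : q / 2 ≤ (q - q / 2 : ℕ) := by omega
  generalize q - q / 2 = β at *
  generalize q / 2 = α at *
  subst h1
  have h2' : (β : ℝ) ≤ α + 1 := by exact_mod_cast h2
  have h3' : (α : ℝ) ≤ β := by exact_mod_cast h3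
  push_cast
  nlinarith

theorem sub_le_two_mul_of_low {q w n : ℕ} {lam : ℝ} (hqw : q + w = n) (hn : 1424 ≤ (n : ℝ))
    (hw : (w : ℝ) ≤ n / 356) (hlam : (n : ℝ) / 2 - n / 712 ≤ lam)
    (hlow : ∀ κ : ℝ, κ * (lam - w + 1) = 1 → 0 < lam - κ * w →
      ((q - q / 2 : ℕ) : ℝ) * ((q / 2 : ℕ) - 1 + lam / (lam - κ * w)) ≤ lam ^ 2) :
    (q : ℝ) - 0.9 / n ≤ 2 * lam := by
  have hqw' : (q : ℝ) + w = n := by exact_mod_cast hqw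
  have hw0 : (0 : ℝ) ≤ w := Nat.cast_nonneg _
  have hpos : 0 < lam - w + 1 := by linarith
  have hκ : 1 / (lam - w + 1) * (lam - w + 1) = 1 := one_div_mul_cancel hpos.ne'
  have hκ0 : 0 < 1 / (lam - w + 1) := by positivity
  have hκw : 1 / (lam - w + 1) * w ≤ 1 := by
    rw [one_div_mul_eq_div, div_le_one hpos]; linarith
  have hκw0 : 0 ≤ 1 / (lam - w + 1) * w := by positivity
  have hp : 0 < lam - 1 / (lam - w + 1) * w := by linarith
  have h1 := hlow _ hκ hp
  have h2 : 1 ≤ lam / (lam - 1 / (lam - w + 1) * w) := by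
    rw [le_div_iff₀ hp]; linarith
  have h3 : ((q - q / 2 : ℕ) : ℝ) * (q / 2 : ℕ) ≤ lam ^ 2 :=
    (mul_le_mul_of_nonneg_left (by linarith) (Nat.cast_nonneg _)).trans h1
  have h4 := sq_sub_one_le_half_mul_half q
  obtain ⟨ε, hε⟩ : ∃ ε : ℝ, ε = 0.9 / n := ⟨_, rfl⟩
  have hεn : ε * n = 0.9 := by rw [hε]; field_simp
  have hε0 : 0 < ε := by rw [hε]; positivity
  have hε1 : ε ≤ 0.001 := by rw [hε, div_le_iff₀ (by linarith)]; linarith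
  rw [← hε]
  have h5 : 0.89 ≤ ε * q := by
    have := mul_le_mul_of_nonneg_left hw hε0.le
    have : ε * q = ε * n - ε * w := by rw [← hqw']; ring
    linarith
  have h6 : ε ^ 2 ≤ 0.001 ^ 2 := by gcongr
  refine le_of_sq_le_sq ?_ (by linarith)
  nlinarith

theorem turanSuspAt_bounds {n q w : ℕ} (hq : 2 ≤ q) (hqw : q + w = n) {lam : ℝ}
    (hlam : (turanSuspAt n q 0).specRad ≤ lam) :
    (q : ℝ) ^ 2 - 1 ≤ 2 * lam * q ∧
    ∀ κ : ℝ, 0 < lam → κ * (lam - w + 1) = 1 → 0 < lam - κ * w →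
      ((q - q / 2 : ℕ) : ℝ) * ((q / 2 : ℕ) - 1 + lam / (lam - κ * w)) ≤ lam ^ 2 := by
  classical
  have : Nonempty (Fin n) := ⟨⟨0, by omega⟩⟩
  obtain ⟨-, -, -, -, hray⟩ := (turanSuspAt n q 0).exists_nonneg_eigenvector
  have hray' : ∀ y : Fin n → ℝ, (turanSuspAt n q 0).adjForm y y ≤ lam * ∑ v, y v ^ 2 :=
    fun y => (hray y).trans
      (mul_le_mul_of_nonneg_right hlam (sum_nonneg fun _ _ => sq_nonneg _))
  have hT := isTuranSusp_turanSuspAt n q hq (by omega)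
  obtain ⟨hA, hB, hW⟩ := card_turan_classes n q (by omega)
  have hw : n - q = w := by omega
  constructor
  · have h1 := hT.two_mul_le hray'
    have h2 := sq_sub_one_le_half_mul_half q
    rw [hA, hB] at h1
    have h3 : ((q / 2 : ℕ) : ℝ) + (q - q / 2 : ℕ) = q := by
      have : q / 2 + (q - q / 2) = q := by omega
      exact_mod_cast this
    rw [h3] at h1
    linarith
  · intro κ hlam0 hκ hκ0
    have h1 := hT.le_sq (κ := κ) hlam0 hray'
    rw [hA, hB, hW, hw] at h1
    exact h1 hκ hκ0

theorem familyG_of_isAnchored {n r : ℕ} {G : SimpleGraph (Fin n)} {S : Finset (Fin n)}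
    {col : Fin n → ZMod 2} {f : Fin n → Fin n} (hne : S.Nonempty) (hS : #Sᶜ ≤ r - 2)
    (hcol : ∀ x ∈ S, ∀ y ∈ S, G.Adj x y → col x ≠ col y) (hf : G.IsAnchored S f) :
    FamilyG n r G := by
  obtain ⟨s₀, hs₀⟩ := hne
  have hU : univ.biUnion (fun i => ({c ∈ Sᶜ | f c = i} : Finset (Fin n))) = Sᶜ := by
    ext c
    simp
  refine ⟨n, fun i => {c ∈ Sᶜ | f c = i}, fun i => if i ∈ S then i else s₀, ?_⟩
  rw [hU]
  refine ⟨?_, hS, ?_, ⟨{v | col v = 0}, ?_⟩, ?_, ?_⟩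
  · intro i j hij
    rw [Finset.disjoint_left]
    intro c hc hc'
    rw [mem_filter] at hc hc'
    exact hij (hc.2.symm.trans hc'.2)
  · intro i
    rw [mem_compl, not_not]
    beta_reduce
    split_ifs with h
    · exact h
    · exact hs₀
  · intro x y hxy hx hy
    rw [mem_compl, not_not] at hx hy
    have := hcol x hx y hy hxy
    simp only [Set.mem_ofPred_eq]
    generalize col x = a at *
    generalize col y = b at *
    revert a b
    decide
  · intro i j hij c hc c' hc' hadj
    rw [mem_filter, mem_compl] at hc hc'
    exact hij (hc.2.symm.trans (((hf c hc.1).2.2 c' hc'.1 hadj).trans hc'.2))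
  · intro i c hc y hy hyS
    rw [mem_filter, mem_compl] at hc
    rw [mem_compl, not_not] at hyS
    beta_reduce
    rw [← hc.2, if_pos (hf c hc.1).1]
    exact (hf c hc.1).2.1 y hyS hy

theorem familyG_or_nonempty_iso (k r n : ℕ) (hk : 2 ≤ k) (hr3 : 3 ≤ r) (hr : r ≤ 2 * k)
    (hn : 712 * k ≤ n) (G : SimpleGraph (Fin n))
    (hfree : G.CycleFree (2 * k + 1))
    (hlam : (turanSuspAt n (n - r + 1) 0).specRad ≤ G.specRad) :
    FamilyG n r G ∨ Nonempty (G ≃g turanSuspAt n (n - r + 1) 0) := by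
  classical
  have : Nonempty (Fin n) := ⟨⟨0, by omega⟩⟩
  obtain ⟨w, rfl⟩ : ∃ w, r = w + 1 := ⟨r - 1, by omega⟩
  have hqe : n - (w + 1) + 1 = n - w := by omega
  rw [hqe] at hlam ⊢
  obtain ⟨q, hq⟩ : ∃ q, q = n - w := ⟨_, rfl⟩
  rw [← hq] at hlam ⊢
  have hqw : q + w = n := by omega
  obtain ⟨hlow1, hlow2⟩ := turanSuspAt_bounds (by omega) hqw hlam
  have hqR : (q : ℝ) + w = n := by exact_mod_cast hqw
  have hkR : (2 : ℝ) ≤ k := by exact_mod_cast hk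
  have hnR : 712 * (k : ℝ) ≤ n := by exact_mod_cast hn
  have hrR : (w : ℝ) + 1 ≤ 2 * k := by exact_mod_cast hr
  have hlam1 : (n : ℝ) / 2 - k ≤ G.specRad := by
    by_contra! hcon
    have : (2 * G.specRad) * q ≤ (q - 1) * q :=
      mul_le_mul_of_nonneg_right (by linarith) (Nat.cast_nonneg _)
    linarith
  obtain ⟨A, B, x, h⟩ := exists_spectralCore hk (by rwa [Fintype.card_fin]) hfree
    (by rwa [Fintype.card_fin])
  have hlam0 : 0 < G.specRad := by linarith
  have hq1 : (Fintype.card (Fin n) : ℝ) - (w + 1 : ℕ) + 1 - 0.9 / (Fintype.card (Fin n) : ℝ) ≤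
      2 * G.specRad := by
    rw [Fintype.card_fin]
    have h1 := sub_le_two_mul_of_low hqw (by linarith) (by linarith) (by linarith)
      fun κ => hlow2 κ hlam0
    push_cast
    linarith
  rcases h.exists_anchored_or_isTuranSusp (by omega) hr hq1 (fun q' w' κ h1 h2 h3 h4 => by
      obtain rfl : w' = w := by omega
      obtain rfl : q' = q := by rw [Fintype.card_fin] at h1; omega
      exact hlow2 κ hlam0 h3 h4) with
    ⟨S, col, f, hne, hS, hcol, hf⟩ | ⟨s, A', B', W', hT, hW, hA, hB⟩
  · exact Or.inl (familyG_of_isAnchored hne hS hcol hf)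
  · right
    obtain ⟨hA', hB', hW'⟩ := card_turan_classes n q (by omega)
    have hWq : n - #W' = q := by omega
    rw [Fintype.card_fin, hWq] at hA hB
    exact hT.nonempty_iso (isTuranSusp_turanSuspAt n q (by omega) (by omega)) (hA.trans hA'.symm)
      (hB.trans hB'.symm) (by omega)

end Main

end SimpleGraph

/-- Theorem: strong spectral stability for `C_{2k+1}`-free graphs.
If `k ≥ 2`, `3 ≤ r ≤ 2k`, `n ≥ 712 k`, and `G` is an `n`-vertex `C_{2k+1}`-free graph with
`λ(G) ≥ λ(T_{n-r+1,2} ∘ K_r)`, then `G ∈ 𝒢_{n,r}`, unless `G = T_{n-r+1,2} ∘ K_r`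
(the clique attached at a vertex of the part of size `⌊(n-r+1)/2⌋`). -/
theorem stmt_3 (k r n : ℕ) (hk : 2 ≤ k) (hr3 : 3 ≤ r) (hr : r ≤ 2 * k)
    (hn : 712 * k ≤ n) (G : SimpleGraph (Fin n))
    (hfree : G.CycleFree (2 * k + 1))
    (hlam : (turanSuspAt n (n - r + 1) 0).specRad ≤ G.specRad) :
    FamilyG n r G ∨ Nonempty (G ≃g turanSuspAt n (n - r + 1) 0) :=
  SimpleGraph.familyG_or_nonempty_iso k r n hk hr3 hr hn G hfree hlam
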